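/- Suppose λ_n = n·p_n → ∞ as n→∞. Then the minimal weight W_n between two uniformly chosen vertices of G_n(p_n), conditioned on the two vertices being connected, satisfies: the conditional law of (λ_n−1)·W_n − log n converges weakly, as n→∞, to the law of M₁ + M₂ − M₃, where M₁, M₂, M₃ are independent standard Gumbel random variables, i.e., each M_i has cumulative distribution function Λ(x) = exp(−e^{−x}) for x ∈ ℝ. -/

import Mathlib

/-!
First passage percolation on the Erdős–Rényi random graph `G_n(p_n)` with i.i.d. rate-1
exponential edge weights.  CLT for the hopcount between two uniformly chosen vertices
(by exchangeability, vertices `0` and `1`), conditioned on the two vertices being connected: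
if `n pₙ → λ > 1` and `β = λ/(λ-1)` then `(Hₙ - β log n)/√(β log n) ⇒ N(0,1)`.
(The graph on `n` vertices is indexed here as `Fin (n+2)` so that the two chosen vertices
always exist; the limit `n → ∞` is unaffected.)
-/

open MeasureTheory ProbabilityTheory Filter Real
open scoped ENNReal NNReal

noncomputable section

/-- The exponential distribution with rate 1 on `ℝ`. -/
def expDist : Measure ℝ :=
  volume.withDensity (fun x => if 0 ≤ x then ENNReal.ofReal (Real.exp (-x)) else 0)

/-- The Bernoulli distribution on `Bool` with success probability `p`. -/
def bernoulliDist (p : ℝ) : Measure Bool :=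
  ENNReal.ofReal p • Measure.dirac true + ENNReal.ofReal (1 - p) • Measure.dirac false

/-- The (random) Erdős–Rényi graph determined by the edge indicators: the first component of
`Z e` tells whether the edge `e` is present. -/
def theGraph {n : ℕ} (Z : Sym2 (Fin n) → Bool × ℝ) : SimpleGraph (Fin n) where
  Adj a b := a ≠ b ∧ (Z s(a, b)).1 = true
  symm := by
    constructor
    intro a b h
    refine ⟨h.1.symm, ?_⟩
    rw [Sym2.eq_swap]
    exact h.2
  loopless := by constructor; intro a h; exact h.1 rfl

/-- Effective edge weights: the exponential weight on present edges, `∞` on absent ones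
(and on loops). -/
def effWeight {n : ℕ} (Z : Sym2 (Fin n) → Bool × ℝ) (a b : Fin n) : ℝ≥0∞ :=
  if a ≠ b ∧ (Z s(a, b)).1 = true then ENNReal.ofReal (Z s(a, b)).2 else ⊤

/-- Total weight of a walk `q` with `k` steps. -/
def walkWeight {n : ℕ} (w : Fin n → Fin n → ℝ≥0∞) {k : ℕ} (q : Fin (k + 1) → Fin n) : ℝ≥0∞ :=
  ∑ t : Fin k, w (q t.castSucc) (q t.succ)

/-- The minimal total weight over all paths (walks) from `i` to `j`; `∞` iff `i`, `j` are
not connected in the graph of finite-weight edges. -/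
def minWeight {n : ℕ} (w : Fin n → Fin n → ℝ≥0∞) (i j : Fin n) : ℝ≥0∞ :=
  ⨅ (k : ℕ) (q : Fin (k + 1) → Fin n) (_ : q 0 = i ∧ q (Fin.last k) = j), walkWeight w q

/-- The hopcount: the number of edges of the minimal-weight path from `i` to `j`
(the minimal number of edges among weight-minimizing walks; almost surely the minimal-weight
path is unique, and then this is its number of edges). -/
def hopCount {n : ℕ} (w : Fin n → Fin n → ℝ≥0∞) (i j : Fin n) : ℕ :=
  sInf {k : ℕ | ∃ q : Fin (k + 1) → Fin n,
    q 0 = i ∧ q (Fin.last k) = j ∧ walkWeight w q = minWeight w i j}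

/-- The standard Gumbel distribution on `ℝ`, with cumulative distribution function
`Λ(x) = exp(-e^{-x})` and hence density `exp(-x - e^{-x})`. -/
def gumbelDist : Measure ℝ :=
  volume.withDensity (fun x => ENNReal.ofReal (Real.exp (-x - Real.exp (-x))))

/-- The law of `M₁ + M₂ - M₃` for `M₁, M₂, M₃` independent standard Gumbel random variables. -/
def gumbelLimitLaw : Measure ℝ :=
  (gumbelDist.prod (gumbelDist.prod gumbelDist)).map
    (fun v : ℝ × ℝ × ℝ => v.1 + v.2.1 - v.2.2)

/-- Bellman–Ford relaxation. -/
def relax {m : ℕ} (y : Fin m → ℝ≥0∞) (x : Sym2 (Fin m) → ℝ≥0∞) : ℕ → Fin m → ℝ≥0∞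
  | 0 => y
  | k + 1 => fun u => relax y x k u ⊓ ⨅ w, (relax y x k w + x s(w, u))

/-- Distance from a super-source. -/
def sdist {m : ℕ} (y : Fin m → ℝ≥0∞) (x : Sym2 (Fin m) → ℝ≥0∞) (u : Fin m) : ℝ≥0∞ :=
  ⨅ k, relax y x k u

theorem sdist_le {m : ℕ} (y : Fin m → ℝ≥0∞) (x : Sym2 (Fin m) → ℝ≥0∞) (u : Fin m) :
    sdist y x u ≤ y u := iInf_le _ 0

theorem sdist_step {m : ℕ} (y : Fin m → ℝ≥0∞) (x : Sym2 (Fin m) → ℝ≥0∞) (u w : Fin m) :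
    sdist y x u ≤ sdist y x w + x s(w, u) := by
  unfold sdist
  rw [ENNReal.iInf_add]
  refine le_iInf fun k => ?_
  refine (iInf_le _ (k + 1)).trans ?_
  exact inf_le_right.trans (iInf_le _ w)

theorem sdist_greatest {m : ℕ} (y : Fin m → ℝ≥0∞) (x : Sym2 (Fin m) → ℝ≥0∞)
    (pot : Fin m → ℝ≥0∞) (h0 : ∀ u, pot u ≤ y u) (h1 : ∀ u w, pot u ≤ pot w + x s(w, u)) (u : Fin m) :
    pot u ≤ sdist y x u := by
  have key : ∀ k u, pot u ≤ relax y x k u := by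
    intro k
    induction k with
    | zero => exact h0
    | succ k ih =>
      intro u
      refine le_inf (ih u) (le_iInf fun w => (h1 u w).trans ?_)
      gcongr
      exact ih w
  exact le_iInf fun k => key k u

theorem measurable_sdist {m : ℕ} (u : Fin m) :
    Measurable (fun z : (Fin m → ℝ≥0∞) × (Sym2 (Fin m) → ℝ≥0∞) => sdist z.1 z.2 u) := by
  have key : ∀ k u, Measurable
      (fun z : (Fin m → ℝ≥0∞) × (Sym2 (Fin m) → ℝ≥0∞) => relax z.1 z.2 k u) := by
    intro k
    induction k with
    | zero => intro u; exact (measurable_pi_apply u).comp measurable_fst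
    | succ k ih =>
      intro u
      refine (ih u).inf (Measurable.iInf fun w => (ih w).add ?_)
      exact (measurable_pi_apply _).comp measurable_snd
  exact Measurable.iInf fun k => key k u

/-- The rest of the edge weights after removal of `v`. -/
def xrest {m : ℕ} (v : Fin (m + 1)) (x : Sym2 (Fin (m + 1)) → ℝ≥0∞) : Sym2 (Fin m) → ℝ≥0∞ :=
  fun e => x (e.map v.succAbove)

/-- The row of edge weights at `v`. -/
def xrow {m : ℕ} (v : Fin (m + 1)) (x : Sym2 (Fin (m + 1)) → ℝ≥0∞) : Fin m → ℝ≥0∞ :=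
  fun u => x s(v, v.succAbove u)

theorem xrest_mk {m : ℕ} (v : Fin (m + 1)) (x : Sym2 (Fin (m + 1)) → ℝ≥0∞) (a b : Fin m) :
    xrest v x s(a, b) = x s(v.succAbove a, v.succAbove b) := rfl

/-- The updated source weights after absorbing `v`. -/
def ynew {m : ℕ} (v : Fin (m + 1)) (y : Fin (m + 1) → ℝ≥0∞)
    (x : Sym2 (Fin (m + 1)) → ℝ≥0∞) : Fin m → ℝ≥0∞ :=
  fun u => min (y (v.succAbove u) - y v) (xrow v x u)

theorem sdist_min {m : ℕ} (v : Fin (m + 1)) (y : Fin (m + 1) → ℝ≥0∞)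
    (x : Sym2 (Fin (m + 1)) → ℝ≥0∞) (hv : ∀ u, y v ≤ y u) : sdist y x v = y v := by
  refine le_antisymm (sdist_le _ _ _) ?_
  exact sdist_greatest y x (fun _ => y v) hv (fun u w => le_self_add) v

theorem le_sdist {m : ℕ} (T : ℝ≥0∞) (y : Fin m → ℝ≥0∞)
    (x : Sym2 (Fin m) → ℝ≥0∞) (hv : ∀ u, T ≤ y u) (u : Fin m) : T ≤ sdist y x u := 
  sdist_greatest y x (fun _ => T) hv (fun u w => le_self_add) u

theorem sdist_succAbove {m : ℕ} (v : Fin (m + 1)) (y : Fin (m + 1) → ℝ≥0∞)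
    (x : Sym2 (Fin (m + 1)) → ℝ≥0∞) (hv : ∀ u, y v ≤ y u) (u : Fin m) :
    sdist y x (v.succAbove u) = y v + sdist (ynew v y x) (xrest v x) u := by
  apply le_antisymm
  · have := sdist_greatest (ynew v y x) (xrest v x) (fun u => sdist y x (v.succAbove u) - y v)
      ?_ ?_ u
    · exact tsub_le_iff_left.1 this
    · intro u
      refine le_min (tsub_le_tsub_right (sdist_le _ _ _) _) ?_
      rw [tsub_le_iff_left]
      refine (sdist_step y x _ v).trans ?_
      rw [sdist_min v y x hv]; rfl
    · intro u w
      rw [tsub_le_iff_left, ← add_assoc]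
      refine (sdist_step y x _ (v.succAbove w)).trans ?_
      rw [xrest_mk]
      gcongr
      exact le_add_tsub
  · have := sdist_greatest y x
      (fun a => if h : ∃ u, v.succAbove u = a then
        y v + sdist (ynew v y x) (xrest v x) h.choose else y v) ?_ ?_ (v.succAbove u)
    · have h : ∃ u', v.succAbove u' = v.succAbove u := ⟨u, rfl⟩
      have h2 : h.choose = u := Fin.succAbove_right_injective h.choose_spec
      simp only [h, dite_true, h2] at this
      exact this
    · intro a
      split_ifs with h
      · obtain ⟨hc⟩ : Nonempty (v.succAbove h.choose = a) := ⟨h.choose_spec⟩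
        generalize h.choose = b at hc
        subst hc
        calc y v + sdist (ynew v y x) (xrest v x) b ≤ y v + (y (v.succAbove b) - y v) := by
              gcongr
              exact (sdist_le _ _ _).trans (min_le_left _ _)
          _ = y (v.succAbove b) := add_tsub_cancel_of_le (hv _)
      · exact hv a
    · intro a b
      split_ifs with h h' h'
      · obtain ⟨hc⟩ : Nonempty (v.succAbove h.choose = a) := ⟨h.choose_spec⟩
        generalize h.choose = c at hc
        obtain ⟨hc'⟩ : Nonempty (v.succAbove h'.choose = b) := ⟨h'.choose_spec⟩
        generalize h'.choose = c' at hc'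
        subst hc hc'
        rw [add_assoc, ← xrest_mk v x]
        gcongr
        exact sdist_step _ _ _ _
      · obtain ⟨hc⟩ : Nonempty (v.succAbove h.choose = a) := ⟨h.choose_spec⟩
        generalize h.choose = c at hc
        have hb : b = v := by
          by_contra hb
          exact h' (Fin.exists_succAbove_eq hb)
        subst hb hc
        gcongr
        exact (sdist_le _ _ _).trans (min_le_right _ _)
      · rw [add_assoc]; exact le_self_add
      · exact le_self_add

/-- Distances to the target `0`, computed from the target. -/
def tdist {m : ℕ} (x : Sym2 (Fin (m + 1)) → ℝ≥0∞) : Fin (m + 1) → ℝ≥0∞ :=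
  Fin.cons 0 (sdist (xrow 0 x) (xrest 0 x))

theorem tdist_step {m : ℕ} (x : Sym2 (Fin (m + 1)) → ℝ≥0∞) (a b : Fin (m + 1)) :
    tdist x a ≤ tdist x b + x s(b, a) := by
  refine Fin.cases ?_ (fun a => ?_) a
  · simp [tdist]
  · refine Fin.cases ?_ (fun b => ?_) b
    · simp only [tdist, Fin.cons_zero, Fin.cons_succ, zero_add]
      exact (sdist_le _ _ _).trans_eq (by simp [xrow])
    · simp only [tdist, Fin.cons_succ]
      refine (sdist_step _ _ _ b).trans_eq ?_
      rw [xrest_mk]; simp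

theorem sdist_zero_eq {m : ℕ} (y : Fin (m + 1) → ℝ≥0∞) (x : Sym2 (Fin (m + 1)) → ℝ≥0∞) :
    sdist y x 0 = ⨅ v, (y v + tdist x v) := by
  apply le_antisymm
  · refine le_iInf fun v => ?_
    refine Fin.cases ?_ (fun u => ?_) v
    · simpa [tdist] using sdist_le y x 0
    · have := sdist_greatest (xrow 0 x) (xrest 0 x) (fun u => sdist y x 0 - sdist y x u.succ)
        ?_ ?_ u
      · rw [tsub_le_iff_left] at this
        refine this.trans ?_
        simp only [tdist, Fin.cons_succ]
        gcongr
        exact sdist_le _ _ _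
      · intro u
        rw [tsub_le_iff_left]
        refine (sdist_step y x 0 u.succ).trans_eq ?_
        rw [Sym2.eq_swap]; simp [xrow]
      · intro u w
        rw [tsub_le_iff_left]
        have h1 := sdist_step y x w.succ u.succ
        calc sdist y x 0 ≤ sdist y x w.succ + (sdist y x 0 - sdist y x w.succ) := le_add_tsub
          _ ≤ (sdist y x u.succ + x s(u.succ, w.succ)) + (sdist y x 0 - sdist y x w.succ) := by
            gcongr
          _ = _ := by
            rw [xrest_mk, Sym2.eq_swap]; simp only [Fin.zero_succAbove]; ring
  · set I := ⨅ v, (y v + tdist x v) with hI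
    have := sdist_greatest y x (fun v => I - tdist x v) ?_ ?_ 0
    · simpa [tdist] using this
    · intro u
      rw [tsub_le_iff_right]
      exact iInf_le _ u
    · intro u w
      rw [tsub_le_iff_right]
      have h1 := tdist_step x w u
      calc I ≤ (I - tdist x w) + tdist x w := le_tsub_add
        _ ≤ (I - tdist x w) + (tdist x u + x s(u, w)) := by gcongr
        _ = _ := by rw [Sym2.eq_swap]; ring

/-! ### minWeight -/

theorem minWeight_self {n : ℕ} (w : Fin n → Fin n → ℝ≥0∞) (i : Fin n) : minWeight w i i = 0 := by
  refine le_antisymm ?_ bot_le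
  refine (iInf_le _ 0).trans ((iInf_le _ (fun _ => i)).trans ((iInf_le _ ⟨rfl, rfl⟩).trans ?_))
  simp [walkWeight]

theorem minWeight_step {n : ℕ} (w : Fin n → Fin n → ℝ≥0∞) (i j k : Fin n) :
    minWeight w i k ≤ minWeight w i j + w j k := by
  conv_rhs => unfold minWeight
  simp only [ENNReal.iInf_add]
  refine le_iInf fun l => le_iInf fun q => le_iInf fun hq => ?_
  refine (iInf_le _ (l + 1)).trans ((iInf_le _ (Fin.snoc q k : Fin (l + 1 + 1) → Fin n)).trans 
    ((iInf_le _ ⟨?_, ?_⟩).trans ?_))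
  · unfold walkWeight
    rw [Fin.sum_univ_castSucc]
    apply le_of_eq
    congr 1
    · refine Finset.sum_congr rfl fun t _ => ?_
      rw [Fin.succ_castSucc]
      simp only [Fin.snoc_castSucc]
    · simp only [Fin.succ_last, Fin.snoc_last, Fin.snoc_castSucc]
      rw [hq.2]
  · rw [← hq.1]
    exact Fin.snoc_castSucc (α := fun _ => Fin n) k q 0
  · simp

theorem le_minWeight {n : ℕ} (w : Fin n → Fin n → ℝ≥0∞) (i : Fin n) (pot : Fin n → ℝ≥0∞)
    (h0 : pot i = 0) (h1 : ∀ a b, pot b ≤ pot a + w a b) (j : Fin n) : pot j ≤ minWeight w i j := by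
  have key : ∀ (l : ℕ) (q : Fin (l + 1) → Fin n), q 0 = i → pot (q (Fin.last l)) ≤ walkWeight w q := by
    intro l
    induction l with
    | zero => intro q hq; simp [hq, h0]
    | succ l ih =>
      intro q hq
      unfold walkWeight
      rw [Fin.sum_univ_castSucc]
      have := ih (fun t => q t.castSucc) (by simpa using hq)
      refine (h1 (q (Fin.last l).castSucc) _).trans ?_
      refine add_le_add (this.trans_eq ?_) (le_of_eq ?_)
      · unfold walkWeight
        refine Finset.sum_congr rfl fun t _ => ?_
        rw [← Fin.castSucc_succ]
      · simp
  refine le_iInf fun l => le_iInf fun q => le_iInf fun hq => ?_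
  rw [← hq.2]
  exact key l q hq.1

/-- weight of an edge -/
def wt (z : Bool × ℝ) : ℝ≥0∞ := if z.1 = true then ENNReal.ofReal z.2 else ⊤

theorem measurable_wt : Measurable wt := by
  unfold wt
  refine Measurable.ite ?_ (ENNReal.measurable_ofReal.comp measurable_snd) measurable_const
  exact measurable_fst (measurableSet_singleton true)

theorem effWeight_eq {n : ℕ} (Z : Sym2 (Fin n) → Bool × ℝ) (a b : Fin n) (h : a ≠ b) :
    effWeight Z a b = wt (Z s(a, b)) := by
  simp [effWeight, wt, h]

theorem minWeight_eq {n : ℕ} (Z : Sym2 (Fin (n + 2)) → Bool × ℝ) :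
    minWeight (effWeight Z) 0 1 =
      sdist (xrow 0 (fun e => wt (Z e))) (xrest 0 (fun e => wt (Z e))) 0 := by
  apply le_antisymm
  · have := sdist_greatest (xrow 0 (fun e => wt (Z e))) (xrest 0 (fun e => wt (Z e)))
      (fun u => minWeight (effWeight Z) 0 u.succ) ?_ ?_ 0
    · exact this
    · intro u
      refine (minWeight_step _ 0 0 _).trans ?_
      rw [minWeight_self, zero_add, effWeight_eq _ _ _ (Fin.succ_ne_zero u).symm]
      simp [xrow]
    · intro u w
      by_cases h : u = w
      · subst h; exact le_self_add
      refine (minWeight_step _ 0 w.succ _).trans ?_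
      rw [xrest_mk, effWeight_eq _ _ _ (fun h' => h (Fin.succ_injective _ h').symm)]
      simp
  · have := le_minWeight (effWeight Z) 0
      (Fin.cons 0 (sdist (xrow 0 (fun e => wt (Z e))) (xrest 0 (fun e => wt (Z e))))) ?_ ?_ 1
    · exact this
    · simp
    · intro a b
      have h1 : wt (Z s(a, b)) ≤ effWeight Z a b ∨ a = b := by
        by_cases h : a = b
        · exact Or.inr h
        · exact Or.inl (effWeight_eq _ _ _ h).ge
      rcases h1 with h1 | rfl
      · refine le_trans ?_ (add_le_add_right h1 _)
        exact tdist_step (fun e => wt (Z e)) b a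
      · exact le_self_add

theorem minWeight_lt_top_iff {n : ℕ} (Z : Sym2 (Fin (n + 2)) → Bool × ℝ) :
    (theGraph Z).Reachable 0 1 ↔ minWeight (effWeight Z) 0 1 < ⊤ := by
  constructor
  · intro h
    rw [SimpleGraph.reachable_iff_reflTransGen] at h
    generalize (1 : Fin (n + 2)) = v at h ⊢
    induction h with
    | refl => simp [minWeight_self]
    | @tail b c _ h2 ih =>
      refine (minWeight_step _ _ b _).trans_lt ?_
      refine ENNReal.add_lt_top.2 ⟨ih, ?_⟩
      have h3 : b ≠ c ∧ (Z s(b, c)).1 = true := h2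
      unfold effWeight
      rw [if_pos h3]
      exact ENNReal.ofReal_lt_top
  · intro h
    by_contra hc
    classical
    have := le_minWeight (effWeight Z) 0
      (fun v => if (theGraph Z).Reachable 0 v then 0 else ⊤) ?_ ?_ 1
    · simp only [hc, if_false] at this
      exact absurd (lt_of_le_of_lt this h) (lt_irrefl _)
    · simp
    · intro a b
      by_cases ha : (theGraph Z).Reachable 0 a
      · by_cases hb : (theGraph Z).Reachable 0 b
        · simp [hb]
        · have : ¬ (theGraph Z).Adj a b := fun h => hb (ha.trans h.reachable)
          have h3 : ¬ (a ≠ b ∧ (Z s(a, b)).1 = true) := this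
          unfold effWeight
          rw [if_neg h3]; simp
      · simp [ha]

/-! ### Part 2: measure recursions -/

theorem pi_precomp {ι κ : Type} [Fintype ι] [Fintype κ] (ν : Measure ℝ≥0∞) [IsProbabilityMeasure ν]
    (g : ι → κ) (hg : Function.Injective g) :
    (Measure.pi fun _ : κ => ν).map (fun x i => x (g i)) = Measure.pi fun _ : ι => ν := by
  have h1 : iIndepFun (fun (i : κ) (ω : κ → ℝ≥0∞) => id (ω i)) (Measure.pi fun _ : κ => ν) :=
    iIndepFun_pi (fun i => aemeasurable_id)
  have h2 := h1.precomp hg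
  have h3 := (iIndepFun_iff_map_fun_eq_pi_map (f := fun (i : ι) (ω : κ → ℝ≥0∞) => id (ω (g i)))
    (fun i => ((measurable_pi_apply (g i)).aemeasurable))).1 h2
  refine h3.trans ?_
  congr 1
  funext i
  exact (measurePreserving_eval (fun _ : κ => ν) (g i)).map_eq

theorem measurable_xrow {m : ℕ} (v : Fin (m + 1)) : Measurable (xrow v) :=
  measurable_pi_lambda _ fun _ => measurable_pi_apply _

theorem measurable_xrest {m : ℕ} (v : Fin (m + 1)) : Measurable (xrest v) :=
  measurable_pi_lambda _ fun _ => measurable_pi_apply _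

theorem rowsplit {m : ℕ} (ν : Measure ℝ≥0∞) [IsProbabilityMeasure ν] (v : Fin (m + 1)) :
    (Measure.pi fun _ : Sym2 (Fin (m + 1)) => ν).map (fun x => (xrow v x, xrest v x)) =
      (Measure.pi fun _ : Fin m => ν).prod (Measure.pi fun _ : Sym2 (Fin m) => ν) := by
  let g : Fin m ⊕ Sym2 (Fin m) → Sym2 (Fin (m + 1)) :=
    Sum.elim (fun u => s(v, v.succAbove u)) (fun e => e.map v.succAbove)
  have hg : Function.Injective g := by
    rintro (a | a) (b | b) h
    · simp only [g, Sum.elim_inl, Sym2.congr_right] at h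
      rw [Fin.succAbove_right_injective h]
    · exfalso
      simp only [g, Sum.elim_inl, Sum.elim_inr] at h
      have : v ∈ Sym2.map v.succAbove b := by rw [← h]; simp
      rw [Sym2.mem_map] at this
      obtain ⟨c, _, hc⟩ := this
      exact Fin.succAbove_ne v c hc
    · exfalso
      simp only [g, Sum.elim_inl, Sum.elim_inr] at h
      have : v ∈ Sym2.map v.succAbove a := by rw [h]; simp
      rw [Sym2.mem_map] at this
      obtain ⟨c, _, hc⟩ := this
      exact Fin.succAbove_ne v c hc
    · simp only [g, Sum.elim_inr] at h
      rw [Sym2.map.injective Fin.succAbove_right_injective h]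
  have h1 := pi_precomp ν g hg
  have h2 := (measurePreserving_sumPiEquivProdPi (fun _ : Fin m ⊕ Sym2 (Fin m) => ν)).map_eq
  have hm : Measurable (fun (x : Sym2 (Fin (m + 1)) → ℝ≥0∞) i => x (g i)) :=
    measurable_pi_lambda _ fun _ => measurable_pi_apply _
  rw [← h1, Measure.map_map (MeasurableEquiv.measurable _) hm] at h2
  exact h2

theorem pi_map2 {m : ℕ} (α ν : Measure ℝ≥0∞) [IsFiniteMeasure α] [IsFiniteMeasure ν]
    (φ : ℝ≥0∞ × ℝ≥0∞ → ℝ≥0∞) (hφ : Measurable φ) :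
    ((Measure.pi fun _ : Fin m => α).prod (Measure.pi fun _ : Fin m => ν)).map
      (fun z u => φ (z.1 u, z.2 u)) = Measure.pi fun _ : Fin m => (α.prod ν).map φ := by
  have h1 := measurePreserving_arrowProdEquivProdArrow ℝ≥0∞ ℝ≥0∞ (Fin m) (fun _ => α) (fun _ => ν)
  have h2 := Measure.pi_map_pi (μ := fun _ : Fin m => α.prod ν) (f := fun _ => φ)
    (fun _ => hφ.aemeasurable)
  rw [← h2, ← h1.map_eq, Measure.map_map]
  · rfl
  · exact measurable_pi_lambda _ fun u => hφ.comp
      (((measurable_pi_apply u).comp measurable_fst).prodMk ((measurable_pi_apply u).comp measurable_snd))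
  · exact MeasurableEquiv.measurable _

/-- One exploration step on laws of source weights. -/
def step (ν α : Measure ℝ≥0∞) (τ : ℝ≥0∞) : Measure ℝ≥0∞ :=
  ((α.restrict (Set.Ioi τ)).prod ν).map (fun z => min (z.1 - τ) z.2)

theorem measurable_stepfun (τ : ℝ≥0∞) : Measurable (fun z : ℝ≥0∞ × ℝ≥0∞ => min (z.1 - τ) z.2) :=
  (measurable_fst.sub measurable_const).min measurable_snd

instance step_finite (ν α : Measure ℝ≥0∞) (τ : ℝ≥0∞) [IsFiniteMeasure α] [IsFiniteMeasure ν] :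
    IsFiniteMeasure (step ν α τ) := by
  unfold step; infer_instance

theorem step_tail (ν α : Measure ℝ≥0∞) (τ s : ℝ≥0∞) [IsFiniteMeasure α] [IsFiniteMeasure ν] :
    step ν α τ (Set.Ioi s) = α (Set.Ioi (τ + s)) * ν (Set.Ioi s) := by
  unfold step
  rw [Measure.map_apply (measurable_stepfun τ) measurableSet_Ioi]
  have : (fun z : ℝ≥0∞ × ℝ≥0∞ => min (z.1 - τ) z.2) ⁻¹' Set.Ioi s =
      Set.Ioi (τ + s) ×ˢ Set.Ioi s := by
    ext z
    simp [lt_tsub_iff_left]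
  rw [this, Measure.prod_prod, Measure.restrict_apply measurableSet_Ioi]
  congr 2
  ext z
  simp only [Set.mem_inter_iff, Set.mem_Ioi, and_iff_left_iff_imp]
  exact fun h => lt_of_le_of_lt le_self_add h

/-- strict argmin indicator -/
def amin {m : ℕ} (v : Fin (m + 1)) (T : ℝ≥0∞) : Set (Fin (m + 1) → ℝ≥0∞) :=
  {y | y v ≤ T ∧ ∀ u : Fin m, y v < y (v.succAbove u)}

theorem measurableSet_amin {m : ℕ} (v : Fin (m + 1)) (T : ℝ≥0∞) : MeasurableSet (amin v T) := by
  refine (measurableSet_le (measurable_pi_apply v) measurable_const).inter ?_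
  have : {y : Fin (m + 1) → ℝ≥0∞ | ∀ u : Fin m, y v < y (v.succAbove u)} =
    ⋂ u : Fin m, {y | y v < y (v.succAbove u)} := by ext; simp
  change MeasurableSet {y : Fin (m + 1) → ℝ≥0∞ | ∀ u : Fin m, y v < y (v.succAbove u)}
  rw [this]
  exact MeasurableSet.iInter fun u =>
    measurableSet_lt (measurable_pi_apply v) (measurable_pi_apply _)

theorem one_step {m : ℕ} (ν α : Measure ℝ≥0∞) [IsProbabilityMeasure ν] [IsFiniteMeasure α]
    (v : Fin (m + 1)) (T : ℝ≥0∞) 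
    (H : ℝ≥0∞ × (Fin m → ℝ≥0∞) × (Sym2 (Fin m) → ℝ≥0∞) → ℝ≥0∞) (hH : Measurable H) :
    ∫⁻ y in amin v T, ∫⁻ x, H (y v, ynew v y x, xrest v x) ∂(Measure.pi fun _ => ν)
        ∂(Measure.pi fun _ => α) =
      ∫⁻ τ in Set.Iic T, ∫⁻ y, ∫⁻ x, H (τ, y, x) ∂(Measure.pi fun _ => ν)
        ∂(Measure.pi fun _ => step ν α τ) ∂α := by
  have h1 : ∀ y : Fin (m + 1) → ℝ≥0∞,
      ∫⁻ x, H (y v, ynew v y x, xrest v x) ∂(Measure.pi fun _ => ν) =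
      ∫⁻ r, ∫⁻ x', H (y v, (fun u => min (y (v.succAbove u) - y v) (r u)), x')
        ∂(Measure.pi fun _ => ν) ∂(Measure.pi fun _ : Fin m => ν) := by
    intro y
    have hm : Measurable (fun z : (Fin m → ℝ≥0∞) × (Sym2 (Fin m) → ℝ≥0∞) =>
        H (y v, (fun u => min (y (v.succAbove u) - y v) (z.1 u)), z.2)) := by
      refine hH.comp (measurable_const.prodMk (Measurable.prodMk ?_ measurable_snd))
      exact measurable_pi_lambda _ fun u =>
        measurable_const.min ((measurable_pi_apply u).comp measurable_fst)
    rw [← lintegral_prod (fun z : (Fin m → ℝ≥0∞) × (Sym2 (Fin m) → ℝ≥0∞) =>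
        H (y v, (fun u => min (y (v.succAbove u) - y v) (z.1 u)), z.2)) hm.aemeasurable,
      ← rowsplit ν v, lintegral_map hm ((measurable_xrow v).prodMk (measurable_xrest v))]
    rfl
  simp_rw [h1]
  have hG : Measurable (fun z : ℝ≥0∞ × (Fin m → ℝ≥0∞) =>
      ∫⁻ r, ∫⁻ x', H (z.1, (fun u => min (z.2 u - z.1) (r u)), x')
        ∂(Measure.pi fun _ => ν) ∂(Measure.pi fun _ : Fin m => ν)) := by
    refine Measurable.lintegral_prod_right (f := fun (z : ℝ≥0∞ × (Fin m → ℝ≥0∞)) (r : Fin m → ℝ≥0∞) =>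
      ∫⁻ x', H (z.1, (fun u => min (z.2 u - z.1) (r u)), x')
        ∂(Measure.pi fun _ => ν)) ?_
    refine Measurable.lintegral_prod_right (f := fun (w : (ℝ≥0∞ × (Fin m → ℝ≥0∞)) × 
      (Fin m → ℝ≥0∞)) x' => H (w.1.1, (fun u => min (w.1.2 u - w.1.1) (w.2 u)), x')) ?_
    refine hH.comp (Measurable.prodMk (by fun_prop) (Measurable.prodMk ?_ (by fun_prop)))
    exact measurable_pi_lambda _ fun u => by fun_prop
  rw [← lintegral_indicator (measurableSet_amin v T), ← lintegral_indicator measurableSet_Iic]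
  have h2 := (measurePreserving_piFinSuccAbove (fun _ : Fin (m + 1) => α) v)
  let S : Set (ℝ≥0∞ × (Fin m → ℝ≥0∞)) := {z | z.1 ≤ T ∧ ∀ u, z.1 < z.2 u}
  have hS : MeasurableSet S := by
    refine (measurableSet_le measurable_fst measurable_const).inter ?_
    have : {z : ℝ≥0∞ × (Fin m → ℝ≥0∞) | ∀ u : Fin m, z.1 < z.2 u} =
      ⋂ u : Fin m, {z | z.1 < z.2 u} := by ext; simp
    change MeasurableSet {z : ℝ≥0∞ × (Fin m → ℝ≥0∞) | ∀ u : Fin m, z.1 < z.2 u}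
    rw [this]
    exact MeasurableSet.iInter fun u =>
      measurableSet_lt measurable_fst ((measurable_pi_apply _).comp measurable_snd)
  have h3 := h2.lintegral_comp (hG.indicator hS)
  refine Eq.trans ?_ (h3.trans ?_)
  · rfl
  rw [lintegral_prod _ (hG.indicator hS).aemeasurable]
  refine lintegral_congr fun τ => ?_
  by_cases hτ : τ ∈ Set.Iic T
  · rw [Set.indicator_of_mem hτ]
    have h4 : ∀ y : Fin m → ℝ≥0∞, S.indicator (fun z : ℝ≥0∞ × (Fin m → ℝ≥0∞) =>
      ∫⁻ r, ∫⁻ x', H (z.1, (fun u => min (z.2 u - z.1) (r u)), x')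
        ∂(Measure.pi fun _ => ν) ∂(Measure.pi fun _ : Fin m => ν)) (τ, y) =
        (Set.univ.pi fun _ : Fin m => Set.Ioi τ).indicator (fun y => 
        ∫⁻ r, ∫⁻ x', H (τ, (fun u => min (y u - τ) (r u)), x')
        ∂(Measure.pi fun _ => ν) ∂(Measure.pi fun _ : Fin m => ν)) y := by
      intro y
      refine Set.indicator_eq_indicator ?_ rfl
      simp only [S, Set.mem_ofPred_eq, Set.mem_pi, Set.mem_univ, Set.mem_Ioi, forall_true_left]
      exact and_iff_right hτ
    simp_rw [h4]
    rw [lintegral_indicator (MeasurableSet.univ_pi fun _ => measurableSet_Ioi),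
      Measure.restrict_pi_pi]
    have hK : Measurable (fun y : Fin m → ℝ≥0∞ => ∫⁻ x, H (τ, y, x) ∂(Measure.pi fun _ => ν)) := by
      refine Measurable.lintegral_prod_right (f := fun (y : Fin m → ℝ≥0∞) x => H (τ, y, x)) ?_
      exact hH.comp (by fun_prop)
    unfold step
    rw [← pi_map2 _ _ _ (measurable_stepfun τ)]
    have hmm : Measurable (fun (z : (Fin m → ℝ≥0∞) × (Fin m → ℝ≥0∞)) u =>
        min (z.1 u - τ) (z.2 u)) := by
      exact measurable_pi_lambda _ fun u => by fun_prop
    rw [lintegral_map hK hmm]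
    exact (lintegral_prod _ (hK.comp hmm).aemeasurable).symm
  · rw [Set.indicator_of_notMem hτ]
    rw [← lintegral_zero (μ := Measure.pi fun _ : Fin m => α)]
    refine lintegral_congr fun y => ?_
    exact Set.indicator_of_notMem (fun h => hτ h.1) _

theorem tie_null {m : ℕ} (α : Measure ℝ≥0∞) [IsFiniteMeasure α] (hα : ∀ τ, τ < ⊤ → α {τ} = 0)
    (v : Fin (m + 1)) (T : ℝ≥0∞) (hT : T < ⊤) :
    (Measure.pi fun _ : Fin (m + 1) => α)
      {y | y v ≤ T ∧ ∃ u : Fin m, y (v.succAbove u) = y v} = 0 := by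
  have h2 := (measurePreserving_piFinSuccAbove (fun _ : Fin (m + 1) => α) v)
  let S : Set (ℝ≥0∞ × (Fin m → ℝ≥0∞)) := {z | z.1 ≤ T ∧ ∃ u, z.2 u = z.1}
  have hS : MeasurableSet S := by
    refine (measurableSet_le measurable_fst measurable_const).inter ?_
    have : {z : ℝ≥0∞ × (Fin m → ℝ≥0∞) | ∃ u : Fin m, z.2 u = z.1} =
      ⋃ u : Fin m, {z | z.2 u = z.1} := by ext; simp
    change MeasurableSet {z : ℝ≥0∞ × (Fin m → ℝ≥0∞) | ∃ u : Fin m, z.2 u = z.1}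
    rw [this]
    exact MeasurableSet.iUnion fun u =>
      measurableSet_eq_fun ((measurable_pi_apply _).comp measurable_snd) measurable_fst
  have h3 := h2.measure_preimage hS.nullMeasurableSet
  refine Eq.trans ?_ (h3.trans ?_)
  · rfl
  rw [Measure.prod_apply hS]
  rw [← lintegral_zero (μ := α)]
  refine lintegral_congr fun τ => ?_
  by_cases hτ : τ ≤ T
  · refine measure_mono_null (t := ⋃ u : Fin m, Function.eval u ⁻¹' {τ}) ?_ ?_
    · intro y hy
      obtain ⟨_, u, hu⟩ := hy
      exact Set.mem_iUnion.2 ⟨u, hu⟩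
    · rw [measure_iUnion_null_iff]
      intro u
      exact Measure.pi_eval_preimage_null _ (hα τ (hτ.trans_lt hT))
  · refine measure_mono_null (t := ∅) ?_ (by simp)
    intro y hy
    exact absurd hy.1 hτ

/-- all above T -/
def allgt (m : ℕ) (T : ℝ≥0∞) : Set (Fin m → ℝ≥0∞) := Set.univ.pi fun _ => Set.Ioi T

theorem measurableSet_allgt (m : ℕ) (T : ℝ≥0∞) : MeasurableSet (allgt m T) :=
  MeasurableSet.univ_pi fun _ => measurableSet_Ioi

theorem partition_lint {m : ℕ} (α : Measure ℝ≥0∞) [IsFiniteMeasure α]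
    (hα : ∀ τ, τ < ⊤ → α {τ} = 0) (T : ℝ≥0∞) (hT : T < ⊤) (F : (Fin (m + 1) → ℝ≥0∞) → ℝ≥0∞) :
    ∫⁻ y, F y ∂(Measure.pi fun _ => α) =
      ∫⁻ y in allgt (m + 1) T, F y ∂(Measure.pi fun _ => α) +
        ∑ v, ∫⁻ y in amin v T, F y ∂(Measure.pi fun _ => α) := by
  have hdis : Pairwise (Function.onFun Disjoint (fun v : Fin (m + 1) => amin v T)) := by
    intro v w hvw
    refine Set.disjoint_left.2 fun y hy hy' => ?_
    obtain ⟨u, rfl⟩ := Fin.exists_succAbove_eq hvw.symm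
    obtain ⟨u', hu'⟩ := Fin.exists_succAbove_eq hvw
    have h1 := hy.2 u
    have h2 := hy'.2 u'
    rw [hu'] at h2
    exact absurd h1 h2.not_gt
  have hdis2 : Disjoint (allgt (m + 1) T) (⋃ v : Fin (m + 1), amin v T) := by
    refine Set.disjoint_left.2 fun y hy hy' => ?_
    obtain ⟨v, hv⟩ := Set.mem_iUnion.1 hy'
    exact absurd hv.1 (hy v trivial).not_ge
  rw [← tsum_fintype (L := SummationFilter.unconditional _),
    ← lintegral_iUnion (fun v => measurableSet_amin v T) hdis,
    ← lintegral_union (MeasurableSet.iUnion fun v => measurableSet_amin v T) hdis2]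
  rw [← setLIntegral_univ]
  refine setLIntegral_congr ?_
  symm
  rw [eventuallyEq_univ]
  rw [mem_ae_iff]
  refine measure_mono_null (t := ⋃ v : Fin (m + 1),
    {y | y v ≤ T ∧ ∃ u : Fin m, y (v.succAbove u) = y v}) ?_ ?_
  · intro y hy
    simp only [Set.mem_compl_iff, Set.mem_union, Set.mem_iUnion, not_or, not_exists] at hy
    obtain ⟨v, hv⟩ := Finite.exists_min y
    have hvT : y v ≤ T := by
      by_contra h
      exact hy.1 fun u _ => (not_le.1 h).trans_le (hv u)
    refine Set.mem_iUnion.2 ⟨v, hvT, ?_⟩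
    by_contra hc
    push Not at hc
    exact hy.2 v ⟨hvT, fun u => lt_of_le_of_ne (hv _) (hc u).symm⟩
  · rw [measure_iUnion_null_iff]
    exact fun v => tie_null α hα v T hT

/-- Stage one functional. -/
def E1 (ν : Measure ℝ≥0∞) (ρ : ℝ≥0∞ → ℝ≥0∞) (m : ℕ) (α : Measure ℝ≥0∞) (T : ℝ≥0∞) : ℝ≥0∞ :=
  ∫⁻ y, ∫⁻ x, ∏ u : Fin m, ρ (T - sdist y x u) ∂(Measure.pi fun _ => ν) ∂(Measure.pi fun _ => α)

theorem measurable_E1_integrand {m : ℕ} (ρ : ℝ≥0∞ → ℝ≥0∞) (hρ : Measurable ρ) (T : ℝ≥0∞) :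
    Measurable (fun z : (Fin m → ℝ≥0∞) × (Sym2 (Fin m) → ℝ≥0∞) =>
      ∏ u : Fin m, ρ (T - sdist z.1 z.2 u)) := 
  Finset.measurable_prod _ fun u _ => hρ.comp (measurable_const.sub (measurable_sdist u))

theorem measurable_E1_right {m : ℕ} (ρ : ℝ≥0∞ → ℝ≥0∞) (hρ : Measurable ρ) (T : ℝ≥0∞)
    (y : Fin m → ℝ≥0∞) :
    Measurable (fun x : Sym2 (Fin m) → ℝ≥0∞ => ∏ u : Fin m, ρ (T - sdist y x u)) := 
  Finset.measurable_prod _ fun u _ => hρ.comp (measurable_const.sub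
    ((measurable_sdist u).comp (measurable_const.prodMk measurable_id)))

theorem measurable_E1_row {m : ℕ} (ρ : ℝ≥0∞ → ℝ≥0∞) (hρ : Measurable ρ) (T : ℝ≥0∞) :
    Measurable (fun x : Sym2 (Fin (m + 1)) → ℝ≥0∞ =>
      ∏ u : Fin m, ρ (T - sdist (xrow 0 x) (xrest 0 x) u)) := 
  Finset.measurable_prod _ fun u _ => hρ.comp (measurable_const.sub
    ((measurable_sdist u).comp ((measurable_xrow 0).prodMk (measurable_xrest 0))))

theorem E1_zero (ν : Measure ℝ≥0∞) [IsProbabilityMeasure ν] (ρ : ℝ≥0∞ → ℝ≥0∞)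
    (α : Measure ℝ≥0∞) [IsFiniteMeasure α] (T : ℝ≥0∞) : E1 ν ρ 0 α T = 1 := by
  unfold E1
  simp [Measure.pi_of_empty]

theorem E1_succ (ν : Measure ℝ≥0∞) [IsProbabilityMeasure ν] (ρ : ℝ≥0∞ → ℝ≥0∞) (hρ : Measurable ρ)
    (hρ0 : ρ 0 = 1) (m : ℕ)
    (α : Measure ℝ≥0∞) [IsFiniteMeasure α] (hα : ∀ τ, τ < ⊤ → α {τ} = 0) (T : ℝ≥0∞) (hT : T < ⊤) :
    E1 ν ρ (m + 1) α T = α (Set.Ioi T) ^ (m + 1) +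
      (m + 1 : ℕ) * ∫⁻ τ in Set.Iic T, ρ (T - τ) * E1 ν ρ m (step ν α τ) (T - τ) ∂α := by
  conv_lhs => unfold E1
  rw [partition_lint α hα T hT]
  congr 1
  · rw [setLIntegral_congr_fun (g := fun _ => 1) (measurableSet_allgt _ _)]
    · simp [allgt, Measure.pi_pi]
    · intro y hy
      have : ∀ (x : Sym2 (Fin (m + 1)) → ℝ≥0∞) u, T - sdist y x u = 0 := fun x u =>
        tsub_eq_zero_of_le (le_sdist T y x (fun u => (hy u trivial).le) u)
      simp [this, hρ0]
  · have key : ∀ v : Fin (m + 1), ∫⁻ y in amin v T, ∫⁻ x, ∏ u, ρ (T - sdist y x u)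
        ∂(Measure.pi fun _ => ν) ∂(Measure.pi fun _ => α) =
        ∫⁻ τ in Set.Iic T, ρ (T - τ) * E1 ν ρ m (step ν α τ) (T - τ) ∂α := by
      intro v
      have h1 := one_step ν α v T (fun z => ρ (T - z.1) * ∏ u, ρ (T - z.1 - sdist z.2.1 z.2.2 u))
        (by
          refine (hρ.comp (measurable_const.sub measurable_fst)).mul ?_
          exact Finset.measurable_prod _ fun u _ => hρ.comp
            ((measurable_const.sub measurable_fst).sub
              ((measurable_sdist u).comp measurable_snd)))
      refine Eq.trans ?_ (h1.trans ?_)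
      · refine setLIntegral_congr_fun (measurableSet_amin v T) fun y hy => ?_
        refine lintegral_congr fun x => ?_
        have hv : ∀ u, y v ≤ y u := by
          intro u
          by_cases h : u = v
          · rw [h]
          · obtain ⟨u', rfl⟩ := Fin.exists_succAbove_eq h
            exact (hy.2 u').le
        rw [Fin.prod_univ_succAbove _ v]
        congr 1
        · rw [sdist_min v y x hv]
        · refine Finset.prod_congr rfl fun u _ => ?_
          rw [sdist_succAbove v y x hv, tsub_add_eq_tsub_tsub]
      · refine lintegral_congr fun τ => ?_
        have hm := measurable_E1_integrand (m := m) ρ hρ (T - τ)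
        unfold E1
        have hm' : Measurable (fun y : Fin m → ℝ≥0∞ => ∫⁻ x, ∏ u, ρ (T - τ - sdist y x u)
            ∂(Measure.pi fun _ : Sym2 (Fin m) => ν)) := hm.lintegral_prod_right'
        refine Eq.trans ?_ (lintegral_const_mul (ρ (T - τ)) hm')
        refine lintegral_congr fun y => ?_
        dsimp only
        exact lintegral_const_mul _ (measurable_E1_right ρ hρ (T - τ) y)
    rw [Finset.sum_congr rfl fun v _ => key v]
    simp

/-- Stage zero functional. -/
def E0 (ν : Measure ℝ≥0∞) (T1 : ℝ≥0∞) (m : ℕ) (α : Measure ℝ≥0∞) (T : ℝ≥0∞) : ℝ≥0∞ :=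
  ∫⁻ y, ∫⁻ x, (Set.Ioi (T + T1)).indicator 1 (sdist y x (0 : Fin (m + 1)))
    ∂(Measure.pi fun _ => ν) ∂(Measure.pi fun _ => α)

theorem measurable_tailshift (α : Measure ℝ≥0∞) (T : ℝ≥0∞) :
    Measurable (fun s => α (Set.Ioi (T + s))) := by
  refine Antitone.measurable fun a b h => measure_mono ?_
  exact Set.Ioi_subset_Ioi (by gcongr)

theorem gap_set {T T1 δ y : ℝ≥0∞} (hT : T < ⊤) (hT1 : T1 < ⊤) :
    (T < y ∧ T + T1 < y + δ) ↔ T + (T1 - δ) < y := by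
  rcases le_total δ T1 with h | h
  · obtain ⟨c, rfl⟩ := exists_add_of_le h
    have hδ : δ ≠ ⊤ := (h.trans_lt hT1).ne
    rw [ENNReal.add_sub_cancel_left hδ, show T + (δ + c) = (T + c) + δ by ring,
      ENNReal.add_lt_add_iff_right hδ]
    exact ⟨fun h => h.2, fun h => ⟨lt_of_le_of_lt le_self_add h, h⟩⟩
  · rw [tsub_eq_zero_of_le h, add_zero]
    exact ⟨fun h => h.1, fun h' => ⟨h', ENNReal.add_lt_add_of_lt_of_le hT1.ne h' h⟩⟩

theorem lt_iInf_fin {m : ℕ} (f : Fin (m + 1) → ℝ≥0∞) (a : ℝ≥0∞) : a < ⨅ v, f v ↔ ∀ v, a < f v := by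
  obtain ⟨i, hi⟩ := exists_eq_ciInf_of_finite (f := f)
  constructor
  · intro h v
    exact h.trans_le (iInf_le _ v)
  · intro h
    rw [← hi]; exact h i

theorem Gam_eq (ν : Measure ℝ≥0∞) [IsProbabilityMeasure ν] (T1 : ℝ≥0∞) (hT1 : T1 < ⊤) (m : ℕ)
    (α : Measure ℝ≥0∞) [IsFiniteMeasure α] (T : ℝ≥0∞) (hT : T < ⊤) :
    ∫⁻ y in allgt (m + 1) T, ∫⁻ x, (Set.Ioi (T + T1)).indicator 1 (sdist y x (0 : Fin (m + 1)))
      ∂(Measure.pi fun _ => ν) ∂(Measure.pi fun _ => α) =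
    α (Set.Ioi (T + T1)) * E1 ν (fun s => α (Set.Ioi (T + s))) m ν T1 := by
  have hmeas : Measurable (fun z : (Fin (m + 1) → ℝ≥0∞) × (Sym2 (Fin (m + 1)) → ℝ≥0∞) =>
      (Set.Ioi (T + T1)).indicator (1 : ℝ≥0∞ → ℝ≥0∞) (sdist z.1 z.2 (0 : Fin (m + 1)))) :=
    (measurable_one.indicator measurableSet_Ioi).comp (measurable_sdist 0)
  rw [lintegral_lintegral_swap hmeas.aemeasurable]
  have h1 : ∀ x : Sym2 (Fin (m + 1)) → ℝ≥0∞,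
      ∫⁻ y in allgt (m + 1) T, (Set.Ioi (T + T1)).indicator 1 (sdist y x (0 : Fin (m + 1)))
        ∂(Measure.pi fun _ => α) = α (Set.Ioi (T + T1)) * 
        ∏ u : Fin m, α (Set.Ioi (T + (T1 - sdist (xrow 0 x) (xrest 0 x) u))) := by
    intro x
    rw [← lintegral_indicator (measurableSet_allgt _ _)]
    have h2 : ∀ y : Fin (m + 1) → ℝ≥0∞, (allgt (m + 1) T).indicator (fun y =>
        (Set.Ioi (T + T1)).indicator (1 : ℝ≥0∞ → ℝ≥0∞) (sdist y x (0 : Fin (m + 1)))) y =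
        (Set.univ.pi fun v : Fin (m + 1) => Set.Ioi (T + (T1 - tdist x v))).indicator 1 y := by
      intro y
      have h3 : (y ∈ allgt (m + 1) T ∧ sdist y x 0 ∈ Set.Ioi (T + T1)) ↔
        y ∈ (Set.univ.pi fun v : Fin (m + 1) => Set.Ioi (T + (T1 - tdist x v))) := by
        simp only [allgt, Set.mem_univ_pi, Set.mem_Ioi, sdist_zero_eq, lt_iInf_fin, ← forall_and,
          gap_set hT hT1]
      classical
      simp only [Set.indicator_apply, ← h3, Pi.one_apply]
      by_cases ha : y ∈ allgt (m + 1) T <;> simp [ha]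
    simp_rw [h2]
    rw [lintegral_indicator_one (MeasurableSet.univ_pi fun _ => measurableSet_Ioi), Measure.pi_pi,
      Fin.prod_univ_succ]
    simp [tdist]
  simp_rw [h1]
  have hm2 := measurable_E1_integrand (m := m) (fun s => α (Set.Ioi (T + s)))
    (measurable_tailshift α T) T1
  have hrs : Measurable (fun x : Sym2 (Fin (m + 1)) → ℝ≥0∞ => (xrow 0 x, xrest 0 x)) :=
    (measurable_xrow 0).prodMk (measurable_xrest 0)
  have hm3 : Measurable (fun x : Sym2 (Fin (m + 1)) → ℝ≥0∞ =>
      ∏ u : Fin m, α (Set.Ioi (T + (T1 - sdist (xrow 0 x) (xrest 0 x) u)))) :=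
    measurable_E1_row (fun s => α (Set.Ioi (T + s))) (measurable_tailshift α T) T1
  rw [lintegral_const_mul _ hm3]
  congr 1
  unfold E1
  rw [← lintegral_prod _ hm2.aemeasurable, ← rowsplit ν 0, lintegral_map hm2 hrs]

theorem measurable_E0_integrand {m : ℕ} (T : ℝ≥0∞) :
    Measurable (fun z : (Fin (m + 1) → ℝ≥0∞) × (Sym2 (Fin (m + 1)) → ℝ≥0∞) =>
      (Set.Ioi T).indicator (1 : ℝ≥0∞ → ℝ≥0∞) (sdist z.1 z.2 (0 : Fin (m + 1)))) :=
  (measurable_one.indicator measurableSet_Ioi).comp (measurable_sdist 0)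

theorem E0_rec (ν : Measure ℝ≥0∞) [IsProbabilityMeasure ν] (T1 : ℝ≥0∞) (hT1 : T1 < ⊤) (m : ℕ)
    (α : Measure ℝ≥0∞) [IsFiniteMeasure α] (hα : ∀ τ, τ < ⊤ → α {τ} = 0) (T : ℝ≥0∞) (hT : T < ⊤) :
    E0 ν T1 m α T = α (Set.Ioi (T + T1)) * E1 ν (fun s => α (Set.Ioi (T + s))) m ν T1 +
      m * ∫⁻ τ in Set.Iic T, E0 ν T1 (m - 1) (step ν α τ) (T - τ) ∂α := by
  conv_lhs => unfold E0
  rw [partition_lint α hα T hT, Gam_eq ν T1 hT1 m α T hT]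
  congr 1
  have hmin : ∀ (k : ℕ) (v : Fin (k + 1)) (y : Fin (k + 1) → ℝ≥0∞), y ∈ amin v T → 
      ∀ u, y v ≤ y u := by
    intro k v y hy u
    by_cases h : u = v
    · rw [h]
    · obtain ⟨u', rfl⟩ := Fin.exists_succAbove_eq h
      exact (hy.2 u').le
  have key0 : ∫⁻ y in amin 0 T, ∫⁻ x, (Set.Ioi (T + T1)).indicator 1 (sdist y x (0 : Fin (m + 1)))
        ∂(Measure.pi fun _ => ν) ∂(Measure.pi fun _ => α) = 0 := by
    rw [setLIntegral_congr_fun (g := fun _ => 0) (measurableSet_amin _ _)]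
    · simp
    · intro y hy
      have : ∀ x, (Set.Ioi (T + T1)).indicator (1 : ℝ≥0∞ → ℝ≥0∞) (sdist y x (0 : Fin (m + 1))) = 0 := by
        intro x
        apply Set.indicator_of_notMem
        rw [sdist_min 0 y x (hmin m 0 y hy)]
        simp only [Set.mem_Ioi, not_lt]
        exact hy.1.trans le_self_add
      simp [this]
  rw [Fin.sum_univ_succ, key0, zero_add]
  cases m with
  | zero => simp
  | succ m =>
    have key : ∀ v : Fin (m + 1), ∫⁻ y in amin v.succ T, ∫⁻ x, 
        (Set.Ioi (T + T1)).indicator 1 (sdist y x (0 : Fin (m + 1 + 1)))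
        ∂(Measure.pi fun _ => ν) ∂(Measure.pi fun _ => α) =
        ∫⁻ τ in Set.Iic T, E0 ν T1 m (step ν α τ) (T - τ) ∂α := by
      intro v
      have h1 := one_step ν α v.succ T (fun z => (Set.Ioi (T + T1)).indicator 1
          (z.1 + sdist z.2.1 z.2.2 0))
        (by
          exact (measurable_one.indicator measurableSet_Ioi).comp 
            (measurable_fst.add ((measurable_sdist 0).comp measurable_snd)))
      refine Eq.trans ?_ (h1.trans ?_)
      · refine setLIntegral_congr_fun (measurableSet_amin _ T) fun y hy => ?_
        refine lintegral_congr fun x => ?_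
        dsimp only
        rw [← sdist_succAbove v.succ y x (hmin _ _ y hy), Fin.succ_succAbove_zero]
      · refine setLIntegral_congr_fun measurableSet_Iic fun τ hτ => ?_
        unfold E0
        refine lintegral_congr fun y => lintegral_congr fun x => ?_
        have hh : (τ + sdist y x 0 ∈ Set.Ioi (T + T1)) ↔ (sdist y x 0 ∈ Set.Ioi (T - τ + T1)) := by
          obtain ⟨c, rfl⟩ := exists_add_of_le (Set.mem_Iic.1 hτ)
          have hτ' : τ ≠ ⊤ := (lt_of_le_of_lt le_self_add hT).ne
          simp only [Set.mem_Ioi, ENNReal.add_sub_cancel_left hτ', add_assoc,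
            ENNReal.add_lt_add_iff_left hτ']
        classical
        simp only [Set.indicator_apply, hh, Pi.one_apply]
    rw [Finset.sum_congr rfl fun v _ => key v]
    simp

/-! ### Part 4: states -/

/-- survival function of an edge weight -/
def qf (p s : ℝ) : ℝ := 1 - p * (1 - Real.exp (-s))

/-- Context: facts about the edge law. -/
structure Ctx (ν : Measure ℝ≥0∞) (p p' t : ℝ) : Prop where
  prob : IsProbabilityMeasure ν
  p_pos : 0 < p
  p_le : p ≤ 1
  tail : ∀ s, 0 ≤ s → ν (Set.Ioi (ENNReal.ofReal s)) = ENNReal.ofReal (qf p s)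
  zero : ν {0} = 0
  hp' : ∀ s, 0 ≤ s → s ≤ t → p ≤ p' * qf p s

/-- A regular state. -/
structure St (p p' : ℝ) (α : Measure ℝ≥0∞) (Q f : ℝ → ℝ) (A T : ℝ) : Prop where
  fin : IsFiniteMeasure α
  tail : ∀ s, 0 ≤ s → α (Set.Ioi (ENNReal.ofReal s)) = ENNReal.ofReal (Q s)
  zero : α {0} = 0
  der : ∀ s, HasDerivAt Q (-(f s)) s
  cont : Continuous f
  pos : ∀ s, 0 < Q s
  fnn : ∀ s, 0 ≤ f s
  Ann : 0 ≤ A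
  lo : ∀ s, 0 ≤ s → s ≤ T → p * A * Real.exp (-s) * Q s ≤ f s
  hi : ∀ s, 0 ≤ s → s ≤ T → f s ≤ p' * A * Real.exp (-s) * Q s

theorem qf_pos {p : ℝ} (h0 : 0 < p) (h1 : p ≤ 1) (s : ℝ) : 0 < qf p s := by
  unfold qf
  have := Real.exp_pos (-s)
  nlinarith [mul_pos h0 this]

theorem qf_le_one {p : ℝ} (h0 : 0 < p) {s : ℝ} (hs : 0 ≤ s) : qf p s ≤ 1 := by
  unfold qf
  have : Real.exp (-s) ≤ 1 := Real.exp_le_one_iff.2 (by linarith)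
  nlinarith

theorem qf_zero (p : ℝ) : qf p 0 = 1 := by simp [qf]

theorem hasDerivAt_qf (p s : ℝ) : HasDerivAt (qf p) (-(p * Real.exp (-s))) s := by
  have h1 : HasDerivAt (fun s : ℝ => Real.exp (-s)) (Real.exp (-s) * (-1)) s :=
    (hasDerivAt_neg s).exp
  have := ((h1.const_sub 1).const_mul p).const_sub 1
  exact this.congr_deriv (by ring)

theorem Ctx.st {ν : Measure ℝ≥0∞} {p p' t : ℝ} (h : Ctx ν p p' t) {T : ℝ} (hT : T ≤ t) :
    St p p' ν (qf p) (fun s => p * Real.exp (-s)) 1 T where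
  fin := by have := h.prob; infer_instance
  tail := h.tail
  zero := h.zero
  der := hasDerivAt_qf p
  cont := by fun_prop
  pos := qf_pos h.p_pos h.p_le
  fnn := fun s => mul_nonneg h.p_pos.le (Real.exp_pos _).le
  Ann := zero_le_one
  lo := by
    intro s hs _
    have h1 := qf_le_one h.p_pos hs
    have h2 : 0 < p * Real.exp (-s) := mul_pos h.p_pos (Real.exp_pos _)
    nlinarith
  hi := by
    intro s hs hsT
    have h1 := h.hp' s hs (hsT.trans hT)
    have h2 := Real.exp_pos (-s)
    nlinarith

theorem St.step {ν : Measure ℝ≥0∞} {p p' t : ℝ} (hc : Ctx ν p p' t) {α : Measure ℝ≥0∞}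
    {Q f : ℝ → ℝ} {A T : ℝ} (h : St p p' α Q f A T) (hT : T ≤ t) {τ : ℝ} (h0 : 0 ≤ τ) :
    St p p' (step ν α (ENNReal.ofReal τ)) (fun s => Q (τ + s) * qf p s)
      (fun s => f (τ + s) * qf p s + Q (τ + s) * (p * Real.exp (-s)))
      (A * Real.exp (-τ) + 1) (T - τ) where
  fin := by have := hc.prob; have := h.fin; infer_instance
  tail := by
    intro s hs
    have := hc.prob; have := h.fin
    rw [step_tail, ← ENNReal.ofReal_add h0 hs, h.tail _ (by linarith), hc.tail s hs,
      ENNReal.ofReal_mul (h.pos _).le]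
  zero := by
    have := hc.prob; have := h.fin
    unfold _root_.step
    rw [Measure.map_apply (measurable_stepfun _) (measurableSet_singleton 0)]
    refine measure_mono_null (t := (Set.univ ×ˢ {0}) ∪ (Set.Iic (ENNReal.ofReal τ) ×ˢ Set.univ)) ?_ ?_
    · intro z hz
      simp only [Set.mem_preimage, Set.mem_singleton_iff] at hz
      rcases min_choice (z.1 - ENNReal.ofReal τ) z.2 with h | h
      · rw [h, tsub_eq_zero_iff_le] at hz
        right; exact ⟨hz, trivial⟩
      · left; rw [h] at hz; exact ⟨trivial, hz⟩
    · rw [measure_union_null_iff]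
      rw [Measure.prod_prod, Measure.prod_prod, hc.zero, Measure.restrict_apply measurableSet_Iic]
      have : Set.Iic (ENNReal.ofReal τ) ∩ Set.Ioi (ENNReal.ofReal τ) = ∅ := by
        ext x; simp
      simp [this]
  der := by
    intro s
    have h1 : HasDerivAt (fun s => Q (τ + s)) (-(f (τ + s))) s := by
      have := (h.der (τ + s)).comp_const_add τ s
      exact this
    have h2 := h1.mul (hasDerivAt_qf p s)
    exact h2.congr_deriv (by ring)
  cont := by
    have := h.cont
    have h2 : Continuous Q := continuous_iff_continuousAt.2 fun s => (h.der s).continuousAt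
    have h3 : Continuous (qf p) := continuous_iff_continuousAt.2 fun s =>
      (hasDerivAt_qf p s).continuousAt
    fun_prop
  pos := fun s => mul_pos (h.pos _) (qf_pos hc.p_pos hc.p_le s)
  fnn := fun s => add_nonneg (mul_nonneg (h.fnn _) (qf_pos hc.p_pos hc.p_le s).le)
    (mul_nonneg (h.pos _).le (mul_nonneg hc.p_pos.le (Real.exp_pos _).le))
  Ann := by have := mul_nonneg h.Ann (Real.exp_pos (-τ)).le; linarith
  lo := by
    intro s hs hsT
    have h1 := h.lo (τ + s) (by linarith) (by linarith)
    rw [neg_add, Real.exp_add] at h1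
    have h2 := qf_pos hc.p_pos hc.p_le s
    have h3 := qf_le_one hc.p_pos hs
    have h4 : 0 < p * Real.exp (-s) := mul_pos hc.p_pos (Real.exp_pos _)
    have h5 := h.pos (τ + s)
    have h6 := mul_le_mul_of_nonneg_right h1 h2.le
    have h7 : 0 ≤ Q (τ + s) * (p * Real.exp (-s)) * (1 - qf p s) :=
      mul_nonneg (mul_pos h5 h4).le (by linarith)
    calc p * (A * Real.exp (-τ) + 1) * Real.exp (-s) * (Q (τ + s) * qf p s)
        = p * A * (Real.exp (-τ) * Real.exp (-s)) * Q (τ + s) * qf p s +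
          Q (τ + s) * (p * Real.exp (-s)) * qf p s := by ring
      _ ≤ _ := by linarith
  hi := by
    intro s hs hsT
    have h1 := h.hi (τ + s) (by linarith) (by linarith)
    rw [neg_add, Real.exp_add] at h1
    have h2 := qf_pos hc.p_pos hc.p_le s
    have h3 := hc.hp' s hs (by linarith)
    have h4 : 0 < Real.exp (-s) := Real.exp_pos _
    have h5 := h.pos (τ + s)
    have h6 := mul_le_mul_of_nonneg_right h1 h2.le
    have h7 : 0 ≤ Q (τ + s) * (Real.exp (-s)) * (p' * qf p s - p) :=
      mul_nonneg (mul_pos h5 h4).le (by linarith)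
    calc f (τ + s) * qf p s + Q (τ + s) * (p * Real.exp (-s)) ≤ 
        p' * A * (Real.exp (-τ) * Real.exp (-s)) * Q (τ + s) * qf p s +
          Q (τ + s) * (Real.exp (-s)) * (p' * qf p s) := by linarith
      _ = _ := by ring

theorem St.contQ {p p' : ℝ} {α : Measure ℝ≥0∞}
    {Q f : ℝ → ℝ} {A T : ℝ} (h : St p p' α Q f A T) : Continuous Q :=
  continuous_iff_continuousAt.2 fun s => (h.der s).continuousAt

theorem St.univ {p p' : ℝ} {α : Measure ℝ≥0∞}
    {Q f : ℝ → ℝ} {A T : ℝ} (h : St p p' α Q f A T) : α Set.univ = ENNReal.ofReal (Q 0) := by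
  have h1 := h.tail 0 le_rfl
  rw [← h1, ENNReal.ofReal_zero]
  have : (Set.univ : Set ℝ≥0∞) = {0} ∪ Set.Ioi 0 := by
    ext x; simp [eq_or_lt_of_le, eq_comm, pos_iff_ne_zero, em]
  rw [this]
  refine le_antisymm ((measure_union_le _ _).trans ?_) (measure_mono Set.subset_union_right)
  rw [h.zero, zero_add]

theorem St.Iic {p p' : ℝ} {α : Measure ℝ≥0∞}
    {Q f : ℝ → ℝ} {A T : ℝ} (h : St p p' α Q f A T) {s : ℝ} (hs : 0 ≤ s) :
    α (Set.Iic (ENNReal.ofReal s)) = ENNReal.ofReal (Q 0 - Q s) := by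
  have := h.fin
  rw [← Set.compl_Ioi, measure_compl measurableSet_Ioi (measure_ne_top _ _), h.univ, h.tail s hs,
    ENNReal.ofReal_sub _ (h.pos s).le]

theorem St.density {p p' : ℝ} {α : Measure ℝ≥0∞}
    {Q f : ℝ → ℝ} {A T : ℝ} (h : St p p' α Q f A T) {t : ℝ} (ht : 0 ≤ t) :
    α.restrict (Set.Iic (ENNReal.ofReal t)) =
      ((volume.restrict (Set.Ioc 0 t)).withDensity (fun s => ENNReal.ofReal (f s))).map
        ENNReal.ofReal := by
  have := h.fin
  have hfm : Measurable (fun s => ENNReal.ofReal (f s)) := by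
    have := h.cont.measurable; fun_prop
  refine Measure.ext_of_Iic _ _ fun a => ?_
  rw [Measure.map_apply ENNReal.measurable_ofReal measurableSet_Iic,
    Measure.restrict_apply measurableSet_Iic, Set.Iic_inter_Iic]
  obtain ⟨s, hs0, hst, hs⟩ : ∃ s, 0 ≤ s ∧ s ≤ t ∧ a ⊓ ENNReal.ofReal t = ENNReal.ofReal s := by
    refine ⟨(a ⊓ ENNReal.ofReal t).toReal, ENNReal.toReal_nonneg, ?_, ?_⟩
    · exact ENNReal.toReal_le_of_le_ofReal ht inf_le_right
    · rw [ENNReal.ofReal_toReal]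
      exact (inf_le_right.trans_lt ENNReal.ofReal_lt_top).ne
  rw [hs, h.Iic hs0]
  have hpre : MeasurableSet (ENNReal.ofReal ⁻¹' Set.Iic a) :=
    ENNReal.measurable_ofReal measurableSet_Iic
  rw [withDensity_apply _ hpre, Measure.restrict_restrict hpre]
  have hset : ENNReal.ofReal ⁻¹' Set.Iic a ∩ Set.Ioc 0 t = Set.Ioc 0 s := by
    ext u
    simp only [Set.mem_inter_iff, Set.mem_preimage, Set.mem_Iic, Set.mem_Ioc]
    constructor
    · rintro ⟨h1, h2, h3⟩
      refine ⟨h2, ?_⟩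
      have : ENNReal.ofReal u ≤ ENNReal.ofReal s := by
        rw [← hs]; exact le_inf h1 (ENNReal.ofReal_le_ofReal h3)
      exact (ENNReal.ofReal_le_ofReal_iff hs0).1 this
    · rintro ⟨h1, h2⟩
      refine ⟨?_, h1, h2.trans hst⟩
      have := ENNReal.ofReal_le_ofReal h2
      rw [← hs] at this
      exact this.trans inf_le_left
  rw [hset, ← ofReal_integral_eq_lintegral_ofReal]
  · congr 1
    rw [← intervalIntegral.integral_of_le hs0]
    have h3 := intervalIntegral.integral_eq_sub_of_hasDerivAt (a := 0) (b := s)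
      (fun x _ => h.der x) (h.cont.neg.intervalIntegrable _ _)
    rw [intervalIntegral.integral_neg] at h3
    linarith
  · exact h.cont.integrableOn_Ioc
  · exact Eventually.of_forall h.fnn

theorem St.noatom {p p' : ℝ} {α : Measure ℝ≥0∞}
    {Q f : ℝ → ℝ} {A T : ℝ} (h : St p p' α Q f A T) (τ : ℝ≥0∞) (hτ : τ < ⊤) : α {τ} = 0 := by
  by_cases h0 : τ = 0
  · rw [h0]; exact h.zero
  have h1 : α {τ} = α.restrict (Set.Iic (ENNReal.ofReal τ.toReal)) {τ} := by
    rw [Measure.restrict_apply (measurableSet_singleton τ), ENNReal.ofReal_toReal hτ.ne]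
    congr 1
    ext x; simp
  rw [h1, h.density ENNReal.toReal_nonneg,
    Measure.map_apply ENNReal.measurable_ofReal (measurableSet_singleton τ)]
  apply withDensity_absolutelyContinuous
  apply Measure.absolutelyContinuous_of_le Measure.restrict_le_self
  refine measure_mono_null (t := {τ.toReal}) ?_ (by simp)
  intro x hx
  simp only [Set.mem_preimage, Set.mem_singleton_iff] at hx ⊢
  have hx0 : 0 < x := by
    by_contra hc
    exact h0 (by rw [← hx, ENNReal.ofReal_eq_zero]; linarith)
  rw [← hx, ENNReal.toReal_ofReal hx0.le]

theorem St.lint {p p' : ℝ} {α : Measure ℝ≥0∞}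
    {Q f : ℝ → ℝ} {A T : ℝ} (h : St p p' α Q f A T) {t : ℝ} (ht : 0 ≤ t)
    (G : ℝ≥0∞ → ℝ≥0∞) (hG : Measurable G) :
    ∫⁻ τ in Set.Iic (ENNReal.ofReal t), G τ ∂α =
      ∫⁻ s in Set.Ioc 0 t, ENNReal.ofReal (f s) * G (ENNReal.ofReal s) := by
  have hfm : Measurable (fun s => ENNReal.ofReal (f s)) := by
    have := h.cont.measurable; fun_prop
  rw [h.density ht, lintegral_map hG ENNReal.measurable_ofReal,
    lintegral_withDensity_eq_lintegral_mul _ hfm (g := fun a => G (ENNReal.ofReal a)) 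
      (hG.comp ENNReal.measurable_ofReal)]
  rfl

/-! ### Part 5: abstract bounds -/

theorem ftc_lower {Y Y' g : ℝ → ℝ} {T : ℝ} (hT : 0 ≤ T)
    (hY : ∀ s ∈ Set.Icc 0 T, HasDerivAt Y (Y' s) s) (hg : ContinuousOn g (Set.Icc 0 T))
    (hgn : ∀ s ∈ Set.Icc 0 T, 0 ≤ g s) (hle : ∀ s ∈ Set.Icc 0 T, -(Y' s) ≤ g s) :
    ENNReal.ofReal (Y 0) ≤ ENNReal.ofReal (Y T) +
      ∫⁻ s in Set.Ioc 0 T, ENNReal.ofReal (g s) := by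
  have hgi : IntegrableOn g (Set.Icc 0 T) := hg.integrableOn_Icc
  have h1 := intervalIntegral.sub_le_integral_of_hasDeriv_right_of_le hT
    (g := fun s => -Y s) (g' := fun s => -Y' s) (φ := g)
    (fun s hs => (hY s hs).continuousAt.continuousWithinAt.neg)
    (fun s hs => ((hY s (Set.Ioo_subset_Icc_self hs)).neg).hasDerivWithinAt)
    hgi (fun s hs => hle s (Set.Ioo_subset_Icc_self hs))
  rw [intervalIntegral.integral_of_le hT] at h1
  rw [← ofReal_integral_eq_lintegral_ofReal (hgi.mono_set Set.Ioc_subset_Icc_self)]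
  · refine le_trans ?_ ENNReal.ofReal_add_le
    exact ENNReal.ofReal_le_ofReal (by linarith)
  · exact (ae_restrict_iff' measurableSet_Ioc).2 
      (Eventually.of_forall fun s hs => hgn s (Set.Ioc_subset_Icc_self hs))

theorem ftc_upper {Y Y' g : ℝ → ℝ} {T : ℝ} (hT : 0 ≤ T)
    (hY : ∀ s ∈ Set.Icc 0 T, HasDerivAt Y (Y' s) s) (hg : ContinuousOn g (Set.Icc 0 T))
    (hgn : ∀ s ∈ Set.Icc 0 T, 0 ≤ g s) (hle : ∀ s ∈ Set.Icc 0 T, g s ≤ -(Y' s)) (hYT : 0 ≤ Y T) :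
    ENNReal.ofReal (Y T) + ∫⁻ s in Set.Ioc 0 T, ENNReal.ofReal (g s) ≤ ENNReal.ofReal (Y 0) := by
  have hgi : IntegrableOn g (Set.Icc 0 T) := hg.integrableOn_Icc
  have h1 := intervalIntegral.integral_le_sub_of_hasDeriv_right_of_le hT
    (g := fun s => -Y s) (g' := fun s => -Y' s) (φ := g)
    (fun s hs => (hY s hs).continuousAt.continuousWithinAt.neg)
    (fun s hs => ((hY s (Set.Ioo_subset_Icc_self hs)).neg).hasDerivWithinAt)
    hgi (fun s hs => hle s (Set.Ioo_subset_Icc_self hs))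
  rw [intervalIntegral.integral_of_le hT] at h1
  have hae : 0 ≤ᵐ[volume.restrict (Set.Ioc 0 T)] g := (ae_restrict_iff' measurableSet_Ioc).2 
      (Eventually.of_forall fun s hs => hgn s (Set.Ioc_subset_Icc_self hs))
  rw [← ofReal_integral_eq_lintegral_ofReal (hgi.mono_set Set.Ioc_subset_Icc_self) hae,
    ← ENNReal.ofReal_add hYT (integral_nonneg_of_ae hae)]
  exact ENNReal.ofReal_le_ofReal (by linarith)

theorem Yder {Q f v : ℝ → ℝ} {A T s vd : ℝ} (k : ℕ) (hQ : HasDerivAt Q (-(f s)) s)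
    (hv : HasDerivAt v vd (T - s)) :
    HasDerivAt (fun s => Q s ^ k * Real.exp (-(A * Real.exp (-s) * v (T - s))))
      (Real.exp (-(A * Real.exp (-s) * v (T - s))) *
        (-(k * Q s ^ (k - 1) * f s) + Q s ^ k * (A * Real.exp (-s)) * (v (T - s) + vd))) s := by
  have h1 : HasDerivAt (fun s : ℝ => Real.exp (-s)) (Real.exp (-s) * (-1)) s :=
    (hasDerivAt_neg s).exp
  have h2 : HasDerivAt (fun s => v (T - s)) (-vd) s := hv.comp_const_sub T s
  have h3 := (hQ.pow k).mul (((h1.const_mul A).mul h2).neg.exp)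
  exact h3.congr_deriv (by simp only [Pi.mul_apply, Pi.neg_apply, Pi.pow_apply]; ring)

theorem kQ {Q : ℝ} (hQ : 0 < Q) (k : ℕ) : (k : ℝ) * Q ^ (k - 1) = k * Q ^ k / Q := by
  rcases k with _ | k
  · simp
  · rw [Nat.add_sub_cancel, pow_succ]; field_simp

theorem kQ2 {Q : ℝ} (hQ : 0 < Q) (m j : ℕ) : (m : ℝ) * Q ^ (m - 1 + j) = m * Q ^ (m + j) / Q := by
  rcases m with _ | k
  · simp
  · rw [Nat.add_sub_cancel, show k + 1 + j = (k + j) + 1 by ring, pow_succ]; field_simp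

/-- integrand after one step -/
def gint (Q f c v : ℝ → ℝ) (A T : ℝ) (m j : ℕ) (s : ℝ) : ℝ :=
  m * (f s * (c (T - s) * (Q s ^ (m - 1 + j) * Real.exp (-((A * Real.exp (-s) + 1) * v (T - s))))))

theorem gint_eq (Q f c v : ℝ → ℝ) (A T : ℝ) (m j : ℕ) (s : ℝ) (hQ : 0 < Q s) :
    gint Q f c v A T m j s = Real.exp (-(A * Real.exp (-s) * v (T - s))) * (Q s ^ (m + j) / Q s) *
      (f s * (m * (c (T - s) * Real.exp (-(v (T - s)))))) := by
  unfold gint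
  have h1 : Real.exp (-((A * Real.exp (-s) + 1) * v (T - s))) =
      Real.exp (-(A * Real.exp (-s) * v (T - s))) * Real.exp (-(v (T - s))) := by
    rw [← Real.exp_add]; congr 1; ring
  rw [h1]
  have := kQ2 hQ m j
  calc _ = (m * Q s ^ (m - 1 + j)) * (f s * (c (T - s) * (Real.exp (-(A * Real.exp (-s) * v (T - s))) * Real.exp (-(v (T - s)))))) := by ring
    _ = _ := by rw [this]; ring

theorem gint_cont {Q f c v : ℝ → ℝ} {A T : ℝ} {m j : ℕ} (hQ : Continuous Q) (hf : Continuous f)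
    (hc : Continuous c) (hv : ContinuousOn (fun s => v (T - s)) (Set.Icc 0 T)) :
    ContinuousOn (gint Q f c v A T m j) (Set.Icc 0 T) := by
  have hcc : Continuous (fun s => c (T - s)) := hc.comp (continuous_const.sub continuous_id)
  have he : Continuous (fun s => A * Real.exp (-s) + 1) := by fun_prop
  refine continuousOn_const.mul (hf.continuousOn.mul (hcc.continuousOn.mul
    ((hQ.pow _).continuousOn.mul ?_)))
  exact ((he.continuousOn.mul hv).neg).rexp

theorem lower_point {p p' t : ℝ} {α : Measure ℝ≥0∞} {Q f : ℝ → ℝ} {A T : ℝ}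
    (h : St p p' α Q f A T) (hT : 0 ≤ T) (hTt : T ≤ t) (c v vd : ℝ → ℝ) (m M j : ℕ) (hm : m ≤ M)
    (hc : Continuous c) (hc0 : ∀ s, 0 ≤ c s)
    (hv : ∀ s ∈ Set.Icc 0 t, HasDerivAt v (vd s) s)
    (hce : ∀ s ∈ Set.Icc 0 t, c s * Real.exp (-(v s)) ≤ 1)
    (hode : ∀ s ∈ Set.Icc 0 t, p' * (M * (1 - c s * Real.exp (-(v s))) + j) ≤ v s + vd s) :
    ENNReal.ofReal (Q 0 ^ (m + j) * Real.exp (-(A * v T))) ≤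
      ENNReal.ofReal (Q T ^ (m + j) * Real.exp (-(A * Real.exp (-T) * v 0))) +
      ∫⁻ s in Set.Ioc 0 T, ENNReal.ofReal (gint Q f c v A T m j s) := by
  have hsub : ∀ s ∈ Set.Icc 0 T, T - s ∈ Set.Icc 0 t := fun s hs =>
    ⟨by linarith [hs.2], by linarith [hs.1]⟩
  have h1 := ftc_lower (g := gint Q f c v A T m j) hT 
    (fun s hs => Yder (A := A) (m + j) (h.der s) (hv (T - s) (hsub s hs)))
    ?_ ?_ ?_
  · simpa using h1
  · have hvc : ContinuousOn (fun s => v (T - s)) (Set.Icc 0 T) := fun s hs =>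
      ((hv _ (hsub s hs)).comp_const_sub T s).continuousAt.continuousWithinAt
    exact gint_cont h.contQ h.cont hc hvc
  · intro s hs
    unfold gint
    have := h.pos s
    have := h.fnn s
    have := hc0 (T - s)
    positivity
  · intro s hs
    rw [gint_eq _ _ _ _ _ _ _ _ _ (h.pos s), kQ (h.pos s)]
    have hQ := h.pos s
    have hf := h.fnn s
    have hfi := h.hi s hs.1 hs.2
    have ho := hode _ (hsub s hs)
    have hce' := hce _ (hsub s hs)
    set E := Real.exp (-(A * Real.exp (-s) * v (T - s)))
    have hE : 0 < E := Real.exp_pos _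
    set d := c (T - s) * Real.exp (-(v (T - s)))
    have hQk : 0 < Q s ^ (m + j) / Q s := div_pos (pow_pos hQ _) hQ
    have hmM : (m : ℝ) ≤ M := by exact_mod_cast hm
    have key : f s * (m * (1 - d) + j) ≤ Q s * (A * Real.exp (-s)) * (v (T - s) + vd (T - s)) := by
      calc f s * (m * (1 - d) + j) ≤ p' * A * Real.exp (-s) * Q s * (m * (1 - d) + j) := by
            refine mul_le_mul_of_nonneg_right hfi ?_
            have : 0 ≤ 1 - d := by linarith
            positivity
        _ ≤ p' * A * Real.exp (-s) * Q s * (M * (1 - d) + j) := by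
            refine mul_le_mul_of_nonneg_left ?_ (hf.trans hfi)
            have : 0 ≤ 1 - d := by linarith
            nlinarith
        _ = Q s * (A * Real.exp (-s)) * (p' * (M * (1 - d) + j)) := by ring
        _ ≤ _ := by
            refine mul_le_mul_of_nonneg_left ho ?_
            have := h.Ann
            positivity
    have e1 : -(E * (-(((m + j : ℕ) : ℝ) * Q s ^ (m + j) / Q s * f s) + Q s ^ (m + j) * (A * Real.exp (-s)) *
        (v (T - s) + vd (T - s)))) = E * (Q s ^ (m + j) / Q s) * (f s * (m + j) - 
          Q s * (A * Real.exp (-s)) * (v (T - s) + vd (T - s))) := by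
      push_cast
      field_simp
      ring
    rw [e1]
    refine mul_le_mul_of_nonneg_left ?_ (mul_pos hE hQk).le
    linarith

theorem upper_point {p p' t : ℝ} {α : Measure ℝ≥0∞} {Q f : ℝ → ℝ} {A T : ℝ} (hp : 0 ≤ p)
    (h : St p p' α Q f A T) (hT : 0 ≤ T) (hTt : T ≤ t) (c v vd : ℝ → ℝ) (m j : ℕ) (M : ℝ) 
    (hm : M ≤ m) 
    (hc : Continuous c) (hc0 : ∀ s, 0 ≤ c s)
    (hv : ∀ s ∈ Set.Icc 0 t, HasDerivAt v (vd s) s)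
    (hce : ∀ s ∈ Set.Icc 0 t, c s * Real.exp (-(v s)) ≤ 1)
    (hode : ∀ s ∈ Set.Icc 0 t, v s + vd s ≤ p * (M * (1 - c s * Real.exp (-(v s))))) :
      ENNReal.ofReal (Q T ^ (m + j) * Real.exp (-(A * Real.exp (-T) * v 0))) +
      ∫⁻ s in Set.Ioc 0 T, ENNReal.ofReal (gint Q f c v A T m j s) ≤ 
    ENNReal.ofReal (Q 0 ^ (m + j) * Real.exp (-(A * v T))) := by
  have hsub : ∀ s ∈ Set.Icc 0 T, T - s ∈ Set.Icc 0 t := fun s hs =>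
    ⟨by linarith [hs.2], by linarith [hs.1]⟩
  have h1 := ftc_upper (g := gint Q f c v A T m j) hT 
    (fun s hs => Yder (A := A) (m + j) (h.der s) (hv (T - s) (hsub s hs)))
    ?_ ?_ ?_ ?_
  · simpa using h1
  · have hvc : ContinuousOn (fun s => v (T - s)) (Set.Icc 0 T) := fun s hs =>
      ((hv _ (hsub s hs)).comp_const_sub T s).continuousAt.continuousWithinAt
    exact gint_cont h.contQ h.cont hc hvc
  · intro s hs
    unfold gint
    have := h.pos s
    have := h.fnn s
    have := hc0 (T - s)
    positivity
  · intro s hs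
    rw [gint_eq _ _ _ _ _ _ _ _ _ (h.pos s), kQ (h.pos s)]
    have hQ := h.pos s
    have hf := h.fnn s
    have hfi := h.lo s hs.1 hs.2
    have ho := hode _ (hsub s hs)
    have hce' := hce _ (hsub s hs)
    set E := Real.exp (-(A * Real.exp (-s) * v (T - s)))
    have hE : 0 < E := Real.exp_pos _
    set d := c (T - s) * Real.exp (-(v (T - s)))
    have hQk : 0 < Q s ^ (m + j) / Q s := div_pos (pow_pos hQ _) hQ
    have hd : 0 ≤ 1 - d := by linarith
    have hA := h.Ann
    have key : Q s * (A * Real.exp (-s)) * (v (T - s) + vd (T - s)) ≤ f s * (m * (1 - d) + j) := by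
      calc Q s * (A * Real.exp (-s)) * (v (T - s) + vd (T - s))
          ≤ Q s * (A * Real.exp (-s)) * (p * (M * (1 - d))) := by
            refine mul_le_mul_of_nonneg_left ho ?_
            positivity
        _ ≤ Q s * (A * Real.exp (-s)) * (p * (m * (1 - d))) := by gcongr
        _ = p * A * Real.exp (-s) * Q s * (m * (1 - d)) := by ring
        _ ≤ f s * (m * (1 - d)) := by
            refine mul_le_mul_of_nonneg_right hfi ?_
            positivity
        _ ≤ _ := by
            refine mul_le_mul_of_nonneg_left ?_ hf
            have : (0 : ℝ) ≤ j := by positivity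
            linarith
    have e1 : -(E * (-(((m + j : ℕ) : ℝ) * Q s ^ (m + j) / Q s * f s) + Q s ^ (m + j) * (A * Real.exp (-s)) *
        (v (T - s) + vd (T - s)))) = E * (Q s ^ (m + j) / Q s) * (f s * (m + j) - 
          Q s * (A * Real.exp (-s)) * (v (T - s) + vd (T - s))) := by
      push_cast
      field_simp
      ring
    rw [e1]
    refine mul_le_mul_of_nonneg_left ?_ (mul_pos hE hQk).le
    linarith
  · have := h.pos T
    positivity

/-! ### Part 6: abstract induction -/

theorem St.mono {p p' : ℝ} {α : Measure ℝ≥0∞} {Q f : ℝ → ℝ} {A T T' : ℝ}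
    (h : St p p' α Q f A T) (hT : T' ≤ T) : St p p' α Q f A T' where
  fin := h.fin
  tail := h.tail
  zero := h.zero
  der := h.der
  cont := h.cont
  pos := h.pos
  fnn := h.fnn
  Ann := h.Ann
  lo := fun s h0 h1 => h.lo s h0 (h1.trans hT)
  hi := fun s h0 h1 => h.hi s h0 (h1.trans hT)

theorem meas_aux {Q : ℝ → ℝ} {A T : ℝ} (k : ℕ) (hQ : Measurable Q) (v : ℝ → ℝ → ℝ)
    (hvm : Measurable (fun x : ℝ × ℝ => v x.1 x.2)) :
    Measurable (fun x : ℝ × ℝ => ENNReal.ofReal (Q x.1 ^ k *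
      Real.exp (-((A * Real.exp (-x.1) + 1) * v x.2 (T - x.1))))) := by
  have h1 : Measurable (fun x : ℝ × ℝ => v x.2 (T - x.1)) := by
    have : Measurable (fun x : ℝ × ℝ => ((x.2, T - x.1) : ℝ × ℝ)) := by fun_prop
    exact hvm.comp this
  have h2 : Measurable (fun x : ℝ × ℝ => Q x.1) := hQ.comp measurable_fst
  fun_prop

theorem lint_gint {p p' : ℝ} {α : Measure ℝ≥0∞} {Q f : ℝ → ℝ} {A T : ℝ}
    (h : St p p' α Q f A T) (hT : 0 ≤ T) (c : ℝ → ℝ) (hc : Continuous c) (hc0 : ∀ s, 0 ≤ c s)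
    (P : Measure ℝ) [SFinite P] (v : ℝ → ℝ → ℝ)
    (hvm : Measurable (fun x : ℝ × ℝ => v x.1 x.2)) (m j : ℕ) :
    (m : ℝ≥0∞) * ∫⁻ τ in Set.Iic (ENNReal.ofReal T), ENNReal.ofReal (c (T - τ.toReal)) *
      (∫⁻ z, ENNReal.ofReal (Q τ.toReal ^ (m - 1 + j) *
        Real.exp (-((A * Real.exp (-τ.toReal) + 1) * v z (T - τ.toReal)))) ∂P) ∂α =
    ∫⁻ z, (∫⁻ s in Set.Ioc 0 T, ENNReal.ofReal (gint Q f c (v z) A T m j s)) ∂P := by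
  have hm := meas_aux (A := A) (T := T) (m - 1 + j) h.contQ.measurable v hvm
  have hm2 : Measurable (fun s : ℝ => ∫⁻ z, ENNReal.ofReal (Q s ^ (m - 1 + j) *
        Real.exp (-((A * Real.exp (-s) + 1) * v z (T - s)))) ∂P) :=
    Measurable.lintegral_prod_right' hm
  have hm3 : Measurable (fun s : ℝ => ENNReal.ofReal (c (T - s)) * 
      ∫⁻ z, ENNReal.ofReal (Q s ^ (m - 1 + j) *
        Real.exp (-((A * Real.exp (-s) + 1) * v z (T - s)))) ∂P) := by
    have : Measurable c := hc.measurable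
    exact Measurable.mul (by fun_prop) hm2
  have hh := h.lint hT _ (hm3.comp ENNReal.measurable_toReal)
  simp only [Function.comp_def] at hh
  rw [hh]
  rw [lintegral_lintegral_swap (f := fun z s => ENNReal.ofReal (gint Q f c (v z) A T m j s)),
    ← lintegral_const_mul' _ _ (ENNReal.natCast_ne_top m)]
  · refine setLIntegral_congr_fun measurableSet_Ioc fun s hs => ?_
    beta_reduce
    rw [ENNReal.toReal_ofReal hs.1.le]
    have hms : Measurable (fun z => ENNReal.ofReal (Q s ^ (m - 1 + j) *
        Real.exp (-((A * Real.exp (-s) + 1) * v z (T - s))))) := hm.comp measurable_prodMk_left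
    rw [← lintegral_const_mul _ hms, ← lintegral_const_mul _ (hms.const_mul _),
      ← lintegral_const_mul _ ((hms.const_mul _).const_mul _)]
    refine lintegral_congr fun z => ?_
    unfold gint
    rw [ENNReal.ofReal_mul (Nat.cast_nonneg m), ENNReal.ofReal_natCast, ENNReal.ofReal_mul (h.fnn s),
      ENNReal.ofReal_mul (hc0 _)]
  · have h1 : Measurable (fun x : ℝ × ℝ => v x.1 (T - x.2)) := by
      have : Measurable (fun x : ℝ × ℝ => ((x.1, T - x.2) : ℝ × ℝ)) := by fun_prop
      exact hvm.comp this
    have h2 : Measurable (fun x : ℝ × ℝ => Q x.2) := h.contQ.measurable.comp measurable_snd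
    have h3 : Measurable (fun x : ℝ × ℝ => f x.2) := h.cont.measurable.comp measurable_snd
    have h4 : Measurable c := hc.measurable
    refine Measurable.aemeasurable ?_
    unfold Function.uncurry gint
    refine ENNReal.measurable_ofReal.comp (measurable_const.mul (h3.mul (Measurable.mul ?_
      ((h2.pow_const _).mul (Measurable.exp ?_)))))
    · fun_prop
    · exact Measurable.neg (Measurable.mul (by fun_prop) h1)

theorem ofReal_toReal_Iic {T : ℝ} {τ : ℝ≥0∞} (hτ : τ ∈ Set.Iic (ENNReal.ofReal T)) (hT : 0 ≤ T) :
    ENNReal.ofReal τ.toReal = τ ∧ 0 ≤ τ.toReal ∧ τ.toReal ≤ T := by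
  have h1 : τ ≠ ⊤ := ne_top_of_le_ne_top ENNReal.ofReal_ne_top hτ
  refine ⟨ENNReal.ofReal_toReal h1, ENNReal.toReal_nonneg, ENNReal.toReal_le_of_le_ofReal hT hτ⟩

theorem lower_abs {ν : Measure ℝ≥0∞} {p p' t H : ℝ} (hctx : Ctx ν p p' t) (hH : 0 ≤ H) (j M : ℕ)
    (E : ℕ → Measure ℝ≥0∞ → ℝ → ℝ≥0∞) (c : ℝ → ℝ) (hc : Continuous c) (hc0 : ∀ s, 0 ≤ c s)
    (P : Measure ℝ) [SFinite P] (v vd : ℝ → ℝ → ℝ)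
    (hvm : Measurable (fun x : ℝ × ℝ => v x.1 x.2))
    (hrec : ∀ m ≤ M, ∀ α Q f A T, 0 ≤ T → T + H ≤ t → St p p' α Q f A (T + H) →
      (∫⁻ z, ENNReal.ofReal (Q T ^ (m + j) * Real.exp (-(A * Real.exp (-T) * v z 0))) ∂P) +
      (m : ℝ≥0∞) * ∫⁻ τ in Set.Iic (ENNReal.ofReal T), ENNReal.ofReal (c (T - τ.toReal)) *
        E (m - 1) (step ν α τ) (T - τ.toReal) ∂α ≤ E m α T)
    (hv : ∀ᵐ z ∂P, ∀ s ∈ Set.Icc 0 t, HasDerivAt (v z) (vd z s) s)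
    (hce : ∀ᵐ z ∂P, ∀ s ∈ Set.Icc 0 t, c s * Real.exp (-(v z s)) ≤ 1)
    (hode : ∀ᵐ z ∂P, ∀ s ∈ Set.Icc 0 t,
      p' * (M * (1 - c s * Real.exp (-(v z s))) + j) ≤ v z s + vd z s) :
    ∀ m ≤ M, ∀ α Q f A T, 0 ≤ T → T + H ≤ t → St p p' α Q f A (T + H) →
      ∫⁻ z, ENNReal.ofReal (Q 0 ^ (m + j) * Real.exp (-(A * v z T))) ∂P ≤ E m α T := by
  intro m
  induction m using Nat.strong_induction_on with
  | _ m ih =>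
  intro hm α Q f A T hT hTt h
  refine le_trans ?_ (hrec m hm α Q f A T hT hTt h)
  have hS : St p p' α Q f A T := h.mono (by linarith)
  have h1 : (m : ℝ≥0∞) * ∫⁻ τ in Set.Iic (ENNReal.ofReal T), ENNReal.ofReal (c (T - τ.toReal)) *
      (∫⁻ z, ENNReal.ofReal (Q τ.toReal ^ (m - 1 + j) *
        Real.exp (-((A * Real.exp (-τ.toReal) + 1) * v z (T - τ.toReal)))) ∂P) ∂α ≤
      (m : ℝ≥0∞) * ∫⁻ τ in Set.Iic (ENNReal.ofReal T), ENNReal.ofReal (c (T - τ.toReal)) *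
        E (m - 1) (step ν α τ) (T - τ.toReal) ∂α := by
    rcases Nat.eq_zero_or_pos m with h0 | h0
    · simp [h0]
    refine mul_le_mul_right (setLIntegral_mono' measurableSet_Iic fun τ hτ => ?_) _
    obtain ⟨e1, e2, e3⟩ := ofReal_toReal_Iic hτ hT
    refine mul_le_mul_right ?_ _
    have hst := h.step hctx hTt e2
    rw [e1] at hst
    have := ih (m - 1) (by omega) (by omega) _ _ _ _ (T - τ.toReal) (by linarith) (by linarith)
      (hst.mono (by linarith))
    simpa [qf_zero] using this
  rw [lint_gint hS hT c hc hc0 P v hvm] at h1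
  refine le_trans ?_ (add_le_add_right h1 _)
  have hm0 : Measurable (fun z => v z 0) := 
    hvm.comp (measurable_id.prodMk measurable_const)
  rw [← lintegral_add_left (by fun_prop)]
  refine lintegral_mono_ae ?_
  filter_upwards [hv, hce, hode] with z g1 g2 g3
  exact lower_point hS hT (by linarith) c (v z) (vd z) m M j hm hc hc0 g1 g2 g3

theorem Xder {Q f e : ℝ → ℝ} {A T s ed ε B K : ℝ} (k : ℕ) (hQ : HasDerivAt Q (-(f s)) s)
    (he : HasDerivAt e ed (T - s)) :
    HasDerivAt (fun s => Q s ^ k * (ε + (B + A * Real.exp (-s) * e (T - s)) / K))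
      (-(k * Q s ^ (k - 1) * f s * (ε + (B + A * Real.exp (-s) * e (T - s)) / K)) -
         Q s ^ k * (A * Real.exp (-s) * (e (T - s) + ed) / K)) s := by
  have h1 : HasDerivAt (fun s : ℝ => Real.exp (-s)) (Real.exp (-s) * (-1)) s :=
    (hasDerivAt_neg s).exp
  have h2 : HasDerivAt (fun s => e (T - s)) (-ed) s := he.comp_const_sub T s
  have h3 := (hQ.pow k).mul ((((((h1.const_mul A).mul h2).const_add B).div_const K).const_add ε))
  exact h3.congr_deriv (by simp only [Pi.mul_apply, Pi.pow_apply]; ring)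

theorem upper_err {p p' t : ℝ} {α : Measure ℝ≥0∞} {Q f : ℝ → ℝ} {A T : ℝ}
    (h : St p p' α Q f A T) (hT : 0 ≤ T) (hTt : T ≤ t) (c e ed : ℝ → ℝ) (m j : ℕ) (M0 : ℕ)
    (hm : m ≤ M0) {ε K : ℝ} (hε : 0 ≤ ε) (hK : 0 < K)
    (hc : Continuous c) (hc0 : ∀ s, 0 ≤ c s) (hc1 : ∀ s ∈ Set.Icc 0 t, c s ≤ 1)
    (he : ∀ s ∈ Set.Icc 0 t, HasDerivAt e (ed s) s)
    (he0 : ∀ s ∈ Set.Icc 0 t, 0 ≤ e s)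
    (hode : ∀ s ∈ Set.Icc 0 t, p' * M0 * (1 + e s) ≤ e s + ed s) :
      ENNReal.ofReal (Q T ^ (m + j) * ε) +
      ∫⁻ s in Set.Ioc 0 T, ENNReal.ofReal (m * (f s * (c (T - s) * (Q s ^ (m - 1 + j) *
        (ε + ((M0 - m + 1 : ℝ) + (A * Real.exp (-s) + 1) * e (T - s)) / K))))) ≤ 
    ENNReal.ofReal (Q 0 ^ (m + j) * (ε + ((M0 - m : ℝ) + A * e T) / K)) := by
  have hsub : ∀ s ∈ Set.Icc 0 T, T - s ∈ Set.Icc 0 t := fun s hs =>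
    ⟨by linarith [hs.2], by linarith [hs.1]⟩
  have hA := h.Ann
  have hmM : (m : ℝ) ≤ M0 := by exact_mod_cast hm
  have h1 := ftc_upper (g := fun s => (m * (f s * (c (T - s) * (Q s ^ (m - 1 + j) *
        (ε + ((M0 - m + 1 : ℝ) + (A * Real.exp (-s) + 1) * e (T - s)) / K)))))) hT 
    (fun s hs => Xder (A := A) (ε := ε) (B := (M0 - m : ℝ)) (K := K) (m + j) (h.der s) 
      (he (T - s) (hsub s hs)))
    ?_ ?_ ?_ ?_
  · simp only [neg_zero, Real.exp_zero, mul_one, sub_zero, sub_self] at h1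
    refine le_trans (add_le_add_left (ENNReal.ofReal_le_ofReal ?_) _) h1
    have hQ := h.pos T
    have h0 := he0 0 ⟨le_rfl, hT.trans hTt⟩
    have : 0 ≤ ((M0 - m : ℝ) + A * Real.exp (-T) * e 0) / K :=
      div_nonneg (add_nonneg (by linarith) (by positivity)) hK.le
    gcongr
    linarith
  · have hec : ContinuousOn (fun s => e (T - s)) (Set.Icc 0 T) := fun s hs =>
      ((he _ (hsub s hs)).comp_const_sub T s).continuousAt.continuousWithinAt
    have hcc : Continuous (fun s => c (T - s)) := hc.comp (continuous_const.sub continuous_id)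
    have hee : Continuous (fun s => A * Real.exp (-s) + 1) := by fun_prop
    refine continuousOn_const.mul (h.cont.continuousOn.mul (hcc.continuousOn.mul
      ((h.contQ.pow _).continuousOn.mul ?_)))
    exact continuousOn_const.add ((continuousOn_const.add (hee.continuousOn.mul hec)).div_const _)
  · intro s hs
    have := h.pos s
    have := h.fnn s
    have := hc0 (T - s)
    have := he0 _ (hsub s hs)
    have h5 : (0 : ℝ) ≤ M0 - m + 1 := by linarith
    positivity
  · intro s hs
    have hQ := h.pos s
    have hf := h.fnn s
    have hfi := h.hi s hs.1 hs.2
    have ho := hode _ (hsub s hs)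
    have hcc0 := hc0 (T - s)
    have hcc1 := hc1 _ (hsub s hs)
    have hee := he0 _ (hsub s hs)
    set a := Real.exp (-s)
    have ha : 0 < a := Real.exp_pos _
    rw [kQ hQ]
    have e0 := kQ2 hQ m j
    set R := Q s ^ (m + j) / Q s with hR
    have hQk : 0 < R := div_pos (pow_pos hQ _) hQ
    have hR2 : Q s ^ (m + j) = R * Q s := by rw [hR]; field_simp
    have key : m * f s * (1 + e (T - s)) ≤ Q s * (A * a * (e (T - s) + ed (T - s))) := by
      calc m * f s * (1 + e (T - s)) ≤ M0 * (p' * A * a * Q s) * (1 + e (T - s)) := by gcongr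
        _ = Q s * A * a * (p' * M0 * (1 + e (T - s))) := by ring
        _ ≤ Q s * A * a * (e (T - s) + ed (T - s)) := by gcongr
        _ = _ := by ring
    set B := ε + ((M0 - m : ℝ) + A * a * e (T - s)) / K with hB
    have hB0 : 0 ≤ B := add_nonneg hε (div_nonneg (add_nonneg (by linarith) (by positivity)) hK.le)
    have hB2 : ε + ((M0 - m + 1 : ℝ) + (A * a + 1) * e (T - s)) / K = B + (1 + e (T - s)) / K := by
      rw [hB]; ring
    rw [hB2]
    calc (m : ℝ) * (f s * (c (T - s) * (Q s ^ (m - 1 + j) * (B + (1 + e (T - s)) / K)))) 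
        = (m * Q s ^ (m - 1 + j)) * (f s * (c (T - s) * (B + (1 + e (T - s)) / K))) := by ring
      _ = R * (m * (f s * (c (T - s) * (B + (1 + e (T - s)) / K)))) := by rw [e0, hR]; ring
      _ ≤ R * (m * (f s * (1 * (B + (1 + e (T - s)) / K)))) := by gcongr
      _ = R * (m * f s * B + m * f s * (1 + e (T - s)) / K) := by ring
      _ ≤ R * ((m + j : ℕ) * f s * B + Q s * (A * a * (e (T - s) + ed (T - s))) / K) := by
          gcongr
          omega
      _ = _ := by rw [hR2]; field_simp; ring
  · have := h.pos T
    have h0 := he0 0 ⟨le_rfl, hT.trans hTt⟩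
    have h5 : (0 : ℝ) ≤ M0 - m := by linarith
    rw [sub_self]
    positivity

theorem upper_abs {ν : Measure ℝ≥0∞} {p p' t H : ℝ} (hctx : Ctx ν p p' t) (hH : 0 ≤ H) (j M0 : ℕ)
    (E : ℕ → Measure ℝ≥0∞ → ℝ → ℝ≥0∞) (c : ℝ → ℝ) (hc : Continuous c) (hc0 : ∀ s, 0 ≤ c s)
    (hc1 : ∀ s ∈ Set.Icc 0 t, c s ≤ 1)
    (P : Measure ℝ) [SFinite P] (v vd : ℝ → ℝ → ℝ)
    (hvm : Measurable (fun x : ℝ × ℝ => v x.1 x.2)) {ε K : ℝ} (hε : 0 ≤ ε) (hK : 0 < K)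
    (htriv : ∀ m ≤ M0, ∀ α Q f A T, 0 ≤ T → T + H ≤ t → St p p' α Q f A (T + H) →
      E m α T ≤ ENNReal.ofReal (Q 0 ^ (m + j)))
    (hrec : ∀ m : ℕ, m ≤ M0 → (M0 : ℝ) - m < K → ∀ α Q f A T, 0 ≤ T → T + H ≤ t →
      St p p' α Q f A (T + H) → E m α T ≤
      (∫⁻ z, ENNReal.ofReal (Q T ^ (m + j) * Real.exp (-(A * Real.exp (-T) * v z 0))) ∂P) +
      ENNReal.ofReal (Q T ^ (m + j) * ε) +
      (m : ℝ≥0∞) * ∫⁻ τ in Set.Iic (ENNReal.ofReal T), ENNReal.ofReal (c (T - τ.toReal)) *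
        E (m - 1) (step ν α τ) (T - τ.toReal) ∂α)
    (hv : ∀ᵐ z ∂P, ∀ s ∈ Set.Icc 0 t, HasDerivAt (v z) (vd z s) s)
    (hce : ∀ᵐ z ∂P, ∀ s ∈ Set.Icc 0 t, c s * Real.exp (-(v z s)) ≤ 1)
    (hode : ∀ᵐ z ∂P, ∀ s ∈ Set.Icc 0 t,
      v z s + vd z s ≤ p * ((M0 - K) * (1 - c s * Real.exp (-(v z s)))))
    (e ed : ℝ → ℝ) (hem : Measurable e)
    (he : ∀ s ∈ Set.Icc 0 t, HasDerivAt e (ed s) s)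
    (he0 : ∀ s ∈ Set.Icc 0 t, 0 ≤ e s)
    (heode : ∀ s ∈ Set.Icc 0 t, p' * M0 * (1 + e s) ≤ e s + ed s) :
    ∀ m ≤ M0, ∀ α Q f A T, 0 ≤ T → T + H ≤ t → St p p' α Q f A (T + H) →
      E m α T ≤ ∫⁻ z, ENNReal.ofReal (Q 0 ^ (m + j) * Real.exp (-(A * v z T))) ∂P +
        ENNReal.ofReal (Q 0 ^ (m + j) * (ε + ((M0 - m : ℝ) + A * e T) / K)) := by
  intro m
  induction m using Nat.strong_induction_on with
  | _ m ih =>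
  intro hm α Q f A T hT hTt h
  have hmM : (m : ℝ) ≤ M0 := by exact_mod_cast hm
  have hA := h.Ann
  rcases le_or_gt K (M0 - m : ℝ) with hKm | hKm
  · refine (htriv m hm α Q f A T hT hTt h).trans (le_trans ?_ le_add_self)
    refine ENNReal.ofReal_le_ofReal ?_
    have h1 : 1 ≤ ((M0 - m : ℝ) + A * e T) / K := by
      rw [one_le_div hK]
      have := he0 T ⟨hT, by linarith⟩
      have := mul_nonneg hA this
      linarith
    have := pow_pos (h.pos 0) (m + j)
    nlinarith
  refine (hrec m hm hKm α Q f A T hT hTt h).trans ?_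
  have hS : St p p' α Q f A T := h.mono (by linarith)
  have hmG : Measurable (fun s => ENNReal.ofReal (c (T - s)) * ENNReal.ofReal (Q s ^ (m - 1 + j) *
        (ε + ((M0 - m + 1 : ℝ) + (A * Real.exp (-s) + 1) * e (T - s)) / K))) := by
    have h2 := h.contQ.measurable
    have h4 : Measurable c := hc.measurable
    fun_prop
  have h1 : (m : ℝ≥0∞) * ∫⁻ τ in Set.Iic (ENNReal.ofReal T), ENNReal.ofReal (c (T - τ.toReal)) *
        E (m - 1) (step ν α τ) (T - τ.toReal) ∂α ≤ 
      (m : ℝ≥0∞) * ∫⁻ τ in Set.Iic (ENNReal.ofReal T), (ENNReal.ofReal (c (T - τ.toReal)) *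
      (∫⁻ z, ENNReal.ofReal (Q τ.toReal ^ (m - 1 + j) *
        Real.exp (-((A * Real.exp (-τ.toReal) + 1) * v z (T - τ.toReal)))) ∂P) + 
        ENNReal.ofReal (c (T - τ.toReal)) * ENNReal.ofReal (Q τ.toReal ^ (m - 1 + j) *
        (ε + ((M0 - m + 1 : ℝ) + (A * Real.exp (-τ.toReal) + 1) * e (T - τ.toReal)) / K))) ∂α := by
    rcases Nat.eq_zero_or_pos m with h0 | h0
    · simp [h0]
    refine mul_le_mul_right (setLIntegral_mono' measurableSet_Iic fun τ hτ => ?_) _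
    obtain ⟨e1, e2, e3⟩ := ofReal_toReal_Iic hτ hT
    rw [← mul_add]
    refine mul_le_mul_right ?_ _
    have hst := h.step hctx hTt e2
    rw [e1] at hst
    have := ih (m - 1) (by omega) (by omega) _ _ _ _ (T - τ.toReal) (by linarith) (by linarith)
      (hst.mono (by linarith))
    rw [Nat.cast_sub h0] at this
    have e5 : (M0 : ℝ) - (m - (1 : ℕ)) = M0 - m + 1 := by push_cast; ring
    rw [e5] at this
    simpa [qf_zero] using this
  have hmG2 := hmG.comp ENNReal.measurable_toReal
  have hh := h.lint hT _ hmG2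
  simp only [Function.comp_def] at hh hmG2
  rw [lintegral_add_right _ hmG2, mul_add, 
    lint_gint hS hT c hc hc0 P v hvm, hh] at h1
  refine le_trans (add_le_add_right h1 _) ?_
  rw [add_add_add_comm]
  refine add_le_add ?_ ?_
  · have hm0 : Measurable (fun z => v z 0) := 
      hvm.comp (measurable_id.prodMk measurable_const)
    rw [← lintegral_add_left (by fun_prop)]
    refine lintegral_mono_ae ?_
    filter_upwards [hv, hce, hode] with z g1 g2 g3
    exact upper_point hctx.p_pos.le hS hT (by linarith) c (v z) (vd z) m j _ (by linarith) hc hc0 g1 g2 g3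
  · refine le_trans (add_le_add_right (le_of_eq ?_) _) 
      (upper_err hS hT (by linarith) c e ed m j M0 hm hε hK hc hc0 hc1 he he0 heode)
    rw [← lintegral_const_mul' _ _ (ENNReal.natCast_ne_top m)]
    refine setLIntegral_congr_fun measurableSet_Ioc fun s hs => ?_
    beta_reduce
    rw [ENNReal.toReal_ofReal hs.1.le]
    rw [ENNReal.ofReal_mul (Nat.cast_nonneg m), ENNReal.ofReal_natCast, ENNReal.ofReal_mul (h.fnn s),
      ENNReal.ofReal_mul (hc0 _)]

/-! ### Part 7: recursion wrappers, explicit bounds -/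

theorem E1_le_of_le {ν α : Measure ℝ≥0∞} {ρ ρ' : ℝ≥0∞ → ℝ≥0∞} {m : ℕ} {T : ℝ≥0∞}
    (h : ∀ s ≤ T, ρ s ≤ ρ' s) : E1 ν ρ m α T ≤ E1 ν ρ' m α T := by
  unfold E1
  refine lintegral_mono fun y => lintegral_mono fun x => ?_
  exact Finset.prod_le_prod' fun u _ => h _ tsub_le_self

theorem E1_smul {ν α : Measure ℝ≥0∞} {ρ : ℝ≥0∞ → ℝ≥0∞} {m : ℕ} {T a : ℝ≥0∞} (ha : a ≠ ⊤) :
    E1 ν (fun s => a * ρ s) m α T = a ^ m * E1 ν ρ m α T := by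
  unfold E1
  have : a ^ m ≠ ⊤ := ENNReal.pow_ne_top ha
  rw [← lintegral_const_mul' _ _ this]
  refine lintegral_congr fun y => ?_
  rw [← lintegral_const_mul' _ _ this]
  refine lintegral_congr fun x => ?_
  rw [Finset.prod_mul_distrib]
  simp

theorem E1_le_triv {ν α : Measure ℝ≥0∞} [IsProbabilityMeasure ν] [IsFiniteMeasure α]
    {ρ : ℝ≥0∞ → ℝ≥0∞} {m : ℕ} {T : ℝ≥0∞}
    (h : ∀ s, ρ s ≤ 1) : E1 ν ρ m α T ≤ α Set.univ ^ m := by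
  unfold E1
  calc _ ≤ ∫⁻ y : Fin m → ℝ≥0∞, ∫⁻ x : Sym2 (Fin m) → ℝ≥0∞, 1 ∂(Measure.pi fun _ => ν)
        ∂(Measure.pi fun _ => α) := by
        refine lintegral_mono fun y => lintegral_mono fun x => ?_
        exact Finset.prod_le_one' fun u _ => h _
    _ = _ := by simp [Measure.pi_univ]

theorem E0_le_triv {ν α : Measure ℝ≥0∞} [IsProbabilityMeasure ν] [IsFiniteMeasure α]
    {m : ℕ} {T T1 : ℝ≥0∞} : E0 ν T1 m α T ≤ α Set.univ ^ (m + 1) := by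
  unfold E0
  calc _ ≤ ∫⁻ y : Fin (m + 1) → ℝ≥0∞, ∫⁻ x : Sym2 (Fin (m + 1)) → ℝ≥0∞, 1 ∂(Measure.pi fun _ => ν)
        ∂(Measure.pi fun _ => α) := by
        refine lintegral_mono fun y => lintegral_mono fun x => ?_
        exact Set.indicator_le_self' (fun _ _ => zero_le) _
    _ = _ := by simp [Measure.pi_univ]

/-- thinning factor -/
def rho (θ s : ℝ) : ℝ := Real.exp (-(θ * (1 - Real.exp (-s))))

/-- thinning factor, extended -/
def rhoE (θ : ℝ) (s : ℝ≥0∞) : ℝ≥0∞ := ENNReal.ofReal (rho θ s.toReal)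

theorem rho_cont (θ : ℝ) : Continuous (rho θ) := by unfold rho; fun_prop

theorem rho_pos (θ s : ℝ) : 0 < rho θ s := Real.exp_pos _

theorem rho_le_one {θ s : ℝ} (hθ : 0 ≤ θ) (hs : 0 ≤ s) : rho θ s ≤ 1 := by
  unfold rho
  rw [Real.exp_le_one_iff]
  have : Real.exp (-s) ≤ 1 := Real.exp_le_one_iff.2 (by linarith)
  nlinarith

theorem rhoE_meas (θ : ℝ) : Measurable (rhoE θ) := by
  have := (rho_cont θ).measurable
  exact ENNReal.measurable_ofReal.comp (this.comp ENNReal.measurable_toReal)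

theorem rhoE_zero (θ : ℝ) : rhoE θ 0 = 1 := by simp [rhoE, rho]

theorem rhoE_le_one {θ : ℝ} (hθ : 0 ≤ θ) (s : ℝ≥0∞) : rhoE θ s ≤ 1 := by
  unfold rhoE
  exact ENNReal.ofReal_le_one.2 (rho_le_one hθ ENNReal.toReal_nonneg)

theorem ofReal_sub_Iic {T : ℝ} {τ : ℝ≥0∞} (hτ : τ ∈ Set.Iic (ENNReal.ofReal T)) (hT : 0 ≤ T) :
    ENNReal.ofReal T - τ = ENNReal.ofReal (T - τ.toReal) := by
  obtain ⟨e1, e2, e3⟩ := ofReal_toReal_Iic hτ hT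
  rw [ENNReal.ofReal_sub _ e2, e1]

theorem E1_recR {ν : Measure ℝ≥0∞} {p p' t : ℝ} (hctx : Ctx ν p p' t) (θ : ℝ) (m : ℕ)
    {α : Measure ℝ≥0∞} {Q f : ℝ → ℝ} {A T H : ℝ} (hT : 0 ≤ T) (h : St p p' α Q f A H) :
    E1 ν (rhoE θ) m α (ENNReal.ofReal T) = ENNReal.ofReal (Q T ^ m) +
      (m : ℝ≥0∞) * ∫⁻ τ in Set.Iic (ENNReal.ofReal T), ENNReal.ofReal (rho θ (T - τ.toReal)) *
        E1 ν (rhoE θ) (m - 1) (step ν α τ) (ENNReal.ofReal (T - τ.toReal)) ∂α := by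
  have := hctx.prob
  have := h.fin
  rcases m with _ | m
  · rw [E1_zero]; simp
  · rw [E1_succ ν _ (rhoE_meas θ) (rhoE_zero θ) m α h.noatom _ ENNReal.ofReal_lt_top,
      h.tail T hT, ENNReal.ofReal_pow (h.pos T).le]
    congr 2
    refine setLIntegral_congr_fun measurableSet_Iic fun τ hτ => ?_
    obtain ⟨e1, e2, e3⟩ := ofReal_toReal_Iic hτ hT
    beta_reduce
    rw [ofReal_sub_Iic hτ hT, Nat.add_sub_cancel, rhoE, ENNReal.toReal_ofReal (by linarith)]

theorem E0_recR {ν : Measure ℝ≥0∞} {p p' t : ℝ} (hctx : Ctx ν p p' t) {T1 : ℝ} (m : ℕ)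
    {α : Measure ℝ≥0∞} {Q f : ℝ → ℝ} {A T H : ℝ} (hT : 0 ≤ T) (h : St p p' α Q f A H) :
    E0 ν (ENNReal.ofReal T1) m α (ENNReal.ofReal T) = 
      α (Set.Ioi (ENNReal.ofReal T + ENNReal.ofReal T1)) * 
        E1 ν (fun s => α (Set.Ioi (ENNReal.ofReal T + s))) m ν (ENNReal.ofReal T1) +
      (m : ℝ≥0∞) * ∫⁻ τ in Set.Iic (ENNReal.ofReal T), ENNReal.ofReal ((fun _ => 1) (T - τ.toReal)) *
        E0 ν (ENNReal.ofReal T1) (m - 1) (step ν α τ) (ENNReal.ofReal (T - τ.toReal)) ∂α := by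
  have := hctx.prob
  have := h.fin
  rw [E0_rec ν _ ENNReal.ofReal_lt_top m α h.noatom _ ENNReal.ofReal_lt_top]
  congr 2
  refine setLIntegral_congr_fun measurableSet_Iic fun τ hτ => ?_
  beta_reduce
  rw [ofReal_sub_Iic hτ hT, ENNReal.ofReal_one, one_mul]

/-- Bounds on the tail of a state. -/
theorem St.tail_lower {p p' : ℝ} {α : Measure ℝ≥0∞} {Q f : ℝ → ℝ} {A T T1 : ℝ} (hT : 0 ≤ T)
    (h : St p p' α Q f A (T + T1)) {s : ℝ} (hs : 0 ≤ s) (hs1 : s ≤ T1) :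
    Q T * rho (p' * (A * Real.exp (-T))) s ≤ Q (T + s) := by
  -- monotonicity of Q(T+s) * exp (θ (1 - exp (-s)))
  set θ := p' * (A * Real.exp (-T)) with hθ
  have hmono : MonotoneOn (fun s => Q (T + s) * Real.exp (θ * (1 - Real.exp (-s)))) (Set.Icc 0 T1) := by
    have hd : ∀ s, HasDerivAt (fun s => Q (T + s) * Real.exp (θ * (1 - Real.exp (-s))))
        (Real.exp (θ * (1 - Real.exp (-s))) * (θ * Real.exp (-s) * Q (T + s) - f (T + s))) s := by
      intro s
      have h1 : HasDerivAt (fun s => Q (T + s)) (-(f (T + s))) s := (h.der (T + s)).comp_const_add T s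
      have h2 : HasDerivAt (fun s : ℝ => Real.exp (-s)) (Real.exp (-s) * (-1)) s :=
        (hasDerivAt_neg s).exp
      have h3 := h1.mul (((h2.const_sub 1).const_mul θ).exp)
      exact h3.congr_deriv (by ring)
    refine monotoneOn_of_deriv_nonneg (convex_Icc 0 T1) 
      (fun s _ => (hd s).continuousAt.continuousWithinAt) 
      (fun s _ => (hd s).differentiableAt.differentiableWithinAt) fun s hs => ?_
    rw [interior_Icc] at hs
    rw [(hd s).deriv]
    have := h.hi (T + s) (by linarith [hs.1]) (by linarith [hs.2])
    rw [neg_add, Real.exp_add] at this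
    refine mul_nonneg (Real.exp_pos _).le ?_
    rw [hθ]
    linarith
  have h1 := hmono ⟨le_rfl, hs.trans hs1⟩ ⟨hs, hs1⟩ hs
  simp only [add_zero, neg_zero, Real.exp_zero, sub_self, mul_zero, mul_one] at h1
  unfold rho
  rw [Real.exp_neg, ← div_eq_mul_inv, div_le_iff₀ (Real.exp_pos _)]
  exact h1

theorem St.tail_upper {p p' : ℝ} {α : Measure ℝ≥0∞} {Q f : ℝ → ℝ} {A T T1 : ℝ} (hT : 0 ≤ T)
    (h : St p p' α Q f A (T + T1)) {s : ℝ} (hs : 0 ≤ s) (hs1 : s ≤ T1) :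
    Q (T + s) ≤ Q T * rho (p * (A * Real.exp (-T))) s := by
  set θ := p * (A * Real.exp (-T)) with hθ
  have hmono : AntitoneOn (fun s => Q (T + s) * Real.exp (θ * (1 - Real.exp (-s)))) (Set.Icc 0 T1) := by
    have hd : ∀ s, HasDerivAt (fun s => Q (T + s) * Real.exp (θ * (1 - Real.exp (-s))))
        (Real.exp (θ * (1 - Real.exp (-s))) * (θ * Real.exp (-s) * Q (T + s) - f (T + s))) s := by
      intro s
      have h1 : HasDerivAt (fun s => Q (T + s)) (-(f (T + s))) s := (h.der (T + s)).comp_const_add T s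
      have h2 : HasDerivAt (fun s : ℝ => Real.exp (-s)) (Real.exp (-s) * (-1)) s :=
        (hasDerivAt_neg s).exp
      have h3 := h1.mul (((h2.const_sub 1).const_mul θ).exp)
      exact h3.congr_deriv (by ring)
    refine antitoneOn_of_deriv_nonpos (convex_Icc 0 T1) 
      (fun s _ => (hd s).continuousAt.continuousWithinAt) 
      (fun s _ => (hd s).differentiableAt.differentiableWithinAt) fun s hs => ?_
    rw [interior_Icc] at hs
    rw [(hd s).deriv]
    have := h.lo (T + s) (by linarith [hs.1]) (by linarith [hs.2])
    rw [neg_add, Real.exp_add] at this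
    refine mul_nonpos_of_nonneg_of_nonpos (Real.exp_pos _).le ?_
    rw [hθ]
    linarith
  have h1 := hmono ⟨le_rfl, hs.trans hs1⟩ ⟨hs, hs1⟩ hs
  simp only [add_zero, neg_zero, Real.exp_zero, sub_self, mul_zero, mul_one] at h1
  unfold rho
  rw [Real.exp_neg, ← div_eq_mul_inv, le_div_iff₀ (Real.exp_pos _)]
  exact h1

theorem Gam_lower {ν : Measure ℝ≥0∞} {p p' : ℝ} {α : Measure ℝ≥0∞} {Q f : ℝ → ℝ} {A T T1 : ℝ}
    (hT : 0 ≤ T) (hT1 : 0 ≤ T1) (h : St p p' α Q f A (T + T1)) (m : ℕ) :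
    ENNReal.ofReal (Q T ^ (m + 1)) * (ENNReal.ofReal (rho (p' * (A * Real.exp (-T))) T1) * 
      E1 ν (rhoE (p' * (A * Real.exp (-T)))) m ν (ENNReal.ofReal T1)) ≤
    α (Set.Ioi (ENNReal.ofReal T + ENNReal.ofReal T1)) * 
        E1 ν (fun s => α (Set.Ioi (ENNReal.ofReal T + s))) m ν (ENNReal.ofReal T1) := by
  have hQ := h.pos T
  have e : ENNReal.ofReal (Q T ^ (m + 1)) * (ENNReal.ofReal (rho (p' * (A * Real.exp (-T))) T1) * 
      E1 ν (rhoE (p' * (A * Real.exp (-T)))) m ν (ENNReal.ofReal T1)) = 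
      ENNReal.ofReal (Q T * rho (p' * (A * Real.exp (-T))) T1) *
        (ENNReal.ofReal (Q T) ^ m * E1 ν (rhoE (p' * (A * Real.exp (-T)))) m ν (ENNReal.ofReal T1)) := by
    rw [ENNReal.ofReal_pow hQ.le, ENNReal.ofReal_mul hQ.le]; ring
  rw [e, ← E1_smul ENNReal.ofReal_ne_top]
  refine mul_le_mul' ?_ (E1_le_of_le ?_)
  · rw [← ENNReal.ofReal_add hT hT1, h.tail _ (by linarith)]
    exact ENNReal.ofReal_le_ofReal (h.tail_lower hT hT1 le_rfl)
  · intro s hs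
    obtain ⟨e1, e2, e3⟩ := ofReal_toReal_Iic hs hT1
    rw [rhoE, ← ENNReal.ofReal_mul hQ.le]
    conv_rhs => rw [← e1]
    rw [← ENNReal.ofReal_add hT e2, h.tail _ (by linarith)]
    exact ENNReal.ofReal_le_ofReal (h.tail_lower hT e2 e3)

theorem Gam_upper {ν : Measure ℝ≥0∞} {p p' : ℝ} {α : Measure ℝ≥0∞} {Q f : ℝ → ℝ} {A T T1 : ℝ}
    (hT : 0 ≤ T) (hT1 : 0 ≤ T1) (h : St p p' α Q f A (T + T1)) (m : ℕ) :
    α (Set.Ioi (ENNReal.ofReal T + ENNReal.ofReal T1)) * 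
        E1 ν (fun s => α (Set.Ioi (ENNReal.ofReal T + s))) m ν (ENNReal.ofReal T1) ≤
    ENNReal.ofReal (Q T ^ (m + 1)) * (ENNReal.ofReal (rho (p * (A * Real.exp (-T))) T1) * 
      E1 ν (rhoE (p * (A * Real.exp (-T)))) m ν (ENNReal.ofReal T1)) := by
  have hQ := h.pos T
  have e : ENNReal.ofReal (Q T ^ (m + 1)) * (ENNReal.ofReal (rho (p * (A * Real.exp (-T))) T1) * 
      E1 ν (rhoE (p * (A * Real.exp (-T)))) m ν (ENNReal.ofReal T1)) = 
      ENNReal.ofReal (Q T * rho (p * (A * Real.exp (-T))) T1) *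
        (ENNReal.ofReal (Q T) ^ m * E1 ν (rhoE (p * (A * Real.exp (-T)))) m ν (ENNReal.ofReal T1)) := by
    rw [ENNReal.ofReal_pow hQ.le, ENNReal.ofReal_mul hQ.le]; ring
  rw [e, ← E1_smul ENNReal.ofReal_ne_top]
  refine mul_le_mul' ?_ (E1_le_of_le ?_)
  · rw [← ENNReal.ofReal_add hT hT1, h.tail _ (by linarith)]
    exact ENNReal.ofReal_le_ofReal (h.tail_upper hT hT1 le_rfl)
  · intro s hs
    obtain ⟨e1, e2, e3⟩ := ofReal_toReal_Iic hs hT1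
    rw [rhoE, ← ENNReal.ofReal_mul hQ.le]
    conv_lhs => rw [← e1]
    rw [← ENNReal.ofReal_add hT e2, h.tail _ (by linarith)]
    exact ENNReal.ofReal_le_ofReal (h.tail_upper hT e2 e3)

/-! exponential law -/

theorem expDist_eq : expDist = (volume.restrict (Set.Ici (0 : ℝ))).withDensity
    (fun x => ENNReal.ofReal (Real.exp (-x))) := by
  unfold expDist
  rw [← withDensity_indicator measurableSet_Ici]
  congr 1

theorem lint_expDist (g : ℝ → ℝ≥0∞) (hg : Measurable g) : ∫⁻ z, g z ∂expDist =
    ∫⁻ z in Set.Ioi 0, ENNReal.ofReal (Real.exp (-z)) * g z := by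
  rw [expDist_eq, lintegral_withDensity_eq_lintegral_mul _ (by fun_prop) hg,
    restrict_Ioi_eq_restrict_Ici]
  rfl

theorem lint_exp_exp {a b : ℝ} (hb : 0 ≤ b) :
    ∫⁻ z, ENNReal.ofReal (Real.exp (-(a + z * b))) ∂expDist = 
      ENNReal.ofReal (Real.exp (-a) / (1 + b)) := by
  rw [lint_expDist _ (by fun_prop)]
  have h1 : ∀ z : ℝ, ENNReal.ofReal (Real.exp (-z)) * ENNReal.ofReal (Real.exp (-(a + z * b))) =
      ENNReal.ofReal (Real.exp (-a) * Real.exp (-(1 + b) * z)) := by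
    intro z
    rw [← ENNReal.ofReal_mul (Real.exp_pos _).le, ← Real.exp_add, ← Real.exp_add]
    congr 2; ring
  simp_rw [h1]
  have hi : IntegrableOn (fun z => Real.exp (-(1 + b) * z)) (Set.Ioi 0) :=
    integrableOn_exp_mul_Ioi (by linarith) 0
  rw [← ofReal_integral_eq_lintegral_ofReal]
  · rw [integral_const_mul, integral_exp_mul_Ioi (by linarith)]
    congr 1
    have : (1 + b) ≠ 0 := by linarith
    field_simp
    simp
  · exact hi.const_mul _
  · exact Eventually.of_forall fun z => by positivity

instance expDist_prob : IsProbabilityMeasure expDist := ⟨by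
  have := lint_exp_exp (a := 0) (b := 0) le_rfl
  simpa using this⟩

theorem expDist_ae : ∀ᵐ z ∂expDist, 0 ≤ z := by
  rw [expDist_eq]
  refine (withDensity_absolutelyContinuous _ _).ae_le ?_
  exact ae_restrict_mem measurableSet_Ici

/-! ### Part 8: explicit bounds -/

theorem mul_log_ge {w : ℝ} (hw : 0 ≤ w) : w ≤ (1 + w) * Real.log (1 + w) := by
  have h := Real.one_sub_inv_le_log_of_pos (x := 1 + w) (by linarith)
  have h2 : (1 + w) * (1 - (1 + w)⁻¹) = w := by
    have : (1 + w) ≠ 0 := by linarith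
    field_simp
    ring
  nlinarith

theorem mul_log_le {w : ℝ} (hw : 0 ≤ w) : (1 + w) * Real.log (1 + w) ≤ w + w ^ 2 := by
  have h := Real.log_le_sub_one_of_pos (x := 1 + w) (by linarith)
  nlinarith

theorem exp_lin_der (B a k s : ℝ) : HasDerivAt (fun s => B * (Real.exp (a * s)) + k)
    (a * (B * Real.exp (a * s))) s := by
  have h1 : HasDerivAt (fun s : ℝ => a * s) a s := by simpa using (hasDerivAt_id s).const_mul a
  have := (h1.exp.const_mul B).add_const k
  exact this.congr_deriv (by ring)

theorem v_der {w : ℝ → ℝ} {θ s wd : ℝ} (hw : HasDerivAt w wd s) (h0 : 0 ≤ w s) :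
    HasDerivAt (fun s => Real.log (1 + w s) - θ * (1 - Real.exp (-s)))
      (wd / (1 + w s) - θ * Real.exp (-s)) s := by
  have h2 : HasDerivAt (fun s : ℝ => Real.exp (-s)) (Real.exp (-s) * (-1)) s :=
    (hasDerivAt_neg s).exp
  have h3 := ((hw.const_add 1).log (by linarith)).sub ((h2.const_sub 1).const_mul θ)
  exact h3.congr_deriv (by ring)

theorem v_exp {w θ s : ℝ} (h0 : 0 ≤ w) :
    rho θ s * Real.exp (-(Real.log (1 + w) - θ * (1 - Real.exp (-s)))) = 1 / (1 + w) := by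
  unfold rho
  rw [← Real.exp_add]
  rw [show -(θ * (1 - Real.exp (-s))) + -(Real.log (1 + w) - θ * (1 - Real.exp (-s))) =
    -Real.log (1 + w) by ring, Real.exp_neg, Real.exp_log (by linarith), one_div]

theorem rho_zero_left (s : ℝ) : rho 0 s = 1 := by simp [rho]

/-- lower ODE inequality -/
theorem ode_lower {p' M j θ w wd s : ℝ} (h0 : 0 ≤ w)
    (hd : (p' * M - 1) * w + (p' * j + θ) * (1 + w) ≤ wd) :
    p' * (M * (1 - rho θ s * Real.exp (-(Real.log (1 + w) - θ * (1 - Real.exp (-s))))) + j) ≤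
    (Real.log (1 + w) - θ * (1 - Real.exp (-s))) + (wd / (1 + w) - θ * Real.exp (-s)) := by
  rw [v_exp h0]
  have h1 : 0 < 1 + w := by linarith
  have e1 : (Real.log (1 + w) - θ * (1 - Real.exp (-s))) + (wd / (1 + w) - θ * Real.exp (-s)) =
    ((1 + w) * Real.log (1 + w) - θ * (1 + w) + wd) / (1 + w) := by
    field_simp; ring
  have e2 : p' * (M * (1 - 1 / (1 + w)) + j) = (p' * M * w + p' * j * (1 + w)) / (1 + w) := by
    field_simp; ring
  rw [e1, e2]
  refine div_le_div_of_nonneg_right ?_ h1.le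
  have := mul_log_ge h0
  nlinarith

/-- upper ODE inequality -/
theorem ode_upper {p M θ w wd s : ℝ} (h0 : 0 ≤ w)
    (hd : wd ≤ (p * M - 1) * w - w ^ 2 + θ * (1 + w)) :
    (Real.log (1 + w) - θ * (1 - Real.exp (-s))) + (wd / (1 + w) - θ * Real.exp (-s)) ≤
    p * (M * (1 - rho θ s * Real.exp (-(Real.log (1 + w) - θ * (1 - Real.exp (-s)))))) := by
  rw [v_exp h0]
  have h1 : 0 < 1 + w := by linarith
  have e1 : (Real.log (1 + w) - θ * (1 - Real.exp (-s))) + (wd / (1 + w) - θ * Real.exp (-s)) =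
    ((1 + w) * Real.log (1 + w) - θ * (1 + w) + wd) / (1 + w) := by
    field_simp; ring
  have e2 : p * (M * (1 - 1 / (1 + w))) = (p * M * w) / (1 + w) := by
    field_simp; ring
  rw [e1, e2]
  refine div_le_div_of_nonneg_right ?_ h1.le
  have := mul_log_le h0
  nlinarith

theorem one_le_exp_mul {a s : ℝ} (ha : 0 ≤ a) (hs : 0 ≤ s) : 1 ≤ Real.exp (a * s) :=
  Real.one_le_exp (mul_nonneg ha hs)

/-- Stage 1, lower bound -/
theorem stage1_lower {ν : Measure ℝ≥0∞} {p p' t : ℝ} (hctx : Ctx ν p p' t) (M : ℕ) {θ : ℝ}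
    (hθ : 0 ≤ θ) (hκ : 1 < p' * M) (m : ℕ) (hm : m ≤ M) {T1 : ℝ} (hT1 : 0 ≤ T1) (hTt : T1 ≤ t) :
    ENNReal.ofReal (Real.exp (-(θ * T1)) / 
        (1 + θ * (Real.exp ((p' * M - 1) * T1) / (p' * M - 1)))) ≤
      ENNReal.ofReal (rho θ T1) * E1 ν (rhoE θ) m ν (ENNReal.ofReal T1) := by
  set b := p' * M - 1 + θ with hb
  have hb0 : 0 < b := by linarith
  set w : ℝ → ℝ := fun s => θ / b * Real.exp (b * s) + -(θ / b) with hw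
  have hw0 : ∀ s, 0 ≤ s → 0 ≤ w s := by
    intro s hs
    have := one_le_exp_mul hb0.le hs
    have h2 : 0 ≤ θ / b := by positivity
    simp only [hw]; nlinarith
  have hwd : ∀ s, HasDerivAt w (b * (θ / b * Real.exp (b * s))) s := exp_lin_der _ _ _
  set v : ℝ → ℝ := fun s => Real.log (1 + w s) - θ * (1 - Real.exp (-s)) with hv
  have hwm : Measurable w := by fun_prop
  have hv0 : v 0 = 0 := by simp [hv, hw]
  have key := lower_abs (t := t) hctx le_rfl 0 M (fun m α T => E1 ν (rhoE θ) m α (ENNReal.ofReal T))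
    (rho θ) (rho_cont θ) (fun s => (rho_pos θ s).le) (Measure.dirac (0 : ℝ)) (fun _ => v)
    (fun _ s => b * (θ / b * Real.exp (b * s)) / (1 + w s) - θ * Real.exp (-s)) (by fun_prop)
    ?_ ?_ ?_ ?_ m hm ν _ _ 1 T1 hT1 (by simpa using hTt) (hctx.st (by simpa using hTt))
  · simp only [lintegral_const, measure_univ, mul_one, qf_zero, one_pow, one_mul] at key
    refine le_trans ?_ (mul_le_mul_right key _)
    rw [← ENNReal.ofReal_mul (rho_pos θ T1).le]
    refine ENNReal.ofReal_le_ofReal ?_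
    rw [v_exp (hw0 T1 hT1)]
    rw [div_le_div_iff₀ _ (by linarith [hw0 T1 hT1])]
    · rw [one_mul]
      have h1 : w T1 ≤ θ * (Real.exp ((p' * M - 1) * T1) / (p' * M - 1)) * Real.exp (θ * T1) := by
        calc w T1 ≤ θ / b * Real.exp (b * T1) := by
              simp only [hw]
              have h2 : 0 ≤ θ / b := by positivity
              linarith
          _ = θ / b * (Real.exp ((p' * M - 1) * T1) * Real.exp (θ * T1)) := by
              rw [← Real.exp_add, hb]; congr 2; ring
          _ ≤ θ / (p' * M - 1) * (Real.exp ((p' * M - 1) * T1) * Real.exp (θ * T1)) := by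
              gcongr
              linarith
          _ = _ := by ring
      have h2 := one_le_exp_mul hθ hT1
      rw [Real.exp_neg, inv_mul_le_iff₀ (Real.exp_pos _)]
      linarith
    · have : 0 < p' * M - 1 := by linarith
      positivity
  · intro m hm α Q f A T hT hTt' h
    simp only [lintegral_const, measure_univ, mul_one, hv0, mul_zero, neg_zero, Real.exp_zero, add_zero]
    rw [E1_recR hctx θ m hT h]
  · exact Eventually.of_forall fun z s hs => v_der (hwd s) (hw0 s hs.1)
  · refine Eventually.of_forall fun z s hs => ?_
    rw [v_exp (hw0 s hs.1), div_le_one (by linarith [hw0 s hs.1])]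
    linarith [hw0 s hs.1]
  · refine Eventually.of_forall fun z s hs => ?_
    refine ode_lower (hw0 s hs.1) (le_of_eq ?_)
    simp only [hw]
    field_simp
    rw [hb]
    push_cast
    ring

/-- the function in the final lower bound -/
def wlow (p' κ T0 T1 z : ℝ) : ℝ :=
  (Real.exp (p' * (T1 + z * (Real.exp ((κ - 1) * T1) / (κ - 1)))) - 1 + p' / (κ - 1 + p')) * 
    Real.exp ((κ - 1 + p') * T0) + -(p' / (κ - 1 + p'))

theorem stage0_lower {ν : Measure ℝ≥0∞} {p p' : ℝ} (n : ℕ) {T0 T1 : ℝ} 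
    (hctx : Ctx ν p p' (T0 + T1)) (hp' : 0 < p') (hκ : 1 < p' * n) (hT0 : 0 ≤ T0) (hT1 : 0 ≤ T1) :
    ∫⁻ z, ENNReal.ofReal (1 / (1 + wlow p' (p' * n) T0 T1 z)) ∂expDist ≤ 
      E0 ν (ENNReal.ofReal T1) n ν (ENNReal.ofReal T0) := by
  set κ := p' * n with hκd
  set b := κ - 1 + p' with hb
  have hκ1 : 0 < κ - 1 := by linarith
  have hb0 : 0 < b := by linarith
  set c := Real.exp ((κ - 1) * T1) / (κ - 1) with hc
  have hc0 : 0 < c := by positivity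
  have hw0 : ∀ z s, 0 ≤ z → 0 ≤ s → 0 ≤ wlow p' κ s T1 z := by
    intro z s hz hs
    have h1 := one_le_exp_mul hb0.le hs
    have h2 : 1 ≤ Real.exp (p' * (T1 + z * c)) := Real.one_le_exp (by positivity)
    have h3 : 0 < p' / b := by positivity
    unfold wlow
    nlinarith
  have hwd : ∀ z s, HasDerivAt (fun s => wlow p' κ s T1 z) (b * ((Real.exp (p' * (T1 + z * c)) - 1 + 
    p' / b) * Real.exp (b * s))) s := fun z s => exp_lin_der _ _ _ _
  set v : ℝ → ℝ → ℝ := fun z s => Real.log (1 + wlow p' κ s T1 z) - 0 * (1 - Real.exp (-s)) with hv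
  have hv0 : ∀ z, v z 0 = p' * (T1 + z * c) := by
    intro z
    simp only [hv, wlow]
    rw [mul_zero, Real.exp_zero, mul_one, zero_mul, sub_zero]
    rw [show 1 + (Real.exp (p' * (T1 + z * (Real.exp ((κ - 1) * T1) / (κ - 1)))) - 1 + 
      p' / (κ - 1 + p') + -(p' / (κ - 1 + p'))) = Real.exp (p' * (T1 + z * c)) by rw [hc]; ring,
      Real.log_exp]
  have hvm : Measurable (fun x : ℝ × ℝ => v x.1 x.2) := by
    simp only [hv]
    unfold wlow
    fun_prop
  have key := lower_abs (t := T0 + T1) hctx hT1 1 n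
    (fun m α T => E0 ν (ENNReal.ofReal T1) m α (ENNReal.ofReal T))
    (rho 0) (rho_cont 0) (fun s => (rho_pos 0 s).le) expDist v
    (fun z s => b * ((Real.exp (p' * (T1 + z * c)) - 1 + 
      p' / b) * Real.exp (b * s)) / (1 + wlow p' κ s T1 z) - 0 * Real.exp (-s)) hvm
    ?_ ?_ ?_ ?_ n le_rfl ν _ _ 1 T0 hT0 le_rfl (hctx.st le_rfl)
  · refine le_trans (le_of_eq ?_) key
    refine lintegral_congr_ae ?_
    filter_upwards [expDist_ae] with z hz
    simp only [qf_zero, one_pow, one_mul, hv, zero_mul, sub_zero]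
    rw [Real.exp_neg, Real.exp_log (by linarith [hw0 z T0 hz hT0]), one_div]
  · intro m hm α Q f A T hT hTt h
    have hθ : 0 ≤ p' * (A * Real.exp (-T)) := by have := h.Ann; positivity
    rw [E0_recR hctx m hT h]
    refine add_le_add ?_ (le_of_eq ?_)
    · refine le_trans ?_ (Gam_lower hT hT1 h m)
      refine le_trans (le_of_eq ?_) (mul_le_mul_right (stage1_lower hctx n hθ hκ m hm hT1 (by linarith)) _)
      rw [← hκd, ← hc, ← lint_exp_exp (mul_nonneg hθ hc0.le), ← lintegral_const_mul' _ _ ENNReal.ofReal_ne_top]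
      refine lintegral_congr fun z => ?_
      rw [← ENNReal.ofReal_mul (pow_pos (h.pos T) _).le, hv0]
      congr 3
      ring
    · simp only [rho_zero_left]
  · filter_upwards [expDist_ae] with z hz s hs
    exact v_der (hwd z s) (hw0 z s hz hs.1)
  · filter_upwards [expDist_ae] with z hz s hs
    have := hw0 z s hz hs.1
    simp only [hv]
    rw [v_exp this, div_le_one (by linarith)]
    linarith
  · filter_upwards [expDist_ae] with z hz s hs
    refine ode_lower (hw0 z s hz hs.1) (le_of_eq ?_)
    rw [← hκd]
    unfold wlow
    rw [← hb, ← hc]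
    field_simp
    rw [hb]
    push_cast
    ring

/-- saturated growth -/
def sat (a x : ℝ) : ℝ := x / (1 + x / a)

theorem sat_nonneg {a x : ℝ} (ha : 0 < a) (hx : 0 ≤ x) : 0 ≤ sat a x := by
  unfold sat; positivity

theorem sat_le {a x : ℝ} (ha : 0 < a) (hx : 0 ≤ x) : sat a x ≤ x := by
  unfold sat
  refine div_le_self hx ?_
  have : 0 ≤ x / a := by positivity
  linarith

theorem sat_der {a s xd : ℝ} {x : ℝ → ℝ} (ha : 0 < a) (hx : HasDerivAt x xd s) (h0 : 0 ≤ x s) :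
    HasDerivAt (fun s => sat a (x s)) (xd / (1 + x s / a) ^ 2) s := by
  have h1 : 0 < 1 + x s / a := by positivity
  have := hx.div ((hx.div_const a).const_add 1) h1.ne'
  exact this.congr_deriv (by field_simp; ring)

theorem sat_ode {a x θ : ℝ} (ha : 0 < a) (hx : 0 ≤ x) (hθ : 0 ≤ θ) :
    (a * x + θ) / (1 + x / a) ^ 2 ≤ a * sat a x - sat a x ^ 2 + θ * (1 + sat a x) := by
  have h1 : 0 < 1 + x / a := by positivity
  have h2 : 1 ≤ 1 + x / a := by have : 0 ≤ x / a := by positivity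
                                linarith
  have e : a * x / (1 + x / a) ^ 2 = a * sat a x - sat a x ^ 2 := by
    unfold sat
    field_simp
    ring
  rw [add_div, e]
  have h3 : θ / (1 + x / a) ^ 2 ≤ θ := div_le_self hθ (one_le_pow₀ h2)
  have h4 := sat_nonneg ha hx
  nlinarith

theorem sat_inv {a x : ℝ} (ha : 0 < a) (hx : 0 ≤ x) : 1 / (1 + sat a x) ≤ 1 / (1 + x) + 1 / a := by
  have h1 : 0 < 1 + x / a := by positivity
  have e : 1 / (1 + sat a x) = (1 + x / a) / (1 + x / a + x) := by
    unfold sat; field_simp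
  rw [e]
  calc (1 + x / a) / (1 + x / a + x) ≤ (1 + x / a) / (1 + x) := by
        gcongr
        have : 0 ≤ x / a := by positivity
        linarith
    _ = 1 / (1 + x) + (1 / a) * (x / (1 + x)) := by field_simp
    _ ≤ 1 / (1 + x) + (1 / a) * 1 := by
        gcongr
        rw [div_le_one (by linarith)]
        linarith
    _ = _ := by ring

/-- error growth -/
def eg (κ s : ℝ) : ℝ := κ / (κ - 1) * Real.exp ((κ - 1) * s) + -(κ / (κ - 1))

theorem eg_nonneg {κ s : ℝ} (hκ : 1 < κ) (hs : 0 ≤ s) : 0 ≤ eg κ s := by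
  unfold eg
  have := one_le_exp_mul (a := κ - 1) (by linarith) hs
  have h2 : 0 < κ / (κ - 1) := div_pos (by linarith) (by linarith)
  nlinarith

theorem eg_meas (κ : ℝ) : Measurable (eg κ) := by unfold eg; fun_prop

theorem eg_ode {κ s : ℝ} (hκ : 1 < κ) : κ * (1 + eg κ s) = eg κ s + 
    (κ - 1) * (κ / (κ - 1) * Real.exp ((κ - 1) * s)) := by
  unfold eg
  have : κ - 1 ≠ 0 := by linarith
  field_simp
  ring

/-- Stage 1, upper bound -/
theorem stage1_upper {ν : Measure ℝ≥0∞} {p p' t : ℝ} (hctx : Ctx ν p p' t) (m : ℕ) {θ a K κ : ℝ}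
    (hθ : 0 ≤ θ) (hK : 0 < K) (hκ : 1 < κ) (hκm : p' * m ≤ κ) (ha : 0 < a) 
    (ham : a + 1 ≤ p * (m - K)) {T1 : ℝ} (hT1 : 0 ≤ T1) (hTt : T1 ≤ t) :
      ENNReal.ofReal (rho θ T1) * E1 ν (rhoE θ) m ν (ENNReal.ofReal T1) ≤ 
    ENNReal.ofReal (1 / (1 + θ * ((Real.exp (a * T1) - 1) / a))) + 
      ENNReal.ofReal (1 / a + eg κ T1 / K) := by
  have := hctx.prob
  set x : ℝ → ℝ := fun s => θ / a * Real.exp (a * s) + -(θ / a) with hx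
  have hx0 : ∀ s, 0 ≤ s → 0 ≤ x s := by
    intro s hs
    have := one_le_exp_mul ha.le hs
    have h2 : 0 ≤ θ / a := by positivity
    simp only [hx]; nlinarith
  set w : ℝ → ℝ := fun s => sat a (x s) with hw
  have hw0 : ∀ s, 0 ≤ s → 0 ≤ w s := fun s hs => sat_nonneg ha (hx0 s hs)
  have hwd : ∀ s, 0 ≤ s → HasDerivAt w (a * (θ / a * Real.exp (a * s)) / (1 + x s / a) ^ 2) s := 
    fun s hs => sat_der ha (exp_lin_der _ _ _ s) (hx0 s hs)
  set v : ℝ → ℝ := fun s => Real.log (1 + w s) - θ * (1 - Real.exp (-s)) with hv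
  have hwm : Measurable w := by
    simp only [hw, hx]
    unfold sat
    fun_prop
  have hv0 : v 0 = 0 := by simp [hv, hw, hx, sat]
  have key := upper_abs (t := t) hctx le_rfl 0 m (fun m α T => E1 ν (rhoE θ) m α (ENNReal.ofReal T))
    (rho θ) (rho_cont θ) (fun s => (rho_pos θ s).le) (fun s hs => rho_le_one hθ hs.1)
    (Measure.dirac (0 : ℝ)) (fun _ => v)
    (fun _ s => (a * (θ / a * Real.exp (a * s)) / (1 + x s / a) ^ 2) / (1 + w s) - θ * Real.exp (-s)) 
    (by fun_prop) (ε := 0) le_rfl hK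
    ?_ ?_ ?_ ?_ ?_ (eg κ) _ (eg_meas κ) (fun s _ => exp_lin_der _ _ _ s) 
      (fun s hs => eg_nonneg hκ hs.1) ?_
    m le_rfl ν _ _ 1 T1 hT1 (by simpa using hTt) (hctx.st (by simpa using hTt))
  · simp only [lintegral_const, measure_univ, mul_one, qf_zero, one_pow, one_mul, sub_self, 
      zero_add] at key
    refine (mul_le_mul_right key _).trans ?_
    have hegT := eg_nonneg hκ hT1
    rw [mul_add, ← ENNReal.ofReal_mul (rho_pos θ T1).le, v_exp (hw0 T1 hT1),
      ← ENNReal.ofReal_mul (rho_pos θ T1).le, ← ENNReal.ofReal_add, ← ENNReal.ofReal_add]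
    · refine ENNReal.ofReal_le_ofReal ?_
      have h1 := sat_inv ha (hx0 T1 hT1)
      have h2 : x T1 = θ * ((Real.exp (a * T1) - 1) / a) := by simp only [hx]; ring
      rw [h2] at h1
      have h3 : rho θ T1 * (eg κ T1 / K) ≤ 1 * (eg κ T1 / K) := by
        have := rho_le_one hθ hT1
        gcongr
      have e4 : w T1 = sat a (θ * ((Real.exp (a * T1) - 1) / a)) := by simp only [hw, h2]
      rw [e4]
      linarith
    · have := hx0 T1 hT1
      have h2 : x T1 = θ * ((Real.exp (a * T1) - 1) / a) := by simp only [hx]; ring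
      rw [← h2]
      positivity
    · positivity
    · have := hw0 T1 hT1
      positivity
    · have := rho_pos θ T1
      positivity
  · intro m hm α Q f A T hT hTt' h
    have := h.fin
    refine (E1_le_triv (rhoE_le_one hθ)).trans (le_of_eq ?_)
    rw [h.univ, add_zero, ENNReal.ofReal_pow (h.pos 0).le]
  · intro m hm _ α Q f A T hT hTt' h
    simp only [lintegral_const, measure_univ, mul_one, hv0, mul_zero, neg_zero, Real.exp_zero, add_zero,
      ENNReal.ofReal_zero]
    rw [E1_recR hctx θ m hT h]
  · exact Eventually.of_forall fun z s hs => v_der (hwd s hs.1) (hw0 s hs.1)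
  · refine Eventually.of_forall fun z s hs => ?_
    rw [v_exp (hw0 s hs.1), div_le_one (by linarith [hw0 s hs.1])]
    linarith [hw0 s hs.1]
  · refine Eventually.of_forall fun z s hs => ?_
    refine ode_upper (hw0 s hs.1) ?_
    have h1 : a * (θ / a * Real.exp (a * s)) = a * x s + θ := by simp only [hx]; field_simp; ring
    rw [h1]
    refine (sat_ode ha (hx0 s hs.1) hθ).trans ?_
    have := hw0 s hs.1
    have : a * w s ≤ (p * (m - K) - 1) * w s := by gcongr; linarith
    simp only [hw] at this ⊢
    linarith
  · intro s hs
    rw [← eg_ode hκ]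
    have := eg_nonneg hκ hs.1
    gcongr

theorem stage0_upper {ν : Measure ℝ≥0∞} {p p' : ℝ} (n : ℕ) {T0 T1 a K : ℝ} 
    (hctx : Ctx ν p p' (T0 + T1)) (hp' : 0 < p') (hκ : 1 < p' * n) (hT0 : 0 ≤ T0) (hT1 : 0 ≤ T1)
    (hK : 0 < K) (ha : 0 < a) (ham : a + 1 ≤ p * (n - 2 * K)) :
    E0 ν (ENNReal.ofReal T1) n ν (ENNReal.ofReal T0) ≤ 
    ∫⁻ z, ENNReal.ofReal (1 / (1 + z * ((Real.exp (a * T1) - 1) / a * p * Real.exp (a * T0)))) ∂expDist +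
      ENNReal.ofReal (2 / a + eg (p' * n) T1 / K + eg (p' * n) T0 / K) := by
  have := hctx.prob
  have hp := hctx.p_pos
  set κ := p' * n with hκd
  set c := (Real.exp (a * T1) - 1) / a with hc
  have hc0 : 0 ≤ c := by
    have := one_le_exp_mul ha.le hT1
    exact div_nonneg (by linarith) ha.le
  set x : ℝ → ℝ → ℝ := fun z s => (z * c * p) * Real.exp (a * s) + 0 with hx
  have hx0 : ∀ z s, 0 ≤ z → 0 ≤ x z s := by
    intro z s hs
    simp only [hx]; positivity
  set w : ℝ → ℝ → ℝ := fun z s => sat a (x z s) with hw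
  have hw0 : ∀ z s, 0 ≤ z → 0 ≤ w z s := fun z s hs => sat_nonneg ha (hx0 z s hs)
  have hwd : ∀ z s, 0 ≤ z → HasDerivAt (w z) (a * ((z * c * p) * Real.exp (a * s)) / (1 + x z s / a) ^ 2) s := 
    fun z s hs => sat_der ha (exp_lin_der _ _ _ s) (hx0 z s hs)
  set v : ℝ → ℝ → ℝ := fun z s => Real.log (1 + w z s) - 0 * (1 - Real.exp (-s)) with hv
  have hv0 : ∀ z, 0 ≤ z → v z 0 ≤ z * c * p := by
    intro z hz
    simp only [hv, zero_mul, sub_zero]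
    have h1 := Real.log_le_sub_one_of_pos (x := 1 + w z 0) (by linarith [hw0 z 0 hz])
    have h2 : w z 0 ≤ x z 0 := sat_le ha (hx0 z 0 hz)
    have h3 : x z 0 = z * c * p := by simp [hx]
    linarith
  have hvm : Measurable (fun x : ℝ × ℝ => v x.1 x.2) := by
    simp only [hv, hw, hx]
    unfold sat
    fun_prop
  have heg1 := eg_nonneg hκ hT1
  have heg0 := eg_nonneg hκ hT0
  have hε : 0 ≤ 1 / a + eg κ T1 / K := by positivity
  have key := upper_abs (t := T0 + T1) hctx hT1 1 n
    (fun m α T => E0 ν (ENNReal.ofReal T1) m α (ENNReal.ofReal T))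
    (rho 0) (rho_cont 0) (fun s => (rho_pos 0 s).le) (fun s hs => rho_le_one le_rfl hs.1) expDist v
    (fun z s => (a * ((z * c * p) * Real.exp (a * s)) / (1 + x z s / a) ^ 2) / (1 + w z s)
      - 0 * Real.exp (-s)) hvm hε hK
    ?_ ?_ ?_ ?_ ?_ (eg κ) _ (eg_meas κ) (fun s _ => exp_lin_der _ _ _ s) 
      (fun s hs => eg_nonneg hκ hs.1) ?_ n le_rfl ν _ _ 1 T0 hT0 le_rfl (hctx.st le_rfl)
  · refine key.trans ?_
    simp only [qf_zero, one_pow, one_mul, sub_self, zero_add]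
    have h1 : ∫⁻ z, ENNReal.ofReal (Real.exp (-(v z T0))) ∂expDist ≤ 
        ∫⁻ z, ENNReal.ofReal (1 / (1 + z * (c * p * Real.exp (a * T0)))) ∂expDist + 
          ENNReal.ofReal (1 / a) := by
      have e : ENNReal.ofReal (1 / a) = ∫⁻ z, ENNReal.ofReal (1 / a) ∂expDist := by simp
      rw [e, ← lintegral_add_right _ measurable_const]
      refine lintegral_mono_ae ?_
      filter_upwards [expDist_ae] with z hz
      have hx1 := hx0 z T0 hz
      have e2 : x z T0 = z * (c * p * Real.exp (a * T0)) := by simp only [hx]; ring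
      rw [← e2, ← ENNReal.ofReal_add (by positivity) (by positivity)]
      refine ENNReal.ofReal_le_ofReal ?_
      refine le_trans (le_of_eq ?_) (sat_inv ha hx1)
      simp only [hv, zero_mul, sub_zero]
      rw [Real.exp_neg, Real.exp_log (by linarith [hw0 z T0 hz]), one_div]
    refine (add_le_add_left h1 _).trans ?_
    rw [add_assoc, ← ENNReal.ofReal_add (by positivity) (by positivity)]
    refine add_le_add_right (ENNReal.ofReal_le_ofReal (le_of_eq ?_)) _
    ring
  · intro m hm α Q f A T hT hTt' h
    have := h.fin
    refine E0_le_triv.trans (le_of_eq ?_)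
    rw [h.univ, ENNReal.ofReal_pow (h.pos 0).le]
  · intro m hm hmK α Q f A T hT hTt h
    have hA := h.Ann
    have hQ := pow_pos (h.pos T) (m + 1)
    have hθ : 0 ≤ p * (A * Real.exp (-T)) := by positivity
    have hmn : (m : ℝ) ≤ n := by exact_mod_cast hm
    rw [E0_recR hctx m hT h]
    refine add_le_add ?_ (le_of_eq ?_)
    · refine (Gam_upper hT hT1 h m).trans ?_
      refine (mul_le_mul_right (stage1_upper hctx m hθ hK hκ (by rw [hκd]; gcongr) ha 
        (ham.trans ?_) hT1 (by linarith)) _).trans ?_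
      · exact mul_le_mul_of_nonneg_left (by linarith) hp.le
      rw [mul_add, ← ENNReal.ofReal_mul hQ.le (q := 1 / a + _)]
      refine add_le_add_left ?_ _
      have h1 := lint_exp_exp (a := 0) (mul_nonneg hθ hc0)
      rw [neg_zero, Real.exp_zero] at h1
      rw [← hc, ← h1, ← lintegral_const_mul' _ _ ENNReal.ofReal_ne_top]
      refine lintegral_mono_ae ?_
      filter_upwards [expDist_ae] with z hz
      rw [← ENNReal.ofReal_mul hQ.le]
      refine ENNReal.ofReal_le_ofReal ?_
      gcongr
      rw [zero_add]
      calc A * Real.exp (-T) * v z 0 ≤ A * Real.exp (-T) * (z * c * p) := by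
            gcongr
            exact hv0 z hz
        _ = _ := by ring
    · simp only [rho_zero_left]
  · filter_upwards [expDist_ae] with z hz s hs
    exact v_der (hwd z s hz) (hw0 z s hz)
  · filter_upwards [expDist_ae] with z hz s hs
    have := hw0 z s hz
    simp only [hv]
    rw [v_exp this, div_le_one (by linarith)]
    linarith
  · filter_upwards [expDist_ae] with z hz s hs
    refine ode_upper (hw0 z s hz) ?_
    have h1 : a * (z * c * p * Real.exp (a * s)) = a * x z s + 0 := by simp only [hx]; ring
    rw [h1]
    refine (sat_ode ha (hx0 z s hz) le_rfl).trans ?_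
    have := hw0 z s hz
    have h7 : p * (n - 2 * K) ≤ p * (n - K) := by gcongr; linarith
    have : a * w z s ≤ (p * (n - K) - 1) * w z s := by gcongr; linarith
    simp only [hw] at this ⊢
    linarith
  · intro s hs
    rw [← eg_ode hκ]

/-! ### Part 9: link with the model -/

/-- law of an edge weight -/
def nu (p : ℝ) : Measure ℝ≥0∞ := ((bernoulliDist p).prod expDist).map wt

theorem bern_prob {p : ℝ} (h0 : 0 ≤ p) (h1 : p ≤ 1) : IsProbabilityMeasure (bernoulliDist p) := ⟨by
  unfold bernoulliDist
  simp only [Measure.add_apply, Measure.smul_apply, measure_univ, smul_eq_mul, mul_one]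
  rw [← ENNReal.ofReal_add h0 (by linarith)]
  simp⟩

theorem bern_true (p : ℝ) : bernoulliDist p {true} = ENNReal.ofReal p := by
  simp [bernoulliDist]

theorem bern_false (p : ℝ) : bernoulliDist p {false} = ENNReal.ofReal (1 - p) := by
  simp [bernoulliDist]

theorem expDist_Ioi {s : ℝ} (hs : 0 ≤ s) : expDist (Set.Ioi s) = ENNReal.ofReal (Real.exp (-s)) := by
  rw [expDist_eq, withDensity_apply _ measurableSet_Ioi, Measure.restrict_restrict measurableSet_Ioi]
  have : Set.Ioi s ∩ Set.Ici 0 = Set.Ioi s := by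
    ext x; simp only [Set.mem_inter_iff, Set.mem_Ioi, Set.mem_Ici]
    exact ⟨fun h => h.1, fun h => ⟨h, by linarith⟩⟩
  rw [this]
  have hi : IntegrableOn (fun z => Real.exp (-z)) (Set.Ioi s) := integrableOn_exp_neg_Ioi s
  rw [← ofReal_integral_eq_lintegral_ofReal hi (Eventually.of_forall fun z => (Real.exp_pos _).le),
    integral_exp_neg_Ioi]

theorem nu_ctx {p t : ℝ} (hp : 0 < p) (hp1 : p ≤ 1) (hpt : p * t < 1) :
    Ctx (nu p) p (p / (1 - p * t)) t where
  prob := by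
    have := bern_prob hp.le hp1
    exact Measure.isProbabilityMeasure_map measurable_wt.aemeasurable
  p_pos := hp
  p_le := hp1
  tail := by
    intro s hs
    have := bern_prob hp.le hp1
    unfold nu
    rw [Measure.map_apply measurable_wt measurableSet_Ioi]
    have e : wt ⁻¹' (Set.Ioi (ENNReal.ofReal s)) = ({true} ×ˢ Set.Ioi s) ∪ ({false} ×ˢ Set.univ) := by
      ext ⟨b, z⟩
      rcases b with _ | _
      · simp [wt]
      · simp only [wt, Set.mem_preimage, if_true, Set.mem_Ioi, ENNReal.ofReal_lt_ofReal_iff_of_nonneg hs]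
        simp
    rw [e, measure_union _ ((measurableSet_singleton _).prod MeasurableSet.univ), Measure.prod_prod,
      Measure.prod_prod, bern_true, bern_false, expDist_Ioi hs, measure_univ, mul_one,
      ← ENNReal.ofReal_mul hp.le, ← ENNReal.ofReal_add (by positivity) (by linarith)]
    · congr 1; unfold qf; ring
    · rw [Set.disjoint_left]
      rintro ⟨b, z⟩ h1 h2
      simp only [Set.mem_prod, Set.mem_singleton_iff] at h1 h2
      rw [h1.1] at h2
      exact Bool.noConfusion h2.1
  zero := by
    have := bern_prob hp.le hp1
    unfold nu
    rw [Measure.map_apply measurable_wt (measurableSet_singleton 0)]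
    refine measure_mono_null (t := Set.univ ×ˢ Set.Iic 0) ?_ ?_
    · rintro ⟨b, z⟩ h
      rcases b with _ | _
      · simp [wt] at h
      · simp only [wt, Set.mem_preimage, if_true, Set.mem_singleton_iff, ENNReal.ofReal_eq_zero] at h
        exact ⟨trivial, h⟩
    · rw [Measure.prod_prod]
      have h1 : expDist (Set.Iic 0) = 0 := by
        rw [← Set.compl_Ioi, prob_compl_eq_zero_iff measurableSet_Ioi, expDist_Ioi le_rfl]
        simp
      rw [h1, mul_zero]
  hp' := by
    intro s hs hst
    have h1 : 1 - s ≤ Real.exp (-s) := by have := Real.add_one_le_exp (-s); linarith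
    have h2 : 1 - p * t ≤ qf p s := by
      unfold qf
      nlinarith
    rw [div_mul_eq_mul_div, le_div_iff₀ (by linarith)]
    nlinarith

theorem prob_eq {n : ℕ} {p T0 T1 : ℝ} (hp : 0 ≤ p) (hp1 : p ≤ 1) (hT0 : 0 ≤ T0) (hT1 : 0 ≤ T1)
    {Ω : Type} [MeasurableSpace Ω] (μ : Measure Ω) [IsProbabilityMeasure μ]
    (Z : Sym2 (Fin (n + 2)) → Ω → Bool × ℝ) (hZ : ∀ e, Measurable (Z e)) (hind : iIndepFun Z μ)
    (hlaw : ∀ e, μ.map (Z e) = (bernoulliDist p).prod expDist) :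
    μ {ω | ENNReal.ofReal (T0 + T1) < minWeight (effWeight (fun e => Z e ω)) 0 1} = 
      E0 (nu p) (ENNReal.ofReal T1) n (nu p) (ENNReal.ofReal T0) := by
  have := bern_prob hp hp1
  have hnu : IsProbabilityMeasure (nu p) := 
    Measure.isProbabilityMeasure_map measurable_wt.aemeasurable
  have h1 : iIndepFun (fun e ω => wt (Z e ω)) μ := hind.comp (fun _ => wt) (fun _ => measurable_wt)
  have hm : ∀ e, Measurable (fun ω => wt (Z e ω)) := fun e => measurable_wt.comp (hZ e)
  have h2 : μ.map (fun ω e => wt (Z e ω)) = Measure.pi fun _ => nu p := by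
    rw [(iIndepFun_iff_map_fun_eq_pi_map (fun e => (hm e).aemeasurable)).1 h1]
    congr 1
    funext e
    unfold nu
    rw [← hlaw e, Measure.map_map measurable_wt (hZ e)]
    rfl
  have hms : MeasurableSet {z : (Fin (n + 1) → ℝ≥0∞) × (Sym2 (Fin (n + 1)) → ℝ≥0∞) |
      ENNReal.ofReal (T0 + T1) < sdist z.1 z.2 0} :=
    measurableSet_lt measurable_const (measurable_sdist 0)
  have h3 : {ω | ENNReal.ofReal (T0 + T1) < minWeight (effWeight (fun e => Z e ω)) 0 1} = 
      (fun ω e => wt (Z e ω)) ⁻¹' ((fun x => (xrow 0 x, xrest 0 x)) ⁻¹' 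
        {z : (Fin (n + 1) → ℝ≥0∞) × (Sym2 (Fin (n + 1)) → ℝ≥0∞) |
          ENNReal.ofReal (T0 + T1) < sdist z.1 z.2 0}) := by
    ext ω
    simp only [Set.mem_preimage, Set.mem_ofPred_eq]
    rw [minWeight_eq (fun e => Z e ω)]
  have hxx : Measurable (fun x : Sym2 (Fin (n + 1 + 1)) → ℝ≥0∞ => (xrow 0 x, xrest 0 x)) :=
    (measurable_xrow 0).prodMk (measurable_xrest 0)
  rw [h3, ← Measure.map_apply (measurable_pi_lambda _ hm) (hxx hms), h2, 
    ← Measure.map_apply hxx hms, rowsplit, ← lintegral_indicator_one hms, 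
    lintegral_prod _ (measurable_one.indicator hms).aemeasurable]
  unfold E0
  refine lintegral_congr fun y => lintegral_congr fun x => ?_
  rw [← ENNReal.ofReal_add hT0 hT1]
  rfl

theorem measurable_minWeight {n : ℕ} {Ω : Type} [MeasurableSpace Ω] 
    (Z : Sym2 (Fin (n + 2)) → Ω → Bool × ℝ) (hZ : ∀ e, Measurable (Z e)) :
    Measurable (fun ω => minWeight (effWeight (fun e => Z e ω)) 0 1) := by
  have hm : ∀ e, Measurable (fun ω => wt (Z e ω)) := fun e => measurable_wt.comp (hZ e)
  have hxx : Measurable (fun x : Sym2 (Fin (n + 1 + 1)) → ℝ≥0∞ => (xrow 0 x, xrest 0 x)) :=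
    (measurable_xrow 0).prodMk (measurable_xrest 0)
  have h1 : Measurable (fun z : (Fin (n + 1) → ℝ≥0∞) × (Sym2 (Fin (n + 1)) → ℝ≥0∞) => 
    sdist z.1 z.2 0) := measurable_sdist 0
  have := (h1.comp hxx).comp (measurable_pi_lambda _ hm)
  have e : (fun ω => minWeight (effWeight (fun e => Z e ω)) 0 1) = fun ω => 
    sdist (xrow 0 (fun e => wt (Z e ω))) (xrest 0 (fun e => wt (Z e ω))) 0 := by
    funext ω; exact minWeight_eq _
  rw [e]
  exact this

/-! ### Part 10: limits -/

/-- log of the size -/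
def ellS (n : ℕ) : ℝ := Real.log ((n : ℝ) + 2)
/-- mean degree -/
def lamS (p : ℕ → ℝ) (n : ℕ) : ℝ := ((n : ℝ) + 2) * p n
/-- time -/
def tS (p : ℕ → ℝ) (x : ℝ) (n : ℕ) : ℝ := (ellS n + x) / (lamS p n - 1)
/-- inflated p -/
def ppS (p : ℕ → ℝ) (x : ℝ) (n : ℕ) : ℝ := p n / (1 - p n * tS p x n)
/-- inflated mean degree -/
def kS (p : ℕ → ℝ) (x : ℝ) (n : ℕ) : ℝ := ppS p x n * n
/-- cutoff -/
def KS (n : ℕ) : ℝ := Real.exp (3 / 4 * ellS n)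
/-- deflated rate -/
def aS (p : ℕ → ℝ) (n : ℕ) : ℝ := p n * (n - 2 * KS n) - 1

theorem ell_atTop : Tendsto ellS atTop atTop := by
  unfold ellS
  exact Real.tendsto_log_atTop.comp (tendsto_atTop_add_const_right _ _ tendsto_natCast_atTop_atTop)

theorem exp_ell (n : ℕ) : Real.exp (ellS n) = (n : ℝ) + 2 := by
  unfold ellS
  exact Real.exp_log (by positivity)

theorem pow_exp_lim (x r : ℝ) (hr : 0 < r) (k : ℕ) :
    Tendsto (fun n => (ellS n + x) ^ k * Real.exp (-(r * ellS n))) atTop (nhds 0) := by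
  have h1 := tendsto_rpow_mul_exp_neg_mul_atTop_nhds_zero (k : ℝ) r hr
  have h2 : Tendsto (fun n => ellS n + x) atTop atTop := tendsto_atTop_add_const_right _ _ ell_atTop
  have h3 := (h1.comp h2).mul_const (Real.exp (r * x))
  rw [zero_mul] at h3
  refine h3.congr fun n => ?_
  simp only [Function.comp, Real.rpow_natCast]
  rw [mul_assoc, ← Real.exp_add]
  congr 2
  ring

section lims
variable (p : ℕ → ℝ) (hp : ∀ n, 0 ≤ p n ∧ p n ≤ 1) (hlim : Tendsto (lamS p) atTop atTop) (x : ℝ)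

theorem r_lim (f : ℕ → ℝ) (hf : Tendsto f atTop atTop) : 
    Tendsto (fun n => f n / (f n - 1)) atTop (nhds 1) := by
  have h1 : Tendsto (fun n => (1 - (f n)⁻¹)⁻¹) atTop (nhds (1 - 0)⁻¹) :=
    (tendsto_const_nhds.sub hf.inv_tendsto_atTop).inv₀ (by norm_num)
  simp only [sub_zero, inv_one] at h1
  refine h1.congr' ?_
  filter_upwards [hf.eventually_gt_atTop 1] with n hn
  have : f n - 1 ≠ 0 := by linarith
  have : f n ≠ 0 := by linarith
  field_simp

theorem pt_eq (n : ℕ) : p n * tS p x n = 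
    lamS p n / (lamS p n - 1) * ((ellS n + x) * Real.exp (-ellS n)) := by
  rw [Real.exp_neg, exp_ell]
  unfold tS lamS
  have : (n : ℝ) + 2 ≠ 0 := by positivity
  field_simp

include hlim in
theorem pt_mul_lim (k : ℕ) (r : ℝ) (hr : r < 1) :
    Tendsto (fun n => p n * tS p x n * ((ellS n + x) ^ k * Real.exp (r * ellS n))) atTop (nhds 0) := by
  have h1 := (r_lim _ hlim).mul (pow_exp_lim x (1 - r) (by linarith) (k + 1))
  rw [one_mul] at h1
  refine h1.congr fun n => ?_
  rw [pt_eq]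
  have : Real.exp (-((1 - r) * ellS n)) = Real.exp (-ellS n) * Real.exp (r * ellS n) := by
    rw [← Real.exp_add]; congr 1; ring
  rw [this]
  ring

include hlim in
theorem pt_lim : Tendsto (fun n => p n * tS p x n) atTop (nhds 0) := by
  simpa using pt_mul_lim p hlim x 0 0 (by norm_num)

theorem n_ratio : Tendsto (fun n : ℕ => (n : ℝ) / ((n : ℝ) + 2)) atTop (nhds 1) := by
  have h1 : Tendsto (fun n : ℕ => ((n : ℝ) + 2)⁻¹) atTop (nhds 0) :=
    (tendsto_atTop_add_const_right _ _ tendsto_natCast_atTop_atTop).inv_tendsto_atTop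
  have h2 := (tendsto_const_nhds (x := (1 : ℝ))).sub (h1.const_mul 2)
  simp only [mul_zero, sub_zero] at h2
  refine h2.congr fun n => ?_
  have : (n : ℝ) + 2 ≠ 0 := by positivity
  field_simp
  ring

include hlim in
/-- kappa over lambda -/
theorem k_ratio : Tendsto (fun n => kS p x n / lamS p n) atTop (nhds 1) := by
  have h1 := n_ratio.div (tendsto_const_nhds.sub (pt_lim p hlim x)) (by norm_num : (1 : ℝ) - 0 ≠ 0)
  rw [sub_zero, div_one] at h1
  refine h1.congr' ?_
  filter_upwards [hlim.eventually_gt_atTop 0] with n hn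
  simp only [Pi.div_apply]
  unfold kS ppS
  have h2 : (n : ℝ) + 2 ≠ 0 := by positivity
  have h3 : p n ≠ 0 := by
    intro h; simp [lamS, h] at hn
  conv_rhs => unfold lamS
  field_simp

include hlim in
theorem k_atTop : Tendsto (kS p x) atTop atTop := by
  have := (k_ratio p hlim x).pos_mul_atTop one_pos hlim
  refine this.congr' ?_
  filter_upwards [hlim.eventually_gt_atTop 0] with n hn
  field_simp

include hlim in
theorem a_ratio : Tendsto (fun n => aS p n / lamS p n) atTop (nhds 1) := by
  have h0 : Tendsto (fun n => KS n / ((n : ℝ) + 2)) atTop (nhds 0) := by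
    have := pow_exp_lim 0 (1 / 4) (by norm_num) 0
    refine this.congr fun n => ?_
    rw [← exp_ell, KS, ← Real.exp_sub, pow_zero, one_mul]
    congr 1; ring
  have h1 := (n_ratio.sub (h0.const_mul 2)).sub hlim.inv_tendsto_atTop
  simp only [mul_zero, sub_zero] at h1
  refine h1.congr' ?_
  filter_upwards [hlim.eventually_gt_atTop 0] with n hn
  simp only [Pi.inv_apply]
  unfold aS
  have h2 : (n : ℝ) + 2 ≠ 0 := by positivity
  have h3 : p n ≠ 0 := by
    intro h; simp [lamS, h] at hn
  unfold lamS
  field_simp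

include hlim in
theorem a_atTop : Tendsto (aS p) atTop atTop := by
  have := (a_ratio p hlim).pos_mul_atTop one_pos hlim
  refine this.congr' ?_
  filter_upwards [hlim.eventually_gt_atTop 0] with n hn
  field_simp

include hlim in
theorem at_lim : Tendsto (fun n => aS p n * tS p x n - ellS n) atTop (nhds x) := by
  have h1 := pt_mul_lim p hlim x 0 (3 / 4) (by norm_num)
  have h2 := ((pt_lim p hlim x).const_mul 2).add (h1.const_mul 2)
  have h3 := h2.const_sub x
  simp only [mul_zero, add_zero, sub_zero] at h3
  refine h3.congr' ?_
  filter_upwards [hlim.eventually_gt_atTop 1] with n hn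
  have h4 : lamS p n - 1 ≠ 0 := by linarith
  have e : (lamS p n - 1) * tS p x n = ellS n + x := by
    unfold tS; field_simp
  have e2 : aS p n = (lamS p n - 1) - p n * 2 - p n * (2 * KS n) := by unfold aS lamS; ring
  rw [e2, sub_mul, sub_mul, e]
  unfold KS
  ring

include hlim in
theorem kt_lim : Tendsto (fun n => (kS p x n - 1) * tS p x n - ellS n) atTop (nhds x) := by
  have h1 := pt_mul_lim p hlim x 1 0 (by norm_num)
  have h2 := pt_lim p hlim x
  have h3 := ((((r_lim _ hlim).mul h1).sub (h2.const_mul 2)).div (tendsto_const_nhds.sub h2) 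
    (by norm_num : (1 : ℝ) - 0 ≠ 0)).const_add x
  simp only [mul_zero, add_zero, sub_zero, zero_div] at h3
  refine h3.congr' ?_
  filter_upwards [hlim.eventually_gt_atTop 1, h2.eventually_lt_const zero_lt_one] with n hn hn2
  have h4 : lamS p n - 1 ≠ 0 := by linarith
  have h5 : 1 - p n * tS p x n ≠ 0 := by linarith
  have e : (lamS p n - 1) * tS p x n = ellS n + x := by
    unfold tS; field_simp
  have e2 : kS p x n = lamS p n + p n * (lamS p n * tS p x n - 2) / (1 - p n * tS p x n) := by
    unfold kS ppS
    field_simp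
    unfold lamS
    ring
  have e3 : lamS p n / (lamS p n - 1) * (ellS n + x) = lamS p n * tS p x n := by
    unfold tS; ring
  simp only [Pi.div_apply, Pi.sub_apply]
  rw [e2, pow_one, zero_mul, Real.exp_zero, mul_one]
  have e4 : lamS p n / (lamS p n - 1) * (p n * tS p x n * (ellS n + x)) = 
    p n * tS p x n * (lamS p n * tS p x n) := by rw [← e3]; ring
  rw [e4]
  have e5 : (lamS p n + p n * (lamS p n * tS p x n - 2) / (1 - p n * tS p x n) - 1) * tS p x n =
    (lamS p n - 1) * tS p x n + p n * (lamS p n * tS p x n - 2) / (1 - p n * tS p x n) * tS p x n := by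
    ring
  rw [e5, e]
  ring

end lims

/-! ### Part 11: the tail limit -/

theorem ppt_lim (p : ℕ → ℝ) (hlim : Tendsto (lamS p) atTop atTop) (x r : ℝ) (hr : r < 1) :
    Tendsto (fun n => ppS p x n * tS p x n * Real.exp (r * ellS n)) atTop (nhds 0) := by
  have h1 := pt_mul_lim p hlim x 0 r hr
  have h2 := h1.div (tendsto_const_nhds.sub (pt_lim p hlim x)) (by norm_num : (1 : ℝ) - 0 ≠ 0)
  simp only [zero_div] at h2
  refine h2.congr fun n => ?_
  simp only [Pi.div_apply, pow_zero, one_mul]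
  unfold ppS
  ring

theorem bt_lim (p : ℕ → ℝ) (hlim : Tendsto (lamS p) atTop atTop) (x : ℝ) :
    Tendsto (fun n => (kS p x n - 1 + ppS p x n) * (tS p x n / 2) - 1 / 2 * ellS n) atTop
      (nhds (x / 2)) := by
  have h1 := ppt_lim p hlim x 0 (by norm_num)
  have h2 := ((kt_lim p hlim x).add h1).div_const 2
  rw [add_zero] at h2
  refine h2.congr fun n => ?_
  rw [zero_mul, Real.exp_zero]
  ring

theorem half_exp (n : ℕ) : Real.exp (1 / 2 * ellS n) = ((n : ℝ) + 2) * Real.exp (-(1 / 2 * ellS n)) := by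
  rw [← exp_ell, ← Real.exp_add]; congr 1; ring

theorem n_ratio' : Tendsto (fun n : ℕ => ((n : ℝ) + 2) / (n : ℝ)) atTop (nhds 1) := by
  have := n_ratio.inv₀ one_ne_zero
  rw [inv_one] at this
  refine this.congr fun n => ?_
  rw [inv_div]

theorem pp_eq (p : ℕ → ℝ) (x : ℝ) (n : ℕ) (hn : 0 < n) : ppS p x n = kS p x n / n := by
  unfold kS
  have : (n : ℝ) ≠ 0 := by positivity
  field_simp

theorem half_lim0 : Tendsto (fun n => Real.exp (-(1 / 2 * ellS n))) atTop (nhds 0) := by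
  have := pow_exp_lim 0 (1 / 2) (by norm_num) 0
  simpa using this

theorem ppc_lim (p : ℕ → ℝ) (hlim : Tendsto (lamS p) atTop atTop) (x : ℝ) :
    Tendsto (fun n => ppS p x n * (Real.exp ((kS p x n - 1) * (tS p x n / 2)) / (kS p x n - 1)) *
      Real.exp (1 / 2 * ellS n)) atTop (nhds (Real.exp (x / 2))) := by
  have h1 := (Real.continuous_exp.tendsto _).comp ((kt_lim p hlim x).div_const 2)
  have h2 := ((r_lim _ (k_atTop p hlim x)).mul n_ratio').mul h1
  rw [one_mul, one_mul] at h2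
  refine h2.congr' ?_
  filter_upwards [eventually_gt_atTop 0] with n hn
  have e : Real.exp (((kS p x n - 1) * tS p x n - ellS n) / 2) = 
      Real.exp ((kS p x n - 1) * (tS p x n / 2)) * Real.exp (-(1 / 2 * ellS n)) := by
    rw [← Real.exp_add]; congr 1; ring
  simp only [Function.comp]
  rw [e, pp_eq p x n hn, half_exp]
  ring

theorem q_lim (p : ℕ → ℝ) (hlim : Tendsto (lamS p) atTop atTop) (x : ℝ) (hp0 : ∀ n, 0 ≤ p n) :
    Tendsto (fun n => ppS p x n / (kS p x n - 1 + ppS p x n) * Real.exp (1 / 2 * ellS n)) atTop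
      (nhds 0) := by
  have h2 := ((r_lim _ (k_atTop p hlim x)).mul n_ratio').mul half_lim0
  rw [mul_zero] at h2
  refine tendsto_of_tendsto_of_tendsto_of_le_of_le' tendsto_const_nhds h2 ?_ ?_
  · filter_upwards [(k_atTop p hlim x).eventually_gt_atTop 1, 
      (pt_lim p hlim x).eventually_lt_const zero_lt_one] with n hn hn2
    have : 0 ≤ ppS p x n := div_nonneg (hp0 n) (by linarith)
    have : 0 < kS p x n - 1 := by linarith
    positivity
  · filter_upwards [(k_atTop p hlim x).eventually_gt_atTop 1, 
      (pt_lim p hlim x).eventually_lt_const zero_lt_one, eventually_gt_atTop 0] with n hn hn2 hn3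
    have h3 : 0 ≤ ppS p x n := div_nonneg (hp0 n) (by linarith)
    have h4 : 0 < kS p x n - 1 := by linarith
    calc ppS p x n / (kS p x n - 1 + ppS p x n) * Real.exp (1 / 2 * ellS n)
        ≤ ppS p x n / (kS p x n - 1) * Real.exp (1 / 2 * ellS n) := by
          gcongr; linarith
      _ = _ := by rw [half_exp, pp_eq p x n hn3]; ring

theorem wlow_lim (p : ℕ → ℝ) (hlim : Tendsto (lamS p) atTop atTop) (x : ℝ) (hp0 : ∀ n, 0 ≤ p n) (z : ℝ) :
    Tendsto (fun n => wlow (ppS p x n) (kS p x n) (tS p x n / 2) (tS p x n / 2) z) atTop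
      (nhds (z * Real.exp x)) := by
  set u : ℕ → ℝ := fun n => ppS p x n * (tS p x n / 2 + z * (Real.exp ((kS p x n - 1) * (tS p x n / 2)) / (kS p x n - 1)))
    with hu
  have hue : Tendsto (fun n => u n * Real.exp (1 / 2 * ellS n)) atTop (nhds (z * Real.exp (x / 2))) := by
    have := ((ppt_lim p hlim x (1 / 2) (by norm_num)).div_const 2).add ((ppc_lim p hlim x).const_mul z)
    rw [zero_div, zero_add] at this
    refine this.congr fun n => ?_
    simp only [hu]; ring
  have hu0 : Tendsto u atTop (nhds 0) := by
    have := hue.mul half_lim0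
    rw [mul_zero] at this
    refine this.congr fun n => ?_
    rw [mul_assoc, ← Real.exp_add, add_neg_cancel, Real.exp_zero, mul_one]
  have herr : Tendsto (fun n => (Real.exp (u n) - 1 - u n) * Real.exp (1 / 2 * ellS n)) atTop (nhds 0) := by
    have h1 := (hu0.mul hue).abs
    rw [zero_mul, abs_zero] at h1
    refine squeeze_zero_norm' ?_ h1
    filter_upwards [hu0.abs.eventually_le_const (show |(0 : ℝ)| < 1 by norm_num)] with n hn
    rw [Real.norm_eq_abs, abs_mul, Real.abs_exp]
    have h3 := Real.abs_exp_sub_one_sub_id_le hn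
    have e : |u n * (u n * Real.exp (1 / 2 * ellS n))| = u n ^ 2 * Real.exp (1 / 2 * ellS n) := by
      rw [← mul_assoc, ← sq, abs_of_nonneg (by positivity)]
    rw [e]
    exact mul_le_mul_of_nonneg_right h3 (Real.exp_pos _).le
  have hexp := herr.add hue
  have hb := (Real.continuous_exp.tendsto _).comp (bt_lim p hlim x)
  have hq := q_lim p hlim x hp0
  have hq0 := hq.mul half_lim0
  have := ((hexp.add hq).mul hb).sub hq0
  have e : (0 + z * Real.exp (x / 2) + 0) * Real.exp (x / 2) - 0 * 0 = z * Real.exp x := by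
    have : Real.exp x = Real.exp (x / 2) * Real.exp (x / 2) := by rw [← Real.exp_add]; congr 1; ring
    rw [this]; ring
  rw [e] at this
  refine this.congr fun n => ?_
  simp only [Function.comp]
  have e1 : Real.exp ((kS p x n - 1 + ppS p x n) * (tS p x n / 2) - 1 / 2 * ellS n) = 
      Real.exp ((kS p x n - 1 + ppS p x n) * (tS p x n / 2)) * Real.exp (-(1 / 2 * ellS n)) := by
    rw [← Real.exp_add]; congr 1
  have e2 : Real.exp (1 / 2 * ellS n) * Real.exp (-(1 / 2 * ellS n)) = 1 := by
    rw [← Real.exp_add, add_neg_cancel, Real.exp_zero]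
  unfold wlow
  rw [e1]
  change _ = (Real.exp (u n) - 1 + _) * _ + _
  linear_combination (Real.exp (u n) * Real.exp ((kS p x n - 1 + ppS p x n) * (tS p x n / 2)) 
    - Real.exp ((kS p x n - 1 + ppS p x n) * (tS p x n / 2))
    + ppS p x n / (kS p x n - 1 + ppS p x n) * Real.exp ((kS p x n - 1 + ppS p x n) * (tS p x n / 2)) 
    - ppS p x n / (kS p x n - 1 + ppS p x n)) * e2

theorem wlow_nonneg {p' κ T0 T1 z : ℝ} (hp' : 0 ≤ p') (hκ : 1 < κ) (hT0 : 0 ≤ T0) (hT1 : 0 ≤ T1) (hz : 0 ≤ z) :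
    0 ≤ wlow p' κ T0 T1 z := by
  unfold wlow
  have h0 : 0 < κ - 1 := by linarith
  have h1 : 1 ≤ Real.exp (p' * (T1 + z * (Real.exp ((κ - 1) * T1) / (κ - 1)))) := by
    rw [Real.one_le_exp_iff]; positivity
  have h2 : 1 ≤ Real.exp ((κ - 1 + p') * T0) := by
    rw [Real.one_le_exp_iff]; positivity
  have h3 : 0 ≤ p' / (κ - 1 + p') := by positivity
  nlinarith [mul_nonneg (sub_nonneg.2 h1) (sub_nonneg.2 h2), mul_nonneg h3 (sub_nonneg.2 h2)]

/-- limiting tail -/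
def tailS (x : ℝ) : ℝ≥0∞ := ∫⁻ z, ENNReal.ofReal (1 / (1 + z * Real.exp x)) ∂expDist

theorem dct_lim (f : ℕ → ℝ → ℝ) (x : ℝ) (hm : ∀ n, Measurable (f n)) 
    (h0 : ∀ᶠ n in atTop, ∀ z, 0 ≤ z → 0 ≤ f n z)
    (hl : ∀ z, 0 ≤ z → Tendsto (fun n => f n z) atTop (nhds (z * Real.exp x))) :
    Tendsto (fun n => ∫⁻ z, ENNReal.ofReal (1 / (1 + f n z)) ∂expDist) atTop (nhds (tailS x)) := by
  unfold tailS
  refine tendsto_lintegral_filter_of_dominated_convergence (fun _ => 1) ?_ ?_ ?_ ?_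
  · refine Eventually.of_forall fun n => ?_
    have := hm n
    fun_prop
  · filter_upwards [h0] with n hn
    filter_upwards [expDist_ae] with z hz
    rw [← ENNReal.ofReal_one]
    refine ENNReal.ofReal_le_ofReal ?_
    rw [div_le_one (by linarith [hn z hz])]
    linarith [hn z hz]
  · simp
  · filter_upwards [expDist_ae] with z hz
    refine ENNReal.tendsto_ofReal ?_
    refine tendsto_const_nhds.div ((hl z hz).const_add 1) ?_
    positivity

theorem upcoef_lim (p : ℕ → ℝ) (hlim : Tendsto (lamS p) atTop atTop) (x : ℝ) :
    Tendsto (fun n => (Real.exp (aS p n * (tS p x n / 2)) - 1) / aS p n * p n * 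
      Real.exp (aS p n * (tS p x n / 2))) atTop (nhds (Real.exp x)) := by
  have h1 := (Real.continuous_exp.tendsto _).comp (at_lim p hlim x)
  have h2 := (Real.continuous_exp.tendsto _).comp ((at_lim p hlim x).div_const 2)
  have h3 := ((a_ratio p hlim).inv₀ one_ne_zero).mul (h1.sub (h2.mul half_lim0))
  simp only [inv_one, mul_zero, sub_zero, one_mul] at h3
  refine h3.congr fun n => ?_
  simp only [Function.comp]
  have e1 : Real.exp (aS p n * tS p x n - ellS n) = 
      Real.exp (aS p n * (tS p x n / 2)) * Real.exp (aS p n * (tS p x n / 2)) * Real.exp (-ellS n) := by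
    rw [← Real.exp_add, ← Real.exp_add]; congr 1; ring
  have e2 : Real.exp ((aS p n * tS p x n - ellS n) / 2) * Real.exp (-(1 / 2 * ellS n)) = 
      Real.exp (aS p n * (tS p x n / 2)) * Real.exp (-ellS n) := by
    rw [← Real.exp_add, ← Real.exp_add]; congr 1; ring
  rw [e1, e2, inv_div, Real.exp_neg, exp_ell]
  unfold lamS
  have : (n : ℝ) + 2 ≠ 0 := by positivity
  field_simp

theorem eg_lim (p : ℕ → ℝ) (hlim : Tendsto (lamS p) atTop atTop) (x : ℝ) :
    Tendsto (fun n => eg (kS p x n) (tS p x n / 2) / KS n) atTop (nhds 0) := by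
  have h1 := (Real.continuous_exp.tendsto _).comp ((kt_lim p hlim x).div_const 2)
  have h4 := pow_exp_lim 0 (1 / 4) (by norm_num) 0
  have h5 := pow_exp_lim 0 (3 / 4) (by norm_num) 0
  have h2 := (r_lim _ (k_atTop p hlim x)).mul ((h1.mul h4).sub h5)
  simp only [mul_zero, sub_zero, one_mul] at h2
  refine h2.congr fun n => ?_
  simp only [Function.comp, pow_zero, one_mul]
  rw [← Real.exp_add]
  unfold eg KS
  rw [div_eq_mul_inv _ (Real.exp (3 / 4 * ellS n)), ← Real.exp_neg]
  have e1 : Real.exp (((kS p x n - 1) * tS p x n - ellS n) / 2 + -(1 / 4 * ellS n)) = 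
      Real.exp ((kS p x n - 1) * (tS p x n / 2)) * Real.exp (-(3 / 4 * ellS n)) := by
    rw [← Real.exp_add]; congr 1; ring
  rw [e1]; ring

theorem tail_lim (p : ℕ → ℝ) (hp : ∀ n, 0 ≤ p n ∧ p n ≤ 1) (hlim : Tendsto (lamS p) atTop atTop) (x : ℝ) :
    Tendsto (fun n => E0 (nu (p n)) (ENNReal.ofReal (tS p x n / 2)) n (nu (p n)) (ENNReal.ofReal (tS p x n / 2)))
      atTop (nhds (tailS x)) := by
  have hx : Tendsto (fun n => ellS n + x) atTop atTop := tendsto_atTop_add_const_right _ _ ell_atTop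
  have hev : ∀ᶠ n in atTop, 0 < p n ∧ 0 ≤ tS p x n ∧ p n * tS p x n < 1 ∧ 1 < kS p x n ∧ 0 < aS p n := by
    filter_upwards [hlim.eventually_gt_atTop 1, hx.eventually_gt_atTop 0, 
      (pt_lim p hlim x).eventually_lt_const zero_lt_one, (k_atTop p hlim x).eventually_gt_atTop 1, 
      (a_atTop p hlim).eventually_gt_atTop 0] with n h1 h2 h3 h4 h5
    refine ⟨?_, ?_, h3, h4, h5⟩
    · rcases (hp n).1.lt_or_eq with h | h
      · exact h
      · rw [lamS, ← h] at h1; linarith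
    · unfold tS
      have : 0 < lamS p n - 1 := by linarith
      positivity
  have hlow := dct_lim (fun n z => wlow (ppS p x n) (kS p x n) (tS p x n / 2) (tS p x n / 2) z) x
    (fun n => by unfold wlow; fun_prop) (by
      filter_upwards [hev] with n ⟨h1, h2, h3, h4, h5⟩ z hz
      exact wlow_nonneg (div_nonneg h1.le (by linarith)) h4 (by linarith) (by linarith) hz)
    (fun z _ => wlow_lim p hlim x (fun n => (hp n).1) z)
  have hup := dct_lim (fun n z => z * ((Real.exp (aS p n * (tS p x n / 2)) - 1) / aS p n * p n * 
      Real.exp (aS p n * (tS p x n / 2)))) x (fun n => by fun_prop) (by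
      filter_upwards [hev] with n ⟨h1, h2, h3, h4, h5⟩ z hz
      have : 1 ≤ Real.exp (aS p n * (tS p x n / 2)) := by
        rw [Real.one_le_exp_iff]; positivity
      have : 0 ≤ Real.exp (aS p n * (tS p x n / 2)) - 1 := by linarith
      positivity)
    (fun z _ => (upcoef_lim p hlim x).const_mul z)
  have herr : Tendsto (fun n => 2 / aS p n + eg (kS p x n) (tS p x n / 2) / KS n + 
      eg (kS p x n) (tS p x n / 2) / KS n) atTop (nhds 0) := by
    have := (((a_atTop p hlim).inv_tendsto_atTop.const_mul 2).add (eg_lim p hlim x)).add (eg_lim p hlim x)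
    simp only [mul_zero, add_zero] at this
    exact this
  have hup2 := hup.add (ENNReal.tendsto_ofReal herr)
  rw [ENNReal.ofReal_zero, add_zero] at hup2
  refine tendsto_of_tendsto_of_tendsto_of_le_of_le' hlow hup2 ?_ ?_
  · filter_upwards [hev] with n ⟨h1, h2, h3, h4, h5⟩
    have hctx := nu_ctx h1 (hp n).2 (t := tS p x n / 2 + tS p x n / 2) (by rwa [add_halves])
    rw [add_halves] at hctx
    have hctx : Ctx (nu (p n)) (p n) (ppS p x n) (tS p x n / 2 + tS p x n / 2) := by
      rw [add_halves]; exact hctx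
    exact stage0_lower n hctx (div_pos h1 (by linarith)) h4 (by linarith) (by linarith)
  · filter_upwards [hev] with n ⟨h1, h2, h3, h4, h5⟩
    have hctx := nu_ctx h1 (hp n).2 (t := tS p x n / 2 + tS p x n / 2) (by rwa [add_halves])
    rw [add_halves] at hctx
    have hctx : Ctx (nu (p n)) (p n) (ppS p x n) (tS p x n / 2 + tS p x n / 2) := by
      rw [add_halves]; exact hctx
    exact stage0_upper n hctx (div_pos h1 (by linarith)) h4 (by linarith) (by linarith)
      (Real.exp_pos _) h5 (by unfold aS; linarith)

/-! ### Part 12: Gumbel and the conclusion -/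

theorem lint_gumbel (g : ℝ → ℝ≥0∞) (hg : Measurable g) :
    ∫⁻ x, g x ∂gumbelDist = ∫⁻ z, g (-Real.log z) ∂expDist := by
  rw [lint_expDist _ (by fun_prop)]
  unfold gumbelDist
  rw [lintegral_withDensity_eq_lintegral_mul _ (by fun_prop) hg]
  have hder : ∀ x ∈ (Set.univ : Set ℝ), 
      HasDerivWithinAt (fun x : ℝ => Real.exp (-x)) (-Real.exp (-x)) Set.univ x := fun x _ => by
    have := (hasDerivAt_neg x).exp
    exact (this.congr_deriv (by ring)).hasDerivWithinAt
  have hinj : Set.InjOn (fun x : ℝ => Real.exp (-x)) Set.univ := fun a _ b _ h => by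
    simpa using h
  have himg : (fun x : ℝ => Real.exp (-x)) '' Set.univ = Set.Ioi 0 := by
    ext y
    constructor
    · rintro ⟨x, _, rfl⟩; exact Real.exp_pos _
    · intro hy
      exact ⟨-Real.log y, trivial, by simp [Real.exp_log (show 0 < y from hy)]⟩
  have key := lintegral_image_eq_lintegral_abs_deriv_mul MeasurableSet.univ hder hinj 
    (fun z => ENNReal.ofReal (Real.exp (-z)) * g (-Real.log z))
  rw [himg, Measure.restrict_univ] at key
  simp only [abs_neg, Real.abs_exp, Real.log_exp, neg_neg] at key
  rw [key]
  refine lintegral_congr fun x => ?_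
  simp only [Pi.mul_apply]
  rw [← mul_assoc, ← ENNReal.ofReal_mul (Real.exp_pos _).le, ← Real.exp_add]
  congr 3

theorem expDist_pos : ∀ᵐ z ∂expDist, 0 < z := by
  have h1 : expDist (Set.Ioi 0) = 1 := by rw [expDist_Ioi le_rfl]; simp
  have := (prob_compl_eq_zero_iff (μ := expDist) (measurableSet_Ioi (a := (0 : ℝ)))).2 h1
  exact this

instance gumbel_prob : IsProbabilityMeasure gumbelDist := ⟨by
  have := lint_gumbel (fun _ => 1) measurable_const
  simpa using this⟩

theorem gumbel_Iio (y : ℝ) : gumbelDist (Set.Iio y) = ENNReal.ofReal (Real.exp (-Real.exp (-y))) := by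
  rw [← lintegral_indicator_one measurableSet_Iio, 
    lint_gumbel _ (measurable_one.indicator measurableSet_Iio), ← expDist_Ioi (Real.exp_pos _).le,
    ← lintegral_indicator_one measurableSet_Ioi]
  refine lintegral_congr_ae ?_
  filter_upwards [expDist_pos] with z hz
  have : -Real.log z ∈ Set.Iio y ↔ z ∈ Set.Ioi (Real.exp (-y)) := by
    rw [Set.mem_Iio, Set.mem_Ioi, ← Real.lt_log_iff_exp_lt hz, neg_lt]
  by_cases h : z ∈ Set.Ioi (Real.exp (-y))
  · rw [Set.indicator_of_mem h, Set.indicator_of_mem (this.2 h)]; rfl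
  · rw [Set.indicator_of_notMem h, Set.indicator_of_notMem (fun h' => h (this.1 h'))]

theorem meas_comb : Measurable (fun v : ℝ × ℝ × ℝ => v.1 + v.2.1 - v.2.2) := by fun_prop

instance gumbelLimit_prob : IsProbabilityMeasure gumbelLimitLaw := 
  Measure.isProbabilityMeasure_map meas_comb.aemeasurable

theorem gumbelLimit_Ioi (x : ℝ) : gumbelLimitLaw (Set.Ioi x) = tailS x := by
  unfold gumbelLimitLaw
  have hms := meas_comb (measurableSet_Ioi (a := x))
  rw [Measure.map_apply meas_comb measurableSet_Ioi, Measure.prod_apply hms]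
  have h1 : ∀ a, (gumbelDist.prod gumbelDist) (Prod.mk a ⁻¹' ((fun v : ℝ × ℝ × ℝ => v.1 + v.2.1 - v.2.2) ⁻¹' Set.Ioi x))
      = ENNReal.ofReal (1 / (1 + Real.exp (-a) * Real.exp x)) := by
    intro a
    rw [Measure.prod_apply (measurable_prodMk_left hms)]
    have h2 : ∀ b, gumbelDist (Prod.mk b ⁻¹' (Prod.mk a ⁻¹' ((fun v : ℝ × ℝ × ℝ => v.1 + v.2.1 - v.2.2) ⁻¹' Set.Ioi x)))
        = ENNReal.ofReal (Real.exp (-Real.exp (-(a + b - x)))) := by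
      intro b
      rw [← gumbel_Iio]
      congr 1
      ext c
      simp only [Set.mem_preimage, Set.mem_Ioi, Set.mem_Iio]
      constructor <;> intro h <;> linarith
    simp_rw [h2]
    rw [lint_gumbel _ (by fun_prop)]
    have h3 := lint_exp_exp (a := 0) (b := Real.exp (-a) * Real.exp x) (by positivity)
    rw [neg_zero, Real.exp_zero] at h3
    rw [← h3]
    refine lintegral_congr_ae ?_
    filter_upwards [expDist_pos] with z hz
    have e : -(a + -Real.log z - x) = Real.log z + (-a + x) := by ring
    rw [e, Real.exp_add, Real.exp_add, Real.exp_log hz, zero_add]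
  simp_rw [h1]
  rw [lint_gumbel _ (by fun_prop)]
  unfold tailS
  refine lintegral_congr_ae ?_
  filter_upwards [expDist_pos] with z hz
  rw [neg_neg, Real.exp_log hz]

theorem weak_of_tail (m : ℕ → Measure ℝ) (ν : Measure ℝ) [IsProbabilityMeasure ν]
    (hm : ∀ᶠ n in atTop, IsProbabilityMeasure (m n))
    (h : ∀ x, Tendsto (fun n => m n (Set.Ioi x)) atTop (nhds (ν (Set.Ioi x))))
    (g : ℝ → ℝ) (hg : Continuous g) (hb : ∃ C, ∀ x, |g x| ≤ C) :
    Tendsto (fun n => ∫ x, g x ∂(m n)) atTop (nhds (∫ x, g x ∂ν)) := by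
  classical
  obtain ⟨C, hC⟩ := hb
  let P : ℕ → ProbabilityMeasure ℝ := fun n => 
    if hn : IsProbabilityMeasure (m n) then ⟨m n, hn⟩ else ⟨ν, inferInstance⟩
  have hP : ∀ᶠ n in atTop, (P n : Measure ℝ) = m n := by
    filter_upwards [hm] with n hn
    have e : P n = ⟨m n, hn⟩ := dif_pos hn
    rw [e]
    rfl
  let N : ProbabilityMeasure ℝ := ⟨ν, inferInstance⟩
  have hlim : Tendsto P atTop (nhds N) := by
    refine IsPiSystem.tendsto_probabilityMeasure_of_tendsto_of_mem 
      (S := {s | ∃ a b : ℝ, s = Set.Ioc a b}) ?_ ?_ ?_ ?_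
    · rintro _ ⟨a, b, rfl⟩ _ ⟨c, d, rfl⟩ _
      exact ⟨_, _, Set.Ioc_inter_Ioc⟩
    · rintro _ ⟨a, b, rfl⟩; exact measurableSet_Ioc
    · intro u hu x hx
      obtain ⟨ε, hε, hsub⟩ := Metric.isOpen_iff.1 hu x hx
      refine ⟨Set.Ioc (x - ε / 2) (x + ε / 2), ⟨_, _, rfl⟩, 
        Ioc_mem_nhds (by linarith) (by linarith), fun y hy => hsub ?_⟩
      rw [Metric.mem_ball, Real.dist_eq, abs_lt]
      constructor <;> linarith [hy.1, hy.2]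
    · rintro _ ⟨a, b, rfl⟩
      rcases lt_or_ge b a with hab | hab
      · rw [Set.Ioc_eq_empty (not_lt.2 hab.le)]; simp
      have key : ∀ Q : ProbabilityMeasure ℝ, (Q (Set.Ioc a b) : ℝ≥0∞) = 
          (Q : Measure ℝ) (Set.Ioi a) - (Q : Measure ℝ) (Set.Ioi b) := by
        intro Q
        rw [ProbabilityMeasure.ennreal_coeFn_eq_coeFn_toMeasure, 
          ← measure_sdiff (Set.Ioi_subset_Ioi hab) measurableSet_Ioi.nullMeasurableSet (measure_ne_top _ _)]
        congr 1
        ext y; simp [Set.mem_Ioc]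
      rw [← ENNReal.tendsto_coe]
      simp_rw [key]
      have := ENNReal.Tendsto.sub (h a) (h b) (Or.inl (measure_ne_top _ _))
      refine this.congr' ?_
      filter_upwards [hP] with n hn
      rw [hn]
  rw [ProbabilityMeasure.tendsto_iff_forall_integral_tendsto] at hlim
  have := hlim (BoundedContinuousFunction.ofNormedAddCommGroup g hg C hC)
  refine this.congr' ?_
  filter_upwards [hP] with n hn
  rw [hn]
  rfl

theorem tailS_lim : Tendsto tailS atTop (nhds 0) := by
  have h1 := tendsto_measure_Iic_atTop gumbelLimitLaw
  rw [measure_univ] at h1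
  have h2 := ENNReal.Tendsto.sub (tendsto_const_nhds (x := (1 : ℝ≥0∞)) (f := atTop)) h1 (Or.inl ENNReal.one_ne_top)
  rw [tsub_self] at h2
  refine h2.congr fun x => ?_
  rw [← gumbelLimit_Ioi, ← Set.compl_Iic, prob_compl_eq_one_sub measurableSet_Iic]

theorem weight_main
    (p : ℕ → ℝ) (hp : ∀ n, 0 ≤ p n ∧ p n ≤ 1)
    (hlim : Tendsto (lamS p) atTop atTop)
    (Ω : ℕ → Type) (mΩ : ∀ n, MeasurableSpace (Ω n)) (μ : ∀ n, Measure (Ω n))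
    (hμ : ∀ n, IsProbabilityMeasure (μ n))
    (Z : ∀ n, Sym2 (Fin (n + 2)) → Ω n → Bool × ℝ)
    (hZmeas : ∀ n e, Measurable (Z n e))
    (hindep : ∀ n, iIndepFun (Z n) (μ n))
    (hlaw : ∀ n e, (μ n).map (Z n e) = (bernoulliDist (p n)).prod expDist)
    (W : ∀ n, Ω n → ℝ)
    (hW : ∀ n ω, W n ω = (minWeight (effWeight (fun e => Z n e ω)) 0 1).toReal)
    (Conn : ∀ n, Set (Ω n))
    (hConn : ∀ n, Conn n = {ω | (theGraph (fun e => Z n e ω)).Reachable 0 1}) 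
    (g : ℝ → ℝ) (hg : Continuous g) (hb : ∃ C, ∀ x, |g x| ≤ C) :
      Tendsto (fun n : ℕ =>
          ∫ ω, g ((lamS p n - 1) * W n ω - ellS n) ∂((μ n)[|Conn n]))
        atTop (nhds (∫ x, g x ∂gumbelLimitLaw)) := by
  set mw : ∀ n, Ω n → ℝ≥0∞ := fun n ω => minWeight (effWeight (fun e => Z n e ω)) 0 1 with hmw
  have hmwm : ∀ n, Measurable (mw n) := fun n => measurable_minWeight (Z n) (hZmeas n)
  have hWm : ∀ n, Measurable (W n) := fun n => by
    have : W n = fun ω => (mw n ω).toReal := funext fun ω => hW n ω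
    rw [this]; exact (hmwm n).ennreal_toReal
  have hC : ∀ n, Conn n = {ω | mw n ω = ⊤}ᶜ := by
    intro n
    rw [hConn n]
    ext ω
    rw [Set.mem_compl_iff, Set.mem_ofPred_eq, Set.mem_ofPred_eq, minWeight_lt_top_iff, lt_top_iff_ne_top]
  have hTm : ∀ n, MeasurableSet {ω | mw n ω = ⊤} := fun n => hmwm n (measurableSet_singleton ⊤)
  have hCm : ∀ n, MeasurableSet (Conn n) := fun n => by rw [hC n]; exact (hTm n).compl
  have hx : ∀ x : ℝ, Tendsto (fun n => ellS n + x) atTop atTop := fun x =>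
    tendsto_atTop_add_const_right _ _ ell_atTop
  have hev : ∀ x : ℝ, ∀ᶠ n in atTop, 0 ≤ tS p x n ∧ 1 < lamS p n := by
    intro x
    filter_upwards [hlim.eventually_gt_atTop 1, (hx x).eventually_gt_atTop 0] with n h1 h2
    refine ⟨?_, h1⟩
    unfold tS
    have : 0 < lamS p n - 1 := by linarith
    positivity
  have htail : ∀ x, Tendsto (fun n => μ n {ω | ENNReal.ofReal (tS p x n) < mw n ω}) atTop (nhds (tailS x)) := by
    intro x
    refine (tail_lim p hp hlim x).congr' ?_
    filter_upwards [hev x] with n ⟨hn, _⟩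
    have := hμ n
    rw [← prob_eq (hp n).1 (hp n).2 (by linarith) (by linarith) (μ n) (Z n) (hZmeas n) (hindep n) (hlaw n),
      add_halves]
  have hq : Tendsto (fun n => μ n {ω | mw n ω = ⊤}) atTop (nhds 0) := by
    rw [ENNReal.tendsto_nhds_zero]
    intro ε hε
    obtain ⟨x, hxε⟩ := (tailS_lim.eventually_lt_const hε).exists
    filter_upwards [(htail x).eventually_lt_const hxε] with n hn
    refine le_trans (measure_mono ?_) hn.le
    intro ω hω
    rw [Set.mem_ofPred_eq] at hω ⊢
    rw [hω]; exact ENNReal.ofReal_lt_top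
  have hμC : Tendsto (fun n => μ n (Conn n)) atTop (nhds 1) := by
    have := ENNReal.Tendsto.sub (tendsto_const_nhds (x := (1 : ℝ≥0∞)) (f := atTop)) hq (Or.inl ENNReal.one_ne_top)
    rw [tsub_zero] at this
    refine this.congr fun n => ?_
    have := hμ n
    rw [hC n, prob_compl_eq_one_sub (hTm n)]
  have hYm : ∀ n, Measurable (fun ω => (lamS p n - 1) * W n ω - ellS n) := fun n => by
    have := hWm n
    fun_prop
  have hmain := weak_of_tail (fun n => ((μ n)[|Conn n]).map (fun ω => (lamS p n - 1) * W n ω - ellS n))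
    gumbelLimitLaw ?_ ?_ g hg hb
  · refine hmain.congr fun n => ?_
    exact integral_map (hYm n).aemeasurable hg.aestronglyMeasurable
  · filter_upwards [hμC.eventually_const_lt (show (0 : ℝ≥0∞) < 1 by norm_num)] with n hn
    have := hμ n
    have : IsProbabilityMeasure ((μ n)[|Conn n]) := cond_isProbabilityMeasure hn.ne'
    exact Measure.isProbabilityMeasure_map (hYm n).aemeasurable
  · intro x
    rw [gumbelLimit_Ioi]
    have h1 := ENNReal.Tendsto.sub (htail x) hq (Or.inr ENNReal.zero_ne_top)
    rw [tsub_zero] at h1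
    have h2 := ENNReal.Tendsto.mul (hμC.inv) (Or.inl (by simp)) h1 (Or.inr (by simp))
    rw [inv_one, one_mul] at h2
    refine h2.congr' ?_
    filter_upwards [hev x] with n ⟨hn, hn1⟩
    have := hμ n
    rw [Measure.map_apply (hYm n) measurableSet_Ioi, cond_apply (hCm n)]
    congr 1
    rw [← measure_sdiff _ (hTm n).nullMeasurableSet (measure_ne_top _ _)]
    · congr 1
      ext ω
      rw [hC n]
      simp only [Set.mem_sdiff, Set.mem_inter_iff, Set.mem_compl_iff, Set.mem_preimage, Set.mem_Ioi, 
        Set.mem_ofPred_eq]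
      rw [and_comm]
      refine and_congr_right fun hne => ?_
      have e : W n ω = (mw n ω).toReal := hW n ω
      rw [ENNReal.ofReal_lt_iff_lt_toReal hn hne, ← e]
      unfold tS
      rw [div_lt_iff₀ (by linarith)]
      constructor <;> intro h <;> linarith
    · intro ω hω
      rw [Set.mem_ofPred_eq] at hω ⊢
      rw [hω]; exact ENNReal.ofReal_lt_top

/-- **Limit of the minimal weight in the dense regime** (Corollary 1.4(b) of
Bhamidi–van der Hofstad–Hooghiemstra): if `λₙ = n pₙ → ∞`, then the conditional law of
`(λₙ - 1) Wₙ - log n`, given that the two uniformly chosen vertices are connected, converges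
weakly to the law of `M₁ + M₂ - M₃` with `M₁, M₂, M₃` i.i.d. standard Gumbel (CDF
`Λ(x) = exp(-e^{-x})`). -/
theorem weight_limit_dense
    (p : ℕ → ℝ) (hp : ∀ n, 0 ≤ p n ∧ p n ≤ 1)
    (hlim : Tendsto (fun n : ℕ => ((n : ℝ) + 2) * p n) atTop atTop)
    (Ω : ℕ → Type) (mΩ : ∀ n, MeasurableSpace (Ω n)) (μ : ∀ n, Measure (Ω n))
    (hμ : ∀ n, IsProbabilityMeasure (μ n))
    (Z : ∀ n, Sym2 (Fin (n + 2)) → Ω n → Bool × ℝ)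
    (hZmeas : ∀ n e, Measurable (Z n e))
    (hindep : ∀ n, iIndepFun (Z n) (μ n))
    (hlaw : ∀ n e, (μ n).map (Z n e) = (bernoulliDist (p n)).prod expDist)
    (W : ∀ n, Ω n → ℝ)
    (hW : ∀ n ω, W n ω = (minWeight (effWeight (fun e => Z n e ω)) 0 1).toReal)
    (Conn : ∀ n, Set (Ω n))
    (hConn : ∀ n, Conn n = {ω | (theGraph (fun e => Z n e ω)).Reachable 0 1}) :
    ∀ g : ℝ → ℝ, Continuous g → (∃ C, ∀ x, |g x| ≤ C) →
      Tendsto (fun n : ℕ =>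
          ∫ ω, g ((((n : ℝ) + 2) * p n - 1) * W n ω - Real.log ((n : ℝ) + 2))
            ∂((μ n)[|Conn n]))
        atTop (nhds (∫ x, g x ∂gumbelLimitLaw)) := by
  intro g hg hb
  exact weight_main p hp hlim Ω mΩ μ hμ Z hZmeas hindep hlaw W hW Conn hConn g hg hb

end
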